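/- Let Ω ⊆ ℝ² be a bounded convex polygonal domain with 2n edges all of length 1, n ≥ 2, with vertices p_0, …, p_{2n−1} in positively oriented cyclic order. Then there exists a Jenkins–Serrin graph on Ω (a minimal graph u on Ω with u → +∞ at the edges (p_{2i}, p_{2i+1}) and u → −∞ at the edges (p_{2i−1}, p_{2i})) if and only if Ω is not special, i.e., if and only if it is not the case that n ≥ 3 and the boundary of Ω is a parallelogram with two sides of length 1 and two sides of length n−1. -/

import Mathlib

open Set Filter Topology Metric
open scoped RealInnerProductSpace

noncomputable section

/-- The plane `ℝ²` with the Euclidean metric. -/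
abbrev Pt : Type := EuclideanSpace ℝ (Fin 2)

/-- The point of `ℝ²` with coordinates `(a, b)`. -/
def vec2 (a b : ℝ) : Pt := (WithLp.equiv 2 (Fin 2 → ℝ)).symm ![a, b]

/-- `W_u = √(1 + ‖∇u‖²)`. -/
def Wu (u : Pt → ℝ) (p : Pt) : ℝ := Real.sqrt (1 + ‖gradient u p‖ ^ 2)

/-- The conjugate vector field `F_u = (−∂₂u/W_u, ∂₁u/W_u)` of a minimal graph `u`. -/
def conjField (u : Pt → ℝ) (p : Pt) : Pt :=
  (Wu u p)⁻¹ • vec2 (-(gradient u p 1)) (gradient u p 0)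

/-- `u` is a minimal graph on the open set `Ω`: it is `C²` on `Ω` and satisfies the minimal
surface equation `div (∇u / √(1 + ‖∇u‖²)) = 0` there, the divergence being the sum of the
partial derivatives of the components of the normalized gradient field. -/
def MinimalGraph (Ω : Set Pt) (u : Pt → ℝ) : Prop :=
  IsOpen Ω ∧ ContDiffOn ℝ 2 u Ω ∧
    ∀ p ∈ Ω, (∑ i : Fin 2,
      fderiv ℝ (fun q => (Wu u q)⁻¹ • gradient u q) p (EuclideanSpace.single i 1) i) = 0

/-- `ψ` is a conjugate function of `u` on `Ω`: it is differentiable with `∇ψ = F_u` on `Ω`. -/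
def IsConjugate (Ω : Set Pt) (u ψ : Pt → ℝ) : Prop :=
  ∀ p ∈ Ω, DifferentiableAt ℝ ψ p ∧ gradient ψ p = conjField u p

/-- The planar cross product `v₁ w₂ − v₂ w₁`. -/
def cross2 (v w : Pt) : ℝ := v 0 * w 1 - v 1 * w 0

/-- A bounded convex polygonal domain with `2n` edges, all of length one, whose vertices
`vtx 0, vtx 1, …` are listed in positively oriented cyclic order. -/
structure UnitPolygon (n : ℕ) : Type where
  n_ge : 2 ≤ n
  Ω : Set Pt
  vtx : ZMod (2 * n) → Pt
  isOpen : IsOpen Ω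
  convex : Convex ℝ Ω
  isBounded : Bornology.IsBounded Ω
  nonempty : Ω.Nonempty
  inj : Function.Injective vtx
  unit_edges : ∀ i, dist (vtx i) (vtx (i + 1)) = 1
  frontier_eq : frontier Ω = ⋃ i, segment ℝ (vtx i) (vtx (i + 1))
  pos_orient : ∀ i, 0 ≤ cross2 (vtx (i + 1) - vtx i) (vtx (i + 2) - vtx (i + 1))

/-- A bounded unit polygon with `2n` edges is special if `n ≥ 3` and its boundary is a
parallelogram with two sides of length one and two sides of length `n − 1`. -/
def UnitPolygon.IsSpecial {n : ℕ} (P : UnitPolygon n) : Prop :=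
  3 ≤ n ∧ ∃ q v w : Pt, ‖v‖ = 1 ∧ ‖w‖ = (n : ℝ) - 1 ∧
    frontier P.Ω = segment ℝ q (q + v) ∪ segment ℝ (q + v) (q + v + w) ∪
      segment ℝ (q + v + w) (q + w) ∪ segment ℝ (q + w) q

/-- The Jenkins–Serrin graph on a unit polygon: a minimal graph taking boundary values
`+∞` on the edges `(vtx (2i), vtx (2i+1))` and `−∞` on the edges `(vtx (2i−1), vtx (2i))`. -/
def JSGraph {n : ℕ} (P : UnitPolygon n) (u : Pt → ℝ) : Prop :=
  MinimalGraph P.Ω u ∧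
    ∀ i : ZMod (2 * n), ∀ t ∈ openSegment ℝ (P.vtx i) (P.vtx (i + 1)),
      (Even i.val → Tendsto u (𝓝[P.Ω] t) atTop) ∧
      (¬ Even i.val → Tendsto u (𝓝[P.Ω] t) atBot)


/-! ### Plane vector algebra -/

theorem pt_ext {v w : Pt} (h0 : v 0 = w 0) (h1 : v 1 = w 1) : v = w := by
  ext i; fin_cases i
  · exact h0
  · exact h1

theorem vec2_zero (a b : ℝ) : vec2 a b 0 = a := rfl
theorem vec2_one (a b : ℝ) : vec2 a b 1 = b := rfl

theorem pt_norm_sq (v : Pt) : ‖v‖ ^ 2 = v 0 ^ 2 + v 1 ^ 2 := by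
  rw [EuclideanSpace.norm_sq_eq]; simp [Fin.sum_univ_two]

def dot2 (v w : Pt) : ℝ := v 0 * w 0 + v 1 * w 1

theorem unit_sq {v : Pt} (h : ‖v‖ = 1) : v 0 ^ 2 + v 1 ^ 2 = 1 := by
  rw [← pt_norm_sq, h]; norm_num

/-- parallel unit vectors -/
theorem unit_parallel {v w : Pt} (hv : ‖v‖ = 1) (hw : ‖w‖ = 1) (h : cross2 v w = 0) :
    w = v ∨ w = -v := by
  have h1 := unit_sq hv
  have h2 := unit_sq hw
  unfold cross2 at h
  have h3 : (v 0 * w 0 + v 1 * w 1) ^ 2 = 1 := by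
    have : (v 0 * w 0 + v 1 * w 1) ^ 2 + (v 0 * w 1 - v 1 * w 0) ^ 2 =
      (v 0 ^ 2 + v 1 ^ 2) * (w 0 ^ 2 + w 1 ^ 2) := by ring
    rw [h, h1, h2] at this; linarith
  have e0 : w 0 = (v 0 * w 0 + v 1 * w 1) * v 0 := by
    linear_combination (-(w 0)) * h1 - v 1 * h
  have e1 : w 1 = (v 0 * w 0 + v 1 * w 1) * v 1 := by
    linear_combination (-(w 1)) * h1 + v 0 * h
  have h5 : (v 0 * w 0 + v 1 * w 1) = 1 ∨ (v 0 * w 0 + v 1 * w 1) = -1 := by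
    apply sq_eq_sq_iff_eq_or_eq_neg.mp; rw [h3]; norm_num
  rcases h5 with h4 | h4
  · left; rw [h4] at e0 e1; exact pt_ext (by linarith) (by linarith)
  · right; rw [h4] at e0 e1; exact pt_ext (by simp; linarith) (by simp; linarith)

theorem cross2_add_right (u v w : Pt) : cross2 u (v + w) = cross2 u v + cross2 u w := by
  simp [cross2]; ring
theorem cross2_sub_right (u v w : Pt) : cross2 u (v - w) = cross2 u v - cross2 u w := by
  simp [cross2]; ring
theorem cross2_smul_right (u w : Pt) (c : ℝ) : cross2 u (c • w) = c * cross2 u w := by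
  simp [cross2]; ring
theorem cross2_neg_right (u w : Pt) : cross2 u (-w) = - cross2 u w := by
  simp [cross2]; ring
theorem cross2_neg_left (u w : Pt) : cross2 (-u) w = - cross2 u w := by
  simp [cross2]; ring
theorem cross2_self (u : Pt) : cross2 u u = 0 := by
  simp [cross2]; ring
theorem cross2_comm (u v : Pt) : cross2 u v = - cross2 v u := by
  simp [cross2]; ring
theorem dot2_add_right (u v w : Pt) : dot2 u (v + w) = dot2 u v + dot2 u w := by
  simp [dot2]; ring
theorem dot2_sub_right (u v w : Pt) : dot2 u (v - w) = dot2 u v - dot2 u w := by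
  simp [dot2]; ring
theorem dot2_smul_right (u w : Pt) (c : ℝ) : dot2 u (c • w) = c * dot2 u w := by
  simp [dot2]; ring
theorem dot2_neg_right (u w : Pt) : dot2 u (-w) = - dot2 u w := by
  simp [dot2]; ring

theorem continuous_cross2 (u : Pt) : Continuous (fun v => cross2 u v) := by
  unfold cross2; fun_prop

/-! ### Structure of unit polygons -/

namespace UnitPolygon

variable {n : ℕ} (P : UnitPolygon n)

/-- the `k`-th edge vector -/
def e (k : ZMod (2 * n)) : Pt := P.vtx (k + 1) - P.vtx k

theorem neZero {n : ℕ} (P : UnitPolygon n) : NeZero (2 * n) := ⟨by have := P.n_ge; omega⟩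

theorem norm_e (k : ZMod (2 * n)) : ‖P.e k‖ = 1 := by
  have := P.unit_edges k
  rw [dist_comm, dist_eq_norm] at this; exact this

theorem cross_e_succ (k : ZMod (2 * n)) : 0 ≤ cross2 (P.e k) (P.e (k + 1)) := by
  have := P.pos_orient k
  unfold e
  have h : k + 1 + 1 = k + 2 := by ring
  rw [h]; exact this

theorem two_ne_zero' {n : ℕ} (P : UnitPolygon n) : (2 : ZMod (2 * n)) ≠ 0 := by
  have := P.n_ge
  intro h
  have h' : ((2 : ℕ) : ZMod (2 * n)) = 0 := by exact_mod_cast h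
  rw [ZMod.natCast_eq_zero_iff] at h'
  have := Nat.le_of_dvd (by norm_num) h'
  omega

theorem e_succ_ne_neg (k : ZMod (2 * n)) : P.e (k + 1) ≠ -P.e k := by
  intro h
  unfold e at h
  have h1 : P.vtx (k + 1 + 1) = P.vtx k := by
    have := sub_eq_iff_eq_add.mp h
    rw [this]; abel
  have := P.inj h1
  apply P.two_ne_zero'
  have h2 : k + 1 + 1 - k = 0 := by rw [this]; ring
  rw [← h2]; ring

theorem e_succ_eq (k : ZMod (2 * n)) (h : cross2 (P.e k) (P.e (k + 1)) = 0) :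
    P.e (k + 1) = P.e k := by
  rcases unit_parallel (P.norm_e k) (P.norm_e (k + 1)) h with h | h
  · exact h
  · exact absurd h (P.e_succ_ne_neg k)

theorem seg_sub_frontier (k : ZMod (2 * n)) :
    segment ℝ (P.vtx k) (P.vtx (k + 1)) ⊆ frontier P.Ω := by
  rw [P.frontier_eq]
  exact subset_iUnion (fun i => segment ℝ (P.vtx i) (P.vtx (i + 1))) k

theorem vtx_mem_frontier (k : ZMod (2 * n)) : P.vtx k ∈ frontier P.Ω :=
  P.seg_sub_frontier k (left_mem_segment ℝ _ _)

theorem vtx_mem_closure (k : ZMod (2 * n)) : P.vtx k ∈ closure P.Ω :=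
  frontier_subset_closure (P.vtx_mem_frontier k)

/-- Each edge line supports the domain, with some sign. -/
theorem edge_sign (k : ZMod (2 * n)) :
    (∀ x ∈ P.Ω, 0 < cross2 (P.e k) (x - P.vtx k)) ∨
    (∀ x ∈ P.Ω, cross2 (P.e k) (x - P.vtx k) < 0) := by
  set m := midpoint ℝ (P.vtx k) (P.vtx (k + 1)) with hm
  have hmF : m ∈ frontier P.Ω := P.seg_sub_frontier k (midpoint_mem_segment _ _)
  have hmN : m ∉ P.Ω := by
    rw [P.isOpen.frontier_eq] at hmF; exact hmF.2
  obtain ⟨l, hl⟩ := geometric_hahn_banach_open_point P.convex P.isOpen hmN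
  have hcl : ∀ y ∈ closure P.Ω, l y ≤ l m := by
    intro y hy
    have : closure P.Ω ⊆ {y | l y ≤ l m} :=
      closure_minimal (fun z hz => (hl z hz).le) (isClosed_le l.continuous continuous_const)
    exact this hy
  have h1 := hcl _ (P.vtx_mem_closure k)
  have h2 := hcl _ (P.vtx_mem_closure (k + 1))
  have hlm : l m = (l (P.vtx k) + l (P.vtx (k + 1))) / 2 := by
    rw [hm, midpoint_eq_smul_add, map_smul, map_add]; simp; ring
  have hle : l (P.e k) = 0 := by unfold e; rw [map_sub]; linarith
  have hlv : l (P.vtx k) = l m := by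
    have : l (P.vtx (k+1)) - l (P.vtx k) = 0 := by rw [← map_sub]; exact hle
    linarith
  -- l is a multiple of cross
  have hrep : ∀ v : Pt, l v = l (vec2 1 0) * v 0 + l (vec2 0 1) * v 1 := by
    intro v
    have : v = v 0 • vec2 1 0 + v 1 • vec2 0 1 := by
      apply pt_ext <;> simp [vec2_zero, vec2_one]
    conv_lhs => rw [this]
    rw [map_add, map_smul, map_smul]; simp; ring
  set α := l (vec2 1 0)
  set β := l (vec2 0 1)
  set w := P.e k with hw
  have hu := unit_sq (P.norm_e k)
  rw [← hw] at hu
  rw [hrep] at hle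
  have key : ∀ x ∈ P.Ω, (-α * w 1 + β * w 0) * cross2 w (x - P.vtx k) < 0 := by
    intro x hx
    have h := hl x hx
    rw [← hlv] at h
    have h' : l (x - P.vtx k) < 0 := by rw [map_sub]; linarith
    rw [hrep] at h'
    set y := x - P.vtx k
    have : (-α * w 1 + β * w 0) * cross2 w y = α * y 0 + β * y 1 := by
      unfold cross2
      linear_combination (-(w 0) * y 0 - w 1 * y 1) * hle + (α * y 0 + β * y 1) * hu
    rw [this]; exact h'
  rcases lt_trichotomy (-α * w 1 + β * w 0) 0 with h | h | h
  · left; intro x hx; have := key x hx; nlinarith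
  · exfalso; obtain ⟨x, hx⟩ := P.nonempty; have := key x hx; rw [h] at this; linarith
  · right; intro x hx; have := key x hx; nlinarith

theorem zmod_induction {n : ℕ} (P : UnitPolygon n) (Q : ZMod (2 * n) → Prop) (k : ZMod (2 * n)) (h0 : Q k)
    (hs : ∀ i, Q i → Q (i + 1)) : ∀ i, Q i := by
  have : ∀ t : ℕ, Q (k + t) := by
    intro t
    induction t with
    | zero => simpa using h0
    | succ t ih => have := hs _ ih; push_cast; rw [← add_assoc]; exact this
  intro i
  have hnz := P.neZero
  have h := this (i - k).val
  rw [ZMod.natCast_zmod_val] at h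
  simpa using h

theorem sum_e [NeZero (2 * n)] : ∑ k : ZMod (2 * n), P.e k = 0 := by
  unfold e
  rw [Finset.sum_sub_distrib, sub_eq_zero]
  exact Equiv.sum_comp (Equiv.addRight (1 : ZMod (2 * n))) P.vtx

/-- not all edges are parallel to a fixed one -/
theorem not_all_eq (v : Pt) : ¬ ∀ k, P.e k = v := by
  intro h
  have := P.neZero
  have h1 := P.sum_e
  simp only [h, Finset.sum_const, Finset.card_univ] at h1
  rw [ZMod.card] at h1
  have hv : ‖v‖ = 1 := by rw [← h 0]; exact P.norm_e 0
  have : v = 0 := by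
    rw [← Nat.cast_smul_eq_nsmul ℝ] at h1
    rcases smul_eq_zero.mp h1 with h2 | h2
    · have := P.n_ge
      have h3 : 2 * n = 0 := by exact_mod_cast h2
      omega
    · exact h2
  rw [this] at hv; simp at hv

theorem exists_cross_pos : ∃ k, 0 < cross2 (P.e k) (P.e (k + 1)) := by
  by_contra! hcon
  have h : ∀ k, P.e (k + 1) = P.e k := fun k =>
    P.e_succ_eq k (le_antisymm (hcon k) (P.cross_e_succ k))
  exact P.not_all_eq (P.e 0) (P.zmod_induction (fun k => P.e k = P.e 0) 0 rfl
    (fun i hi => (h i).trans hi))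

theorem cl_nonneg_of {k : ZMod (2 * n)} (h : ∀ x ∈ P.Ω, 0 < cross2 (P.e k) (x - P.vtx k))
    {y : Pt} (hy : y ∈ closure P.Ω) : 0 ≤ cross2 (P.e k) (y - P.vtx k) := by
  have : closure P.Ω ⊆ {y | 0 ≤ cross2 (P.e k) (y - P.vtx k)} :=
    closure_minimal (fun z hz => (h z hz).le)
      (isClosed_le continuous_const ((continuous_cross2 _).comp (continuous_sub_right _)))
  exact this hy

theorem cl_nonpos_of {k : ZMod (2 * n)} (h : ∀ x ∈ P.Ω, cross2 (P.e k) (x - P.vtx k) < 0)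
    {y : Pt} (hy : y ∈ closure P.Ω) : cross2 (P.e k) (y - P.vtx k) ≤ 0 := by
  have : closure P.Ω ⊆ {y | cross2 (P.e k) (y - P.vtx k) ≤ 0} :=
    closure_minimal (fun z hz => (h z hz).le)
      (isClosed_le ((continuous_cross2 _).comp (continuous_sub_right _)) continuous_const)
  exact this hy

/-- The domain lies strictly to the left of every edge. -/
theorem edge_pos (k : ZMod (2 * n)) : ∀ x ∈ P.Ω, 0 < cross2 (P.e k) (x - P.vtx k) := by
  have hA : ∀ k, 0 < cross2 (P.e k) (P.e (k + 1)) →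
      (∀ x ∈ P.Ω, 0 < cross2 (P.e k) (x - P.vtx k)) := by
    intro k hk
    rcases P.edge_sign k with h | h
    · exact h
    · exfalso
      have := P.cl_nonpos_of h (P.vtx_mem_closure (k + 1 + 1))
      have e1 : P.vtx (k + 1 + 1) - P.vtx k = P.e (k + 1) + P.e k := by unfold e; abel
      rw [e1, cross2_add_right, cross2_self] at this
      linarith
  have hB : ∀ k, 0 < cross2 (P.e k) (P.e (k + 1)) →
      (∀ x ∈ P.Ω, 0 < cross2 (P.e (k + 1)) (x - P.vtx (k + 1))) := by
    intro k hk
    rcases P.edge_sign (k + 1) with h | h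
    · exact h
    · exfalso
      have := P.cl_nonpos_of h (P.vtx_mem_closure k)
      have e1 : P.vtx k - P.vtx (k + 1) = - P.e k := by unfold e; abel
      rw [e1, cross2_neg_right, cross2_comm] at this
      linarith
  obtain ⟨k0, hk0⟩ := P.exists_cross_pos
  refine P.zmod_induction (fun k => ∀ x ∈ P.Ω, 0 < cross2 (P.e k) (x - P.vtx k)) k0 (hA k0 hk0)
    ?_ k
  intro i hi
  rcases (P.cross_e_succ i).lt_or_eq with h | h
  · exact hB i h
  · have he := P.e_succ_eq i h.symm
    intro x hx
    have h1 := hi x hx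
    have e1 : x - P.vtx i = (x - P.vtx (i + 1)) + P.e i := by unfold e; abel
    rw [e1, cross2_add_right, cross2_self] at h1
    rw [he]; linarith

theorem edge_nonneg (k : ZMod (2 * n)) {y : Pt} (hy : y ∈ closure P.Ω) :
    0 ≤ cross2 (P.e k) (y - P.vtx k) := P.cl_nonneg_of (P.edge_pos k) hy

theorem edge_vtx_nonneg (k j : ZMod (2 * n)) :
    0 ≤ cross2 (P.e k) (P.vtx j - P.vtx k) := P.edge_nonneg k (P.vtx_mem_closure j)

theorem cross_seg_eq_zero (k : ZMod (2 * n)) {z : Pt}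
    (hz : z ∈ segment ℝ (P.vtx k) (P.vtx (k + 1))) : cross2 (P.e k) (z - P.vtx k) = 0 := by
  rw [segment_eq_image'] at hz
  obtain ⟨t, _, rfl⟩ := hz
  have : P.vtx k + t • (P.vtx (k + 1) - P.vtx k) - P.vtx k = t • P.e k := by
    unfold e; abel
  rw [this, cross2_smul_right, cross2_self, mul_zero]

theorem mem_of_pos {x : Pt} (hx : ∀ k, 0 < cross2 (P.e k) (x - P.vtx k)) : x ∈ P.Ω := by
  by_contra hxn
  obtain ⟨y, hy⟩ := P.nonempty
  have hpre : IsPreconnected (segment ℝ y x) := (convex_segment y x).isPreconnected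
  obtain ⟨z, hz, hzF⟩ : ∃ z ∈ segment ℝ y x, z ∈ frontier P.Ω := by
    by_contra! hno
    have hxc : x ∉ closure P.Ω := fun h => hno x (right_mem_segment ℝ y x)
      (by rw [P.isOpen.frontier_eq]; exact ⟨h, hxn⟩)
    obtain ⟨w, _, hw1, hw2⟩ := hpre P.Ω (closure P.Ω)ᶜ P.isOpen isClosed_closure.isOpen_compl
      (fun w hw => by
        by_cases h1 : w ∈ P.Ω
        · exact Or.inl h1
        · refine Or.inr fun h2 => hno w hw ?_
          rw [P.isOpen.frontier_eq]; exact ⟨h2, h1⟩)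
      ⟨y, left_mem_segment ℝ y x, hy⟩ ⟨x, right_mem_segment ℝ y x, hxc⟩
    exact hw2 (subset_closure hw1)
  rw [P.frontier_eq] at hzF
  obtain ⟨k, hk⟩ := mem_iUnion.mp hzF
  have h0 := P.cross_seg_eq_zero k hk
  obtain ⟨a, b, ha, hb, hab, rfl⟩ := hz
  have h1 := P.edge_pos k y hy
  have h2 := hx k
  have : a • y + b • x - P.vtx k = a • (y - P.vtx k) + b • (x - P.vtx k) := by
    rw [smul_sub, smul_sub]
    have : P.vtx k = a • P.vtx k + b • P.vtx k := by rw [← add_smul, hab, one_smul]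
    nth_rewrite 1 [this]; abel
  rw [this, cross2_add_right, cross2_smul_right, cross2_smul_right] at h0
  rcases ha.lt_or_eq with h | h
  · nlinarith [mul_pos h h1, mul_nonneg hb h2.le]
  · have : b = 1 := by linarith
    rw [← h, this] at h0; linarith

/-! #### Unimodality of linear functionals along the boundary -/

/-- lexicographic positivity -/
def LP (a v : Pt) : Prop := 0 < dot2 a v ∨ (dot2 a v = 0 ∧ 0 < cross2 a v)

theorem LP_total {a v : Pt} (ha : a ≠ 0) (hv : v ≠ 0) : LP a v ∨ LP a (-v) := by
  unfold LP
  rw [dot2_neg_right, cross2_neg_right]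
  rcases lt_trichotomy (dot2 a v) 0 with h | h | h
  · right; left; linarith
  · rcases lt_trichotomy (cross2 a v) 0 with h' | h' | h'
    · right; right; constructor <;> linarith
    · exfalso
      have hs : (a 0 ^ 2 + a 1 ^ 2) * (v 0 ^ 2 + v 1 ^ 2) = 0 := by
        unfold dot2 at h; unfold cross2 at h'
        linear_combination (v 0 * a 0 + v 1 * a 1) * h + (a 0 * v 1 - a 1 * v 0) * h'
      rw [← pt_norm_sq, ← pt_norm_sq] at hs
      have := norm_pos_iff.mpr ha
      have := norm_pos_iff.mpr hv
      have : 0 < ‖a‖ ^ 2 * ‖v‖ ^ 2 := by positivity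
      linarith
    · left; right; exact ⟨h, h'⟩
  · left; left; exact h

theorem LP_not_both {a v : Pt} (h1 : LP a v) (h2 : LP a (-v)) : False := by
  unfold LP at h1 h2
  rw [dot2_neg_right, cross2_neg_right] at h2
  rcases h1 with h1 | ⟨h1, h1'⟩ <;> rcases h2 with h2 | ⟨h2, h2'⟩ <;> linarith

theorem LP_add {a v w : Pt} (h1 : LP a v) (h2 : LP a w) : LP a (v + w) := by
  unfold LP at *
  rw [dot2_add_right, cross2_add_right]
  rcases h1 with h1 | ⟨h1, h1'⟩ <;> rcases h2 with h2 | ⟨h2, h2'⟩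
  · left; linarith
  · left; linarith
  · left; linarith
  · right; constructor <;> linarith

theorem LP_smul {a v : Pt} {c : ℝ} (hc : 0 < c) (h1 : LP a v) : LP a (c • v) := by
  unfold LP at *
  rw [dot2_smul_right, cross2_smul_right]
  rcases h1 with h1 | ⟨h1, h1'⟩
  · left; positivity
  · right; rw [h1]; exact ⟨by ring, by positivity⟩

theorem LP_dot {a v : Pt} (h : LP a v) : 0 ≤ dot2 a v := by
  rcases h with h | ⟨h, _⟩ <;> linarith

theorem e_ne_zero (k : ZMod (2 * n)) : P.e k ≠ 0 := by
  intro h; have := P.norm_e k; rw [h] at this; simp at this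

/-- A local lexicographic maximum is a global one. -/
theorem local_max_global {a : Pt} (k j : ZMod (2 * n)) (h1 : LP a (P.e k))
    (h2 : LP a (-P.e (k + 1))) : ¬ LP a (P.vtx j - P.vtx (k + 1)) := by
  have hc : 0 < cross2 (P.e k) (P.e (k + 1)) := by
    rcases (P.cross_e_succ k).lt_or_eq with h | h
    · exact h
    · rw [P.e_succ_eq k h.symm] at h2; exact (LP_not_both h1 h2).elim
  have hj1 := P.edge_vtx_nonneg k j
  have hj2 := P.edge_vtx_nonneg (k + 1) j
  set y := P.vtx j - P.vtx (k + 1) with hy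
  have e1 : P.vtx j - P.vtx k = y + P.e k := by rw [hy]; unfold e; abel
  rw [e1, cross2_add_right, cross2_self, add_zero] at hj1
  set c := cross2 (P.e k) (P.e (k + 1)) with hcdef
  have hyy : c • y = (cross2 (P.e (k+1)) y) • (-P.e k) + (cross2 (P.e k) y) • (P.e (k + 1)) := by
    apply pt_ext <;> simp [hcdef, cross2] <;> ring
  have hneg : -(c • y) = (cross2 (P.e (k+1)) y) • (P.e k) + (cross2 (P.e k) y) • (-P.e (k + 1)) := by
    rw [hyy]; simp; abel
  intro hLP
  have hLP' := LP_smul hc hLP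
  rcases hj1.lt_or_eq with hp | hp <;> rcases hj2.lt_or_eq with hq | hq
  · have := LP_add (LP_smul hq h1) (LP_smul hp h2)
    rw [← hneg] at this; exact LP_not_both hLP' this
  · have := (LP_smul hp h2)
    rw [← hq, zero_smul, zero_add] at hneg
    rw [← hneg] at this; exact LP_not_both hLP' this
  · have := (LP_smul hq h1)
    rw [← hp, zero_smul, add_zero] at hneg
    rw [← hneg] at this; exact LP_not_both hLP' this
  · rw [← hp, ← hq, zero_smul, zero_smul, zero_add] at hyy
    rw [hyy] at hLP'
    simp [LP, dot2, cross2] at hLP'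

theorem exists_lexmax (a : Pt) : ∃ M : ZMod (2 * n), ∀ j, ¬ LP a (P.vtx j - P.vtx M) := by
  have := P.neZero
  obtain ⟨M, hM⟩ := Finite.exists_max
    (fun j => toLex (dot2 a (P.vtx j), cross2 a (P.vtx j)))
  refine ⟨M, fun j hj => ?_⟩
  have := hM j
  rw [Prod.Lex.le_iff] at this
  simp only [LP, dot2_sub_right, cross2_sub_right] at hj
  simp at this
  rcases hj with h | ⟨h, h'⟩ <;> rcases this with h2 | ⟨h2, h2'⟩ <;> linarith

/-- index arithmetic: small shifts are nonzero -/
theorem shift_ne {t : ℕ} (M : ZMod (2 * n)) (h0 : 0 < t) (h1 : t < 2 * n) : M + t ≠ M := by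
  intro h
  have : (t : ZMod (2 * n)) = 0 := by simpa using h
  rw [ZMod.natCast_eq_zero_iff] at this
  exact absurd (Nat.le_of_dvd h0 this) (by omega)

/-- Unimodality of a linear functional along the boundary. -/
theorem unimodal {a : Pt} (ha : a ≠ 0) : ∃ (M : ZMod (2 * n)) (r : ℕ), 0 < r ∧ r < 2 * n ∧
    (∀ t : ℕ, t < r → dot2 a (P.e (M + t)) ≤ 0) ∧
    (∀ t : ℕ, r ≤ t → t < 2 * n → 0 ≤ dot2 a (P.e (M + t))) := by
  classical
  obtain ⟨M, hM⟩ := P.exists_lexmax a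
  have hN := P.n_ge
  have tot : ∀ k, LP a (P.e k) ∨ LP a (-P.e k) := fun k => LP_total ha (P.e_ne_zero k)
  have h0 : LP a (-P.e M) := by
    rcases tot M with h | h
    · exact absurd h (hM (M + 1))
    · exact h
  have hlast : LP a (P.e (M + ((2 * n - 1 : ℕ)))) := by
    rcases tot (M + ((2 * n - 1 : ℕ))) with h | h
    · exact h
    · exfalso
      apply hM (M + ((2 * n - 1 : ℕ)))
      have e1 : (M + ((2 * n - 1 : ℕ)) + 1 : ZMod (2 * n)) = M := by
        have : (((2 * n - 1 : ℕ) + 1 : ℕ) : ZMod (2 * n)) = 0 := by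
          rw [Nat.sub_add_cancel (by omega)]; exact ZMod.natCast_self _
        push_cast at this
        rw [add_assoc]; rw [this, add_zero]
      unfold e at h
      rw [e1, neg_sub] at h
      exact h
  have hex : ∃ t : ℕ, LP a (P.e (M + (t : ℕ))) := ⟨_, hlast⟩
  set r := Nat.find hex with hr
  have hr1 : LP a (P.e (M + (r : ℕ))) := Nat.find_spec hex
  have hrpos : 0 < r := by
    rcases Nat.eq_zero_or_pos r with h | h
    · rw [h] at hr1; simp at hr1; exact (LP_not_both hr1 h0).elim
    · exact h
  have hrle : r ≤ 2 * n - 1 := Nat.find_min' hex hlast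
  refine ⟨M, r, hrpos, by omega, ?_, ?_⟩
  · intro t ht
    have := Nat.find_min hex ht
    have := LP_dot ((tot (M + t)).resolve_left this)
    rw [dot2_neg_right] at this; linarith
  · intro t ht1 ht2
    apply LP_dot
    revert ht2
    induction t, ht1 using Nat.le_induction with
    | base => intro _; exact hr1
    | succ t ht ih =>
      intro ht2
      have h1 := ih (by omega)
      rcases tot (M + ((t + 1 : ℕ))) with h | h
      · exact h
      · exfalso
        have e1 : (M + ((t + 1 : ℕ)) : ZMod (2 * n)) = M + t + 1 := by push_cast; ring
        rw [e1] at h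
        have hmax := P.local_max_global (M + t) M h1 h
        rw [← e1] at hmax
        have hmax2 := hM (M + ((t + 1 : ℕ)))
        have hne : P.vtx M - P.vtx (M + ((t + 1 : ℕ))) ≠ 0 := by
          intro h
          exact shift_ne M (by omega) ht2 (P.inj (sub_eq_zero.mp h)).symm
        rcases LP_total ha hne with h | h
        · exact hmax h
        · rw [neg_sub] at h; exact hmax2 h

/-- telescoping of edges -/
theorem vtx_shift (i : ZMod (2 * n)) (s t : ℕ) (h : s ≤ t) :
    P.vtx (i + t) - P.vtx (i + s) = ∑ k ∈ Finset.Ico s t, P.e (i + k) := by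
  induction t, h using Nat.le_induction with
  | base => simp
  | succ t ht ih =>
    rw [Finset.sum_Ico_succ_top ht, ← ih]
    unfold e; push_cast; rw [← add_assoc]; abel

theorem exists_dot_ne {a : Pt} (ha : a ≠ 0) : ∃ k, dot2 a (P.e k) ≠ 0 := by
  by_contra! hcon
  obtain ⟨k, hk⟩ := P.exists_cross_pos
  have h1 := hcon k
  have h2 := hcon (k + 1)
  unfold dot2 at h1 h2
  unfold cross2 at hk
  apply ha
  have e0 : a 0 * (P.e k 0 * P.e (k+1) 1 - P.e k 1 * P.e (k+1) 0) = 0 := by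
    linear_combination P.e (k+1) 1 * h1 - P.e k 1 * h2
  have e1 : a 1 * (P.e k 0 * P.e (k+1) 1 - P.e k 1 * P.e (k+1) 0) = 0 := by
    linear_combination -(P.e (k+1) 0) * h1 + P.e k 0 * h2
  apply pt_ext
  · simpa [hk.ne'] using e0
  · simpa [hk.ne'] using e1

end UnitPolygon


/-! ### The finite dimensional variational problem -/

namespace Koba

variable {N : ℕ} [NeZero N]

/-- ordered configurations -/
def Conf (x : ZMod N → ℝ) : Prop := ∀ a b : ZMod N, a.val < b.val → x a < x b

/-- coupling constants -/
def mm (X : ZMod N → ZMod N → ℝ) (a b : ZMod N) : ℝ :=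
  X a (b + 1) + X (a + 1) b - X a b - X (a + 1) (b + 1)

/-- the energy -/
def En (X : ZMod N → ZMod N → ℝ) (x : ZMod N → ℝ) : ℝ :=
  ∑ a, ∑ b, mm X a b * Real.log (x a - x b)

/-- log of cross ratio -/
def Q (x : ZMod N → ℝ) (i j : ZMod N) : ℝ :=
  Real.log (x i - x (j - 1)) + Real.log (x (i - 1) - x j) - Real.log (x i - x j)
    - Real.log (x (i - 1) - x (j - 1))

def num (x : ZMod N → ℝ) (i j : ZMod N) : ℝ := |x i - x (j - 1)| * |x (i - 1) - x j|
def den (x : ZMod N → ℝ) (i j : ZMod N) : ℝ := |x i - x j| * |x (i - 1) - x (j - 1)|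

def NonAdj (i j : ZMod N) : Prop := j ≠ i ∧ j ≠ i + 1 ∧ i ≠ j + 1

theorem En_eq (X : ZMod N → ZMod N → ℝ) (x : ZMod N → ℝ) :
    En X x = ∑ i, ∑ j, X i j * Q x i j := by
  unfold En mm Q
  simp only [sub_mul, add_mul, mul_add, mul_sub, Finset.sum_add_distrib, Finset.sum_sub_distrib]
  have h1 : ∑ a, ∑ b, X a (b + 1) * Real.log (x a - x b)
      = ∑ i, ∑ j, X i j * Real.log (x i - x (j - 1)) := by
    refine Finset.sum_congr rfl fun a _ => ?_
    rw [← Equiv.sum_comp (Equiv.addRight (1 : ZMod N))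
      (fun j => X a j * Real.log (x a - x (j - 1)))]
    simp
  have h2 : ∑ a, ∑ b, X (a + 1) b * Real.log (x a - x b)
      = ∑ i, ∑ j, X i j * Real.log (x (i - 1) - x j) := by
    rw [← Equiv.sum_comp (Equiv.addRight (1 : ZMod N))
      (fun i => ∑ j, X i j * Real.log (x (i - 1) - x j))]
    simp
  have h3 : ∑ a, ∑ b, X (a + 1) (b + 1) * Real.log (x a - x b)
      = ∑ i, ∑ j, X i j * Real.log (x (i - 1) - x (j - 1)) := by
    rw [← Equiv.sum_comp (Equiv.addRight (1 : ZMod N))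
      (fun i => ∑ j, X i j * Real.log (x (i - 1) - x (j - 1)))]
    refine Finset.sum_congr rfl fun a _ => ?_
    rw [← Equiv.sum_comp (Equiv.addRight (1 : ZMod N))
      (fun j => X (Equiv.addRight 1 a) j * Real.log (x (Equiv.addRight 1 a - 1) - x (j - 1)))]
    simp
  rw [h1, h2, h3]

theorem Conf.inj {x : ZMod N → ℝ} (hx : Conf x) {a b : ZMod N} (h : a ≠ b) : x a ≠ x b := by
  have hv : a.val ≠ b.val := fun h' => h (ZMod.val_injective N h')
  rcases lt_or_gt_of_ne hv with h1 | h1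
  · exact (hx a b h1).ne
  · exact (hx b a h1).ne'

theorem val_pred {j : ZMod N} (h : j ≠ 0) : (j - 1).val = j.val - 1 := by
  have hN : N ≠ 1 := by
    rintro rfl; exact h (Subsingleton.elim _ _)
  have hN0 : N ≠ 0 := NeZero.ne N
  have : Fact (1 < N) := ⟨by omega⟩
  have h1 : j.val ≠ 0 := by simpa using h
  rw [ZMod.val_sub, ZMod.val_one]
  rw [ZMod.val_one]; omega

theorem val_succ {j : ZMod N} (h : j.val + 1 < N) : (j + 1).val = j.val + 1 := by
  have : Fact (1 < N) := ⟨by omega⟩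
  rw [ZMod.val_add_of_lt, ZMod.val_one]
  rw [ZMod.val_one]; exact h

theorem val_neg_one' (hN : 1 < N) : (-1 : ZMod N).val = N - 1 := by
  obtain ⟨M, rfl⟩ : ∃ M, N = M + 1 := ⟨N - 1, by omega⟩
  rw [ZMod.val_neg_one]; omega

theorem num_symm (x : ZMod N → ℝ) (i j : ZMod N) : num x j i = num x i j := by
  unfold num; rw [abs_sub_comm (x j), abs_sub_comm (x (j-1)), mul_comm]

theorem den_symm (x : ZMod N → ℝ) (i j : ZMod N) : den x j i = den x i j := by
  unfold den; rw [abs_sub_comm (x j), abs_sub_comm (x (j-1))]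

theorem NonAdj.symm {i j : ZMod N} (h : NonAdj i j) : NonAdj j i := ⟨h.1.symm, h.2.2, h.2.1⟩

theorem num_le_den_aux {x : ZMod N → ℝ} (hx : Conf x) {i j : ZMod N} (h : NonAdj i j)
    (hij : i.val < j.val) : num x i j ≤ den x i j := by
  have hjlt := ZMod.val_lt j
  have hj0 : j ≠ 0 := by rintro rfl; simp at hij
  have hj1 := val_pred hj0
  have hij1 : i.val ≠ (j - 1).val := by
    intro h'
    apply h.2.1
    rw [ZMod.val_injective N h']; ring
  have a1 : x i < x (j - 1) := hx _ _ (by omega)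
  have a2 : x (j - 1) < x j := hx _ _ (by omega)
  unfold num den
  by_cases hi0 : i = 0
  · have hN1 : 1 < N := by omega
    have hi1 : (i - 1).val = N - 1 := by rw [hi0, zero_sub, val_neg_one' hN1]
    have hne : (i - 1).val ≠ j.val := by
      intro h'
      apply h.2.2
      rw [← ZMod.val_injective N h']; ring
    have a3 : x j < x (i - 1) := hx _ _ (by omega)
    rw [abs_of_neg (by linarith), abs_of_pos (by linarith), abs_of_neg (by linarith),
      abs_of_pos (by linarith)]
    nlinarith
  · have hi1 := val_pred hi0
    have hi00 : i.val ≠ 0 := by simpa using hi0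
    have a3 : x (i - 1) < x i := hx _ _ (by omega)
    rw [abs_of_neg (by linarith), abs_of_neg (by linarith), abs_of_neg (by linarith),
      abs_of_neg (by linarith)]
    nlinarith [mul_pos (sub_pos.mpr a2) (sub_pos.mpr a3)]

theorem num_le_den {x : ZMod N → ℝ} (hx : Conf x) {i j : ZMod N} (h : NonAdj i j) :
    num x i j ≤ den x i j := by
  have hv : i.val ≠ j.val := fun h' => h.1 (ZMod.val_injective N h').symm
  rcases lt_or_gt_of_ne hv with h1 | h1
  · exact num_le_den_aux hx h h1
  · rw [← num_symm, ← den_symm]; exact num_le_den_aux hx h.symm h1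

theorem NonAdj.facts {i j : ZMod N} (h : NonAdj i j) :
    i ≠ j - 1 ∧ i - 1 ≠ j ∧ i ≠ j ∧ i - 1 ≠ j - 1 := by
  refine ⟨?_, ?_, h.1.symm, ?_⟩
  · rintro rfl; exact h.2.1 (by ring)
  · rintro rfl; exact h.2.2 (by ring)
  · intro h'; exact h.1.symm (sub_left_injective h')

theorem num_pos {x : ZMod N → ℝ} (hx : Conf x) {i j : ZMod N} (h : NonAdj i j) :
    0 < num x i j := by
  obtain ⟨h1, h2, h3, h4⟩ := h.facts
  have := sub_ne_zero.mpr (hx.inj h1)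
  have := sub_ne_zero.mpr (hx.inj h2)
  unfold num; positivity

theorem den_pos {x : ZMod N → ℝ} (hx : Conf x) {i j : ZMod N} (h : NonAdj i j) :
    0 < den x i j := by
  obtain ⟨h1, h2, h3, h4⟩ := h.facts
  have := sub_ne_zero.mpr (hx.inj h3)
  have := sub_ne_zero.mpr (hx.inj h4)
  unfold den; positivity

theorem Q_eq {x : ZMod N → ℝ} (hx : Conf x) {i j : ZMod N} (h : NonAdj i j) :
    Q x i j = Real.log (num x i j) - Real.log (den x i j) := by
  obtain ⟨h1, h2, h3, h4⟩ := h.facts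
  have a1 := abs_ne_zero.mpr (sub_ne_zero.mpr (hx.inj h1))
  have a2 := abs_ne_zero.mpr (sub_ne_zero.mpr (hx.inj h2))
  have a3 := abs_ne_zero.mpr (sub_ne_zero.mpr (hx.inj h3))
  have a4 := abs_ne_zero.mpr (sub_ne_zero.mpr (hx.inj h4))
  unfold Q num den
  rw [Real.log_mul a1 a2, Real.log_mul a3 a4, Real.log_abs, Real.log_abs, Real.log_abs,
    Real.log_abs]
  ring

theorem Q_nonpos {x : ZMod N → ℝ} (hx : Conf x) {i j : ZMod N} (h : NonAdj i j) :
    Q x i j ≤ 0 := by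
  rw [Q_eq hx h]
  have := Real.log_le_log (num_pos hx h) (num_le_den hx h)
  linarith

/-- gauge fixing -/
def Gauge (x : ZMod N → ℝ) : Prop := x 0 = 0 ∧ x 1 = 1 / 2 ∧ x (-1) = 1

def Sset (c : ℝ) : Set (ZMod N → ℝ) :=
  {x | (∀ a b : ZMod N, a.val ≤ b.val → x a ≤ x b) ∧ Gauge x ∧
    ∀ i j, NonAdj i j → c * den x i j ≤ num x i j}

theorem val_le_neg_one (hN : 4 ≤ N) (a : ZMod N) : a.val ≤ (-1 : ZMod N).val := by
  rw [val_neg_one' (by omega)]; have := ZMod.val_lt a; omega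

theorem Sset_compact (hN : 4 ≤ N) (c : ℝ) : IsCompact (Sset c : Set (ZMod N → ℝ)) := by
  have hsub : Sset c ⊆ Set.pi univ (fun _ : ZMod N => Icc (0 : ℝ) 1) := by
    rintro x ⟨h1, h2, _⟩ a _
    constructor
    · rw [← h2.1]; exact h1 0 a (by simp)
    · rw [← h2.2.2]; exact h1 a (-1) (val_le_neg_one hN a)
  refine IsCompact.of_isClosed_subset (isCompact_univ_pi fun _ => isCompact_Icc) ?_ hsub
  unfold Sset Gauge num den
  simp only [setOf_and, setOf_forall]
  refine IsClosed.inter ?_ (IsClosed.inter (IsClosed.inter ?_ (IsClosed.inter ?_ ?_)) ?_)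
  · exact isClosed_iInter fun a => isClosed_iInter fun b => isClosed_iInter fun _ =>
      isClosed_le (by fun_prop) (by fun_prop)
  · exact isClosed_eq (by fun_prop) (by fun_prop)
  · exact isClosed_eq (by fun_prop) (by fun_prop)
  · exact isClosed_eq (by fun_prop) (by fun_prop)
  · exact isClosed_iInter fun a => isClosed_iInter fun b => isClosed_iInter fun _ =>
      isClosed_le (by fun_prop) (by fun_prop)

theorem Sset_conf (hN : 4 ≤ N) {c : ℝ} (hc : 0 < c) {x : ZMod N → ℝ} (hx : x ∈ Sset c) :
    Conf x := by
  obtain ⟨hmono, ⟨g0, g1, g2⟩, hcr⟩ := hx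
  intro a b hab
  by_contra hcon
  have hxab : x a = x b := le_antisymm (hmono a b hab.le) (not_lt.mp hcon)
  have hne : ({k : ZMod N | x k = x a}).Nonempty := ⟨a, rfl⟩
  obtain ⟨A, hA, hAmin⟩ := Set.exists_min_image {k : ZMod N | x k = x a} ZMod.val
    (Set.toFinite _) hne
  obtain ⟨B, hB, hBmax⟩ := Set.exists_max_image {k : ZMod N | x k = x a} ZMod.val
    (Set.toFinite _) hne
  simp only [mem_setOf_eq] at hA hB hAmin hBmax
  have hAB : A.val < B.val := by
    have := hAmin a rfl
    have := hBmax b hxab.symm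
    omega
  have hBlt := ZMod.val_lt B
  have hAB' : x A = x B := by rw [hA, hB]
  have v1 : (1 : ZMod N).val = 1 := by
    have : Fact (1 < N) := ⟨by omega⟩
    exact ZMod.val_one N
  have vm := val_neg_one' (N := N) (by omega)
  have hBlast : ∀ C : ZMod N, C.val = N - 1 → C = -1 := fun C hC =>
    ZMod.val_injective N (by rw [hC, vm])
  have hBs : x (B + 1) ≠ x a := by
    intro h
    by_cases hl : B.val + 1 < N
    · have := hBmax _ h
      rw [val_succ hl] at this; omega
    · have hB1 : B = -1 := hBlast B (by omega)
      rw [hB1] at h hB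
      simp at h
      rw [← h, g0, g2] at hB; norm_num at hB
  have hAp : x (A - 1) ≠ x a := by
    intro h
    by_cases hl : A = 0
    · rw [hl] at h hA
      simp at h
      rw [← h, g0, g2] at hA; norm_num at hA
    · have := hAmin _ h
      have h0 : A.val ≠ 0 := by simpa using hl
      rw [val_pred hl] at this; omega
  have hnon : NonAdj A (B + 1) := by
    refine ⟨?_, ?_, ?_⟩
    · intro h; rw [h] at hBs; exact hBs hA
    · intro h
      have : B = A := add_right_cancel h
      rw [this] at hAB; omega
    · intro h
      by_cases hl : B.val + 1 < N
      · by_cases hl2 : (B + 1).val + 1 < N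
        · have h3 := val_succ hl2
          rw [← h, val_succ hl] at h3; omega
        · have hB1 : B + 1 = -1 := hBlast _ (by rw [val_succ hl] at hl2 ⊢; omega)
          rw [hB1] at h
          simp at h
          rw [val_succ hl] at hl2
          have h1B : (1 : ZMod N).val ≤ B.val := by rw [v1]; omega
          have := hmono 1 B h1B
          rw [← hAB', h, g0, g1] at this; norm_num at this
      · have hB1 : B = -1 := hBlast B (by omega)
        rw [hB1] at h hAB'
        simp at h
        rw [h, g1, g2] at hAB'; norm_num at hAB'
  have h := hcr A (B + 1) hnon
  have hn : num x A (B + 1) = 0 := by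
    unfold num; simp [hAB']
  have hd : 0 < den x A (B + 1) := by
    unfold den
    have h1 : x A - x (B + 1) ≠ 0 := sub_ne_zero.mpr (by rw [hA]; exact hBs.symm)
    have h2 : x (A - 1) - x (B + 1 - 1) ≠ 0 := sub_ne_zero.mpr (by simpa [hB] using hAp)
    positivity
  rw [hn] at h
  nlinarith [mul_pos hc hd]

def x0 (a : ZMod N) : ℝ := if a = 0 then 0 else 1 / 2 + ((a.val : ℝ) - 1) / (2 * ((N : ℝ) - 2))

theorem x0_conf (hN : 4 ≤ N) : Conf (x0 : ZMod N → ℝ) := by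
  intro a b hab
  have hb : b ≠ 0 := by rintro rfl; simp at hab
  have hNr : (4 : ℝ) ≤ N := by exact_mod_cast hN
  have hb1 : (1 : ℝ) ≤ b.val := by
    have : b.val ≠ 0 := by simpa using hb
    exact_mod_cast Nat.one_le_iff_ne_zero.mpr this
  unfold x0
  rw [if_neg hb]
  split_ifs with h
  · have : 0 ≤ ((b.val : ℝ) - 1) / (2 * ((N : ℝ) - 2)) := div_nonneg (by linarith) (by linarith)
    linarith
  · have : (a.val : ℝ) < b.val := by exact_mod_cast hab
    have : ((a.val : ℝ) - 1) / (2 * ((N : ℝ) - 2)) < ((b.val : ℝ) - 1) / (2 * ((N : ℝ) - 2)) :=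
      div_lt_div_of_pos_right (by linarith) (by linarith)
    linarith

theorem one_ne (hN : 4 ≤ N) : (1 : ZMod N) ≠ 0 ∧ (-1 : ZMod N) ≠ 0 ∧ (1 : ZMod N) ≠ -1 := by
  have v1 : (1 : ZMod N).val = 1 := by
    have : Fact (1 < N) := ⟨by omega⟩
    exact ZMod.val_one N
  have vm := val_neg_one' (N := N) (by omega)
  refine ⟨fun h => ?_, fun h => ?_, fun h => ?_⟩
  · rw [h] at v1; simp at v1
  · rw [h] at vm; simp at vm; omega
  · rw [h] at v1; omega

theorem x0_gauge (hN : 4 ≤ N) : Gauge (x0 : ZMod N → ℝ) := by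
  obtain ⟨h1, h2, h3⟩ := one_ne hN
  have v1 : (1 : ZMod N).val = 1 := by
    have : Fact (1 < N) := ⟨by omega⟩
    exact ZMod.val_one N
  have vm := val_neg_one' (N := N) (by omega)
  have hNr : (4 : ℝ) ≤ N := by exact_mod_cast hN
  refine ⟨by simp [x0], by simp [x0, h1, v1], ?_⟩
  unfold x0
  rw [if_neg h2, vm, Nat.cast_sub (by omega)]
  have : (N : ℝ) - 2 ≠ 0 := by linarith
  field_simp
  push_cast
  ring

section main
variable (X : ZMod N → ZMod N → ℝ)

theorem exists_max (hN : 4 ≤ N) (hX0 : ∀ i j, ¬ NonAdj i j → X i j = 0)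
    (hXp : ∀ i j, NonAdj i j → 0 < X i j) :
    ∃ x : ZMod N → ℝ, Conf x ∧ Gauge x ∧ ∀ y, Conf y → Gauge y → En X y ≤ En X x := by
  classical
  obtain ⟨⟨i0, j0⟩, hmin⟩ := Finite.exists_min
    (fun q : ZMod N × ZMod N => Real.exp (En X x0 / X q.1 q.2))
  set c := Real.exp (En X x0 / X i0 j0) with hcdef
  have hc : 0 < c := Real.exp_pos _
  have hterm : ∀ y, Conf y → ∀ i j, X i j * Q y i j ≤ 0 := by
    intro y hy i j
    by_cases h : NonAdj i j
    · exact mul_nonpos_of_nonneg_of_nonpos (hXp i j h).le (Q_nonpos hy h)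
    · rw [hX0 i j h]; simp
  have hsub : ∀ y, Conf y → Gauge y → En X x0 ≤ En X y → y ∈ (Sset c : Set (ZMod N → ℝ)) := by
    intro y hy hg hE
    refine ⟨?_, hg, ?_⟩
    · intro a b hab
      rcases hab.lt_or_eq with h | h
      · exact (hy a b h).le
      · rw [ZMod.val_injective N h]
    · intro i j hij
      have h1 : En X y ≤ X i j * Q y i j := by
        rw [En_eq]
        calc ∑ i, ∑ j, X i j * Q y i j ≤ ∑ j, X i j * Q y i j := by
              have := Finset.sum_le_sum_of_subset_of_nonneg (Finset.subset_univ {i})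
                (f := fun i => - ∑ j, X i j * Q y i j) (fun k _ _ => by
                  rw [neg_nonneg]; exact Finset.sum_nonpos fun j _ => hterm y hy k j)
              simp at this; linarith
          _ ≤ X i j * Q y i j := by
              have := Finset.sum_le_sum_of_subset_of_nonneg (Finset.subset_univ {j})
                (f := fun j => - (X i j * Q y i j)) (fun k _ _ => by
                  rw [neg_nonneg]; exact hterm y hy i k)
              simp at this; linarith
      have hp := hXp i j hij
      have h2 : En X x0 / X i j ≤ Q y i j := by
        rw [div_le_iff₀ hp]; linarith
      have h3 : c ≤ Real.exp (Q y i j) := le_trans (hmin (i, j)) (Real.exp_le_exp.mpr h2)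
      rw [Q_eq hy hij, Real.exp_sub, Real.exp_log (num_pos hy hij),
        Real.exp_log (den_pos hy hij), le_div_iff₀ (den_pos hy hij)] at h3
      exact h3
  have hx0 := hsub x0 (x0_conf hN) (x0_gauge hN) le_rfl
  have hcont : ContinuousOn (En X) (Sset c) := by
    unfold En
    refine continuousOn_finsetSum _ fun a _ => continuousOn_finsetSum _ fun b _ => ?_
    by_cases hab : a = b
    · subst hab; simp; exact continuousOn_const
    · refine continuousOn_const.mul (ContinuousOn.log (by fun_prop) ?_)
      intro x hx
      exact sub_ne_zero.mpr ((Sset_conf hN hc hx).inj hab)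
  obtain ⟨x, hxS, hxmax⟩ := (Sset_compact hN c).exists_isMaxOn ⟨_, hx0⟩ hcont
  refine ⟨x, Sset_conf hN hc hxS, hxS.2.1, fun y hy hg => ?_⟩
  by_cases h : En X x0 ≤ En X y
  · exact hxmax (hsub y hy hg h)
  · have := hxmax hx0
    simp at this
    linarith

def RR (x : ZMod N → ℝ) (k : ZMod N) : ℝ := ∑ j, mm X k j / (x k - x j)

theorem mm_symm (hs : ∀ i j, X i j = X j i) (a b : ZMod N) : mm X a b = mm X b a := by
  unfold mm; rw [hs a (b+1), hs (a+1) b, hs a b, hs (a+1) (b+1)]; ring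

theorem mm_sum (a : ZMod N) : ∑ b, mm X a b = 0 := by
  unfold mm
  simp only [Finset.sum_add_distrib, Finset.sum_sub_distrib]
  have h1 : ∑ b, X a (b + 1) = ∑ b, X a b := Equiv.sum_comp (Equiv.addRight (1 : ZMod N)) (X a)
  have h2 : ∑ b, X (a + 1) (b + 1) = ∑ b, X (a + 1) b :=
    Equiv.sum_comp (Equiv.addRight (1 : ZMod N)) (X (a + 1))
  rw [h1, h2]; ring

theorem hasDeriv_En (hs : ∀ i j, X i j = X j i) {x : ZMod N → ℝ} (hx : Conf x) (k : ZMod N) :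
    HasDerivAt (fun t => En X (Function.update x k t)) (2 * RR X x k) (x k) := by
  classical
  have hterm : ∀ a b, HasDerivAt (fun t => mm X a b *
      Real.log (Function.update x k t a - Function.update x k t b))
      (mm X a b * (((if a = k then 1 else 0) - (if b = k then 1 else 0)) / (x a - x b))) (x k) := by
    intro a b
    by_cases hab : a = b
    · subst hab
      simp only [sub_self, Real.log_zero, mul_zero, zero_div]
      exact hasDerivAt_const _ _
    · refine HasDerivAt.const_mul _ ?_
      have hu : ∀ c, HasDerivAt (fun t => Function.update x k t c) (if c = k then 1 else 0) (x k) := by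
        intro c
        by_cases hc : c = k
        · subst hc; simp only [Function.update_self, if_true]; exact hasDerivAt_id _
        · simp only [Function.update_of_ne hc, if_neg hc]; exact hasDerivAt_const _ _
      have := ((hu a).sub (hu b)).log (by
        simp only [Function.update_eq_self, Pi.sub_apply]
        exact sub_ne_zero.mpr (hx.inj hab))
      simpa using this
  have hsum := HasDerivAt.fun_sum (u := Finset.univ) (fun a _ =>
    HasDerivAt.fun_sum (u := Finset.univ) (fun b _ => hterm a b))
  unfold En
  refine HasDerivAt.congr_deriv hsum ?_
  symm
  have : ∀ a b, mm X a b * (((if a = k then 1 else 0) - (if b = k then 1 else 0)) / (x a - x b))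
      = (if a = k then mm X a b / (x a - x b) else 0) - (if b = k then mm X a b / (x a - x b) else 0) := by
    intro a b
    split_ifs <;> ring
  simp only [this, Finset.sum_sub_distrib, Finset.sum_ite_eq', Finset.mem_univ, if_true]
  have h1 : ∑ a, ∑ b, (if a = k then mm X a b / (x a - x b) else 0)
      = ∑ b, mm X k b / (x k - x b) := by
    rw [Finset.sum_comm]
    simp only [Finset.sum_ite_eq', Finset.mem_univ, if_true]
  rw [h1]
  unfold RR
  rw [two_mul, sub_eq_add_neg, ← Finset.sum_neg_distrib]
  congr 1
  · refine Finset.sum_congr rfl fun b _ => ?_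
    rw [mm_symm X hs b k, ← neg_sub (x k) (x b), div_neg, neg_neg]

theorem RR_eq_zero_of_max (hs : ∀ i j, X i j = X j i)
    {x : ZMod N → ℝ} (hx : Conf x) (hg : Gauge x)
    (hmax : ∀ y, Conf y → Gauge y → En X y ≤ En X x) {k : ZMod N} (h0 : k ≠ 0) (h1 : k ≠ 1)
    (h2 : k ≠ -1) : RR X x k = 0 := by
  have hd := hasDeriv_En X hs hx k
  have hloc : IsLocalMax (fun t => En X (Function.update x k t)) (x k) := by
    have hconf : ∀ᶠ t in 𝓝 (x k), Conf (Function.update x k t) := by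
      unfold Conf
      simp only [eventually_all]
      intro a b hab
      have hc : ∀ c, Continuous (fun t => Function.update x k t c) := by
        intro c
        by_cases hc : c = k
        · subst hc; simp only [Function.update_self]; exact continuous_id
        · simp only [Function.update_of_ne hc]; exact continuous_const
      have := (hc a).continuousAt (x := x k)
      exact ((hc a).continuousAt).eventually_lt ((hc b).continuousAt) (by simpa using hx a b hab)
    filter_upwards [hconf] with t ht
    simp only [Function.update_eq_self]
    refine hmax _ ht ⟨?_, ?_, ?_⟩
    · rw [Function.update_of_ne h0.symm]; exact hg.1
    · rw [Function.update_of_ne h1.symm]; exact hg.2.1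
    · rw [Function.update_of_ne h2.symm]; exact hg.2.2
  have := hloc.hasDerivAt_eq_zero hd
  linarith

theorem mom0 (hs : ∀ i j, X i j = X j i) (x : ZMod N → ℝ) : ∑ k, RR X x k = 0 := by
  have h : ∑ k, RR X x k = - ∑ k, RR X x k := by
    unfold RR
    conv_lhs => rw [Finset.sum_comm]
    rw [← Finset.sum_neg_distrib]
    refine Finset.sum_congr rfl fun b _ => ?_
    rw [← Finset.sum_neg_distrib]
    refine Finset.sum_congr rfl fun a _ => ?_
    rw [mm_symm X hs, ← neg_sub, div_neg]
  linarith

theorem mom_gen (hs : ∀ i j, X i j = X j i) (hd : ∀ k, mm X k k = 0) {x : ZMod N → ℝ}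
    (hx : Conf x) (f : ℝ → ℝ) (g : ℝ → ℝ → ℝ) (hfg : ∀ s t, f s - f t = g s t * (s - t)) :
    2 * ∑ k, f (x k) * RR X x k = ∑ k, ∑ j, g (x k) (x j) * mm X k j := by
  have h : ∑ k, f (x k) * RR X x k = - ∑ k, ∑ j, f (x j) * (mm X k j / (x k - x j)) := by
    unfold RR
    simp only [Finset.mul_sum]
    conv_lhs => rw [Finset.sum_comm]
    rw [← Finset.sum_neg_distrib]
    refine Finset.sum_congr rfl fun b _ => ?_
    rw [← Finset.sum_neg_distrib]
    refine Finset.sum_congr rfl fun a _ => ?_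
    rw [mm_symm X hs, ← neg_sub, div_neg]; ring
  rw [two_mul]
  nth_rewrite 2 [h]
  unfold RR
  simp only [Finset.mul_sum]
  rw [← sub_eq_add_neg, ← Finset.sum_sub_distrib]
  refine Finset.sum_congr rfl fun a _ => ?_
  rw [← Finset.sum_sub_distrib]
  refine Finset.sum_congr rfl fun b _ => ?_
  by_cases hab : a = b
  · subst hab; rw [hd]; simp
  · have := sub_ne_zero.mpr (hx.inj hab)
    rw [← sub_mul, hfg]; field_simp

/-- Existence of a balanced configuration. -/
theorem exists_balanced (hN : 4 ≤ N) (hs : ∀ i j, X i j = X j i)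
    (hX0 : ∀ i j, ¬ NonAdj i j → X i j = 0) (hXp : ∀ i j, NonAdj i j → 0 < X i j) :
    ∃ x : ZMod N → ℝ, Conf x ∧ ∀ k, RR X x k = 0 := by
  classical
  obtain ⟨x, hx, hg, hmax⟩ := exists_max X hN hX0 hXp
  refine ⟨x, hx, ?_⟩
  have hother : ∀ k, k ≠ 0 → k ≠ 1 → k ≠ -1 → RR X x k = 0 := fun k h0 h1 h2 =>
    RR_eq_zero_of_max X hs hx hg hmax h0 h1 h2
  have hd : ∀ k, mm X k k = 0 := by
    intro k
    unfold mm
    rw [hX0 k (k+1) (by simp [NonAdj]), hX0 (k+1) k (by simp [NonAdj]),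
      hX0 k k (by simp [NonAdj]), hX0 (k+1) (k+1) (by simp [NonAdj])]
    ring
  obtain ⟨n1, n2, n3⟩ := one_ne hN
  have hred : ∀ f : ZMod N → ℝ, ∑ k, f k * RR X x k =
      f 0 * RR X x 0 + f 1 * RR X x 1 + f (-1) * RR X x (-1) := by
    intro f
    rw [← Finset.sum_subset (Finset.subset_univ ({0, 1, -1} : Finset (ZMod N)))]
    · rw [Finset.sum_insert (by simp [n1.symm, n2.symm]), Finset.sum_insert (by simp [n3]),
        Finset.sum_singleton]; ring
    · intro k _ hk
      simp at hk
      rw [hother k hk.1 hk.2.1 hk.2.2, mul_zero]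
  have m0 := mom0 X hs x
  have m1 := mom_gen X hs hd hx (fun s => s) (fun _ _ => 1) (fun s t => by ring)
  have m2 := mom_gen X hs hd hx (fun s => s ^ 2) (fun s t => s + t) (fun s t => by ring)
  have r1 : ∑ k, ∑ j, (1 : ℝ) * mm X k j = 0 := by simp [mm_sum]
  have r2 : ∑ k, ∑ j, (x k + x j) * mm X k j = 0 := by
    simp only [add_mul, Finset.sum_add_distrib]
    have : ∑ k, ∑ j, x j * mm X k j = ∑ k, ∑ j, x k * mm X k j := by
      rw [Finset.sum_comm]
      refine Finset.sum_congr rfl fun a _ => Finset.sum_congr rfl fun b _ => ?_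
      rw [mm_symm X hs]
    rw [this]
    simp only [← Finset.mul_sum, mm_sum]; simp
  rw [r1] at m1
  rw [r2] at m2
  have m0' : ∑ k, (1 : ℝ) * RR X x k = 0 := by simpa using m0
  have e0 := hred (fun _ => 1)
  have e1 := hred x
  have e2 := hred (fun k => x k ^ 2)
  rw [m0'] at e0
  rw [hg.1, hg.2.1, hg.2.2] at e1 e2
  have z1 : RR X x 1 = 0 := by linarith
  have z2 : RR X x (-1) = 0 := by linarith
  have z0 : RR X x 0 = 0 := by linarith
  intro k
  by_cases h0 : k = 0
  · rw [h0]; exact z0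
  by_cases h1 : k = 1
  · rw [h1]; exact z1
  by_cases h2 : k = -1
  · rw [h2]; exact z2
  exact hother k h0 h1 h2

end main

end Koba



/-! ## Geometry of unit polygons: odd chords -/

theorem ab_sq {a u : Pt} (ha : ‖a‖ = 1) (hu : ‖u‖ = 1) : dot2 a u ^ 2 + cross2 a u ^ 2 = 1 := by
  have h1 := unit_sq ha
  have h2 := unit_sq hu
  unfold dot2 cross2
  linear_combination (u 0 ^ 2 + u 1 ^ 2) * h1 + h2

theorem cross_ab {a u v : Pt} (ha : ‖a‖ = 1) :
    cross2 u v = dot2 a u * cross2 a v - cross2 a u * dot2 a v := by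
  have h1 := unit_sq ha
  unfold dot2 cross2
  linear_combination (- (u 0 * v 1 - u 1 * v 0)) * h1

theorem ext_ab {a u v : Pt} (ha : ‖a‖ = 1) (h1 : dot2 a u = dot2 a v)
    (h2 : cross2 a u = cross2 a v) : u = v := by
  have h := unit_sq ha
  unfold dot2 at h1
  unfold cross2 at h2
  refine pt_ext ?_ ?_
  · linear_combination (a 0) * h1 - (a 1) * h2 - (u 0 - v 0) * h
  · linear_combination (a 1) * h1 + (a 0) * h2 - (u 1 - v 1) * h

theorem exists_theta {L : ℕ} {u : ℕ → Pt} {a : Pt} (ha : ‖a‖ = 1) (hu : ∀ t, ‖u t‖ = 1)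
    (hd : ∀ t < L, 0 ≤ dot2 a (u t)) (hc : ∀ t, 0 ≤ cross2 (u t) (u (t + 1)))
    (he : ∀ t, cross2 (u t) (u (t + 1)) = 0 → u (t + 1) = u t) :
    ∃ θ : ℕ → ℝ, (∀ s t, s ≤ t → t < L → θ s ≤ θ t) ∧
      (∀ t, θ t ∈ Icc (-(Real.pi / 2)) (Real.pi / 2)) ∧
      ∀ t < L, dot2 a (u t) = Real.cos (θ t) ∧ cross2 a (u t) = Real.sin (θ t) := by
  have habs : ∀ t, -1 ≤ cross2 a (u t) ∧ cross2 a (u t) ≤ 1 := by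
    intro t
    have := ab_sq ha (hu t)
    constructor <;> nlinarith [sq_nonneg (dot2 a (u t))]
  refine ⟨fun t => Real.arcsin (cross2 a (u t)), ?_, fun t => Real.arcsin_mem_Icc _, ?_⟩
  · have hstep : ∀ t, t + 1 < L → cross2 a (u t) ≤ cross2 a (u (t + 1)) := by
      intro t ht
      by_contra hlt
      push Not at hlt
      have hα := hd t (by omega)
      have hβ := hd (t + 1) ht
      have hc1 := hc t
      have hs1 := ab_sq ha (hu t)
      have hs2 := ab_sq ha (hu (t + 1))
      have hne : cross2 (u t) (u (t + 1)) ≠ 0 := by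
        intro h
        rw [he t h] at hlt
        exact lt_irrefl _ hlt
      have hpos : 0 < cross2 (u t) (u (t + 1)) := lt_of_le_of_ne hc1 hne.symm
      rw [cross_ab ha] at hpos
      set p := dot2 a (u t)
      set p' := dot2 a (u (t + 1))
      set q := cross2 a (u t)
      set q' := cross2 a (u (t + 1))
      rcases le_total 0 q' with h | h
      · have : p ≤ p' := by nlinarith
        nlinarith
      · rcases le_total 0 q with h2 | h2
        · nlinarith
        · have : p' ≤ p := by nlinarith
          nlinarith
    intro s t hst
    induction t, hst using Nat.le_induction with
    | base => intro _; exact le_rfl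
    | succ t _ ih =>
      intro ht
      exact (ih (by omega)).trans (Real.arcsin_le_arcsin (hstep t ht))
  · intro t ht
    refine ⟨?_, (Real.sin_arcsin (habs t).1 (habs t).2).symm⟩
    rw [Real.cos_arcsin]
    have := ab_sq ha (hu t)
    rw [show 1 - cross2 a (u t) ^ 2 = dot2 a (u t) ^ 2 by linarith, Real.sqrt_sq (hd t ht)]

theorem imo (h : ℕ) : ∀ θ : ℕ → ℝ, (∀ s t, s ≤ t → t ≤ 2 * h → θ s ≤ θ t) →
    θ (2 * h) - θ 0 ≤ Real.pi →
    1 ≤ (∑ t ∈ Finset.range (2 * h + 1), Real.cos (θ t)) ^ 2 +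
      (∑ t ∈ Finset.range (2 * h + 1), Real.sin (θ t)) ^ 2 ∧
    ((∑ t ∈ Finset.range (2 * h + 1), Real.cos (θ t)) ^ 2 +
      (∑ t ∈ Finset.range (2 * h + 1), Real.sin (θ t)) ^ 2 ≤ 1 →
      ∀ t < h, θ t = θ 0 ∧ θ (2 * h - t) = θ 0 + Real.pi) := by
  induction h with
  | zero =>
    intro θ _ _
    simp
  | succ h ih =>
    intro θ hm hpi
    have ih' := ih (fun t => θ (t + 1)) (fun s t hst ht => hm _ _ (by omega) (by omega)) (by
      have h1 := hm (2 * h + 1) (2 * (h + 1)) (by omega) (by omega)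
      have h2 := hm 0 1 (by omega) (by omega)
      simp only [zero_add]
      linarith)
    have hsum : ∀ f : ℝ → ℝ, ∑ t ∈ Finset.range (2 * (h + 1) + 1), f (θ t) =
        ∑ t ∈ Finset.range (2 * h + 1), f (θ (t + 1)) + (f (θ 0) + f (θ (2 * (h + 1)))) := by
      intro f
      rw [Finset.sum_range_succ, show 2 * (h + 1) = (2 * h + 1) + 1 by ring,
        Finset.sum_range_succ']
      ring
    rw [hsum Real.cos, hsum Real.sin]
    set C := ∑ t ∈ Finset.range (2 * h + 1), Real.cos (θ (t + 1)) with hC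
    set S := ∑ t ∈ Finset.range (2 * h + 1), Real.sin (θ (t + 1)) with hS
    set x := θ 0 with hx
    set y := θ (2 * (h + 1)) with hy
    have hxy : x ≤ y := hm _ _ (by omega) le_rfl
    have hcross : 0 ≤ C * (Real.cos x + Real.cos y) + S * (Real.sin x + Real.sin y) := by
      rw [hC, hS, Finset.sum_mul, Finset.sum_mul, ← Finset.sum_add_distrib]
      refine Finset.sum_nonneg fun t ht => ?_
      have ht' : t < 2 * h + 1 := Finset.mem_range.mp ht
      have h1 : x ≤ θ (t + 1) := hm _ _ (by omega) (by omega)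
      have h2 : θ (t + 1) ≤ y := hm _ _ (by omega) le_rfl
      set z := θ (t + 1)
      have e1 : Real.cos z * (Real.cos x + Real.cos y) + Real.sin z * (Real.sin x + Real.sin y)
          = Real.cos (z - x) + Real.cos (y - z) := by
        rw [Real.cos_sub, Real.cos_sub]; ring
      rw [e1, Real.cos_add_cos]
      refine mul_nonneg (mul_nonneg zero_le_two (Real.cos_nonneg_of_neg_pi_div_two_le_of_le ?_ ?_))
        (Real.cos_nonneg_of_neg_pi_div_two_le_of_le ?_ ?_) <;> linarith
    have hw : (Real.cos x + Real.cos y) ^ 2 + (Real.sin x + Real.sin y) ^ 2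
        = 2 + 2 * Real.cos (y - x) := by
      rw [Real.cos_sub]
      linear_combination Real.sin_sq_add_cos_sq x + Real.sin_sq_add_cos_sq y
    have hcos := Real.neg_one_le_cos (y - x)
    obtain ⟨i1, i2⟩ := ih'
    have key : (C + (Real.cos x + Real.cos y)) ^ 2 + (S + (Real.sin x + Real.sin y)) ^ 2 =
      C ^ 2 + S ^ 2 + 2 * (C * (Real.cos x + Real.cos y) + S * (Real.sin x + Real.sin y)) +
       (2 + 2 * Real.cos (y - x)) := by rw [← hw]; ring
    rw [key]
    refine ⟨by linarith, fun hle => ?_⟩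
    have hc1 : Real.cos (y - x) = -1 := by linarith
    have hyx : y = x + Real.pi := by
      have h0 : Real.cos (y - x) = Real.cos Real.pi := by rw [hc1, Real.cos_pi]
      have := Real.injOn_cos ⟨by linarith, hpi⟩ ⟨Real.pi_pos.le, le_rfl⟩ h0
      linarith
    have i3 := i2 (by linarith)
    intro t ht
    rcases Nat.eq_zero_or_pos t with h0 | h0
    · subst h0; exact ⟨rfl, hyx⟩
    · obtain ⟨s, rfl⟩ : ∃ s, t = s + 1 := ⟨t - 1, by omega⟩
      obtain ⟨j1, j2⟩ := i3 0 (by omega)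
      obtain ⟨k1, k2⟩ := i3 s (by omega)
      simp only [zero_add] at j1 j2 k1 k2
      have m1 := hm 0 1 (by omega) (by omega)
      have m2 := hm (2 * h - 0 + 1) (2 * (h + 1)) (by omega) (by omega)
      have e1 : θ 1 = x := by linarith
      refine ⟨by rw [k1, e1], ?_⟩
      rw [show 2 * (h + 1) - (s + 1) = 2 * h - s + 1 by omega, k2, e1]

namespace UnitPolygon

variable {n : ℕ} (P : UnitPolygon n)

/-- rotation by a quarter turn -/
def J (v : Pt) : Pt := vec2 (-(v 1)) (v 0)

theorem dot2_J (v w : Pt) : dot2 (J v) w = cross2 v w := by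
  unfold dot2 J cross2; rw [vec2_zero, vec2_one]; ring

theorem norm_J (v : Pt) : ‖J v‖ = ‖v‖ := by
  have h : ‖J v‖ ^ 2 = ‖v‖ ^ 2 := by
    rw [pt_norm_sq, pt_norm_sq]; unfold J; rw [vec2_zero, vec2_one]; ring
  exact (pow_left_inj₀ (norm_nonneg _) (norm_nonneg _) two_ne_zero).mp h

theorem cross2_sum (u : Pt) (s : Finset ℕ) (f : ℕ → Pt) :
    cross2 u (∑ k ∈ s, f k) = ∑ k ∈ s, cross2 u (f k) := by
  classical
  induction s using Finset.induction_on with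
  | empty => simp [cross2]
  | insert a s ha ih => rw [Finset.sum_insert ha, Finset.sum_insert ha, cross2_add_right, ih]

theorem dot2_sum (u : Pt) (s : Finset ℕ) (f : ℕ → Pt) :
    dot2 u (∑ k ∈ s, f k) = ∑ k ∈ s, dot2 u (f k) := by
  classical
  induction s using Finset.induction_on with
  | empty => simp [dot2]
  | insert a s ha ih => rw [Finset.sum_insert ha, Finset.sum_insert ha, dot2_add_right, ih]

theorem cast_period (i : ZMod (2 * n)) (t : ℕ) : i + ((t + 2 * n : ℕ) : ZMod (2 * n)) = i + t := by
  push_cast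
  have : (2 : ZMod (2 * n)) * (n : ZMod (2 * n)) = 0 := by
    have := ZMod.natCast_self (2 * n)
    push_cast at this; exact this
  rw [this, add_zero]

theorem turn (i : ZMod (2 * n)) : ∃ r : ℕ, (∀ t < r, 0 ≤ cross2 (P.e i) (P.e (i + t))) ∧
    ∀ t, r ≤ t → t < 2 * n → cross2 (P.e i) (P.e (i + t)) ≤ 0 := by
  have hJ : J (P.e i) ≠ 0 := by
    intro h
    have := norm_J (P.e i)
    rw [h, norm_zero, P.norm_e] at this
    norm_num at this
  obtain ⟨M, r, hr0, hr1, hA, hB⟩ := P.unimodal hJ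
  simp only [dot2_J] at hA hB
  have hnz := P.neZero
  set s := (i - M).val with hs
  have hsN : s < 2 * n := ZMod.val_lt _
  have hi : i = M + s := by rw [hs, ZMod.natCast_zmod_val]; ring
  have hh : ∀ j, 0 ≤ cross2 (P.e i) (P.vtx j - P.vtx i) := P.edge_vtx_nonneg i
  -- forward steps
  have h1 : ∀ t, s ≤ t → t < r → 0 ≤ cross2 (P.e i) (P.e (M + t)) := by
    intro t hst htr
    have h2 := hh (M + ((t + 1 : ℕ) : ZMod (2 * n)))
    nth_rewrite 2 [hi] at h2
    rw [P.vtx_shift M s (t + 1) (by omega), cross2_sum,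
      Finset.sum_Ico_succ_top hst] at h2
    have h3 : ∑ k ∈ Finset.Ico s t, cross2 (P.e i) (P.e (M + k)) ≤ 0 :=
      Finset.sum_nonpos fun k hk => hA k (by have := (Finset.mem_Ico.mp hk).2; omega)
    linarith
  have h2 : ∀ t, r ≤ t → t < s → cross2 (P.e i) (P.e (M + t)) ≤ 0 := by
    intro t hrt hts
    have h2 := hh (M + t)
    have h4 := P.vtx_shift M t s (by omega)
    rw [← hi] at h4
    rw [← neg_sub, h4, cross2_neg_right, cross2_sum,
      Finset.sum_eq_sum_Ico_succ_bot hts] at h2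
    have h3 : 0 ≤ ∑ k ∈ Finset.Ico (t + 1) s, cross2 (P.e i) (P.e (M + k)) :=
      Finset.sum_nonneg fun k hk => hB k (by have := (Finset.mem_Ico.mp hk).1; omega)
        (by have := (Finset.mem_Ico.mp hk).2; omega)
    linarith
  refine ⟨2 * n - s, fun t ht => ?_, fun t ht1 ht2 => ?_⟩
  · have : i + (t : ZMod (2 * n)) = M + ((s + t : ℕ) : ZMod (2 * n)) := by
      rw [hi]; push_cast; ring
    rw [this]
    rcases lt_or_ge (s + t) r with h | h
    · exact h1 _ (by omega) h
    · exact hB _ h (by omega)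
  · obtain ⟨t', ht'⟩ : ∃ t', s + t = t' + 2 * n := ⟨s + t - 2 * n, by omega⟩
    have : i + (t : ZMod (2 * n)) = M + (t' : ZMod (2 * n)) := by
      rw [← cast_period M t', ← ht', hi]; push_cast; ring
    rw [this]
    rcases lt_or_ge t' r with h | h
    · exact hA _ h
    · exact h2 _ h (by omega)

/-- an odd arc in a half plane with short chord. -/
theorem arc (i : ZMod (2 * n)) (h : ℕ) {a : Pt} (ha : ‖a‖ = 1)
    (hd : ∀ t < 2 * h + 1, 0 ≤ dot2 a (P.e (i + t)))
    (hl : ‖P.vtx (i + ((2 * h + 1 : ℕ) : ZMod (2 * n))) - P.vtx i‖ ≤ 1) :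
    ∀ t < h, P.e (i + t) = P.e i ∧ P.e (i + ((2 * h - t : ℕ) : ZMod (2 * n))) = - P.e i := by
  obtain ⟨θ, hm, hI, hθ⟩ := exists_theta (L := 2 * h + 1) (u := fun t : ℕ => P.e (i + t)) ha
    (fun t => P.norm_e _) hd
    (fun t => by have := P.cross_e_succ (i + t); push_cast; rw [← add_assoc]; exact this)
    (fun t ht => by
      push_cast at ht ⊢
      rw [← add_assoc] at ht ⊢
      exact P.e_succ_eq _ ht)
  have himo := (imo h θ (fun s t hst ht => hm s t hst (by omega)) (by
    have := (hI (2 * h)).2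
    have := (hI 0).1
    linarith)).2
  have hs := P.vtx_shift i 0 (2 * h + 1) (by omega)
  rw [Nat.cast_zero, add_zero, ← Finset.range_eq_Ico] at hs
  rw [hs] at hl
  set D := ∑ k ∈ Finset.range (2 * h + 1), P.e (i + k) with hD
  have hc : dot2 a D = ∑ t ∈ Finset.range (2 * h + 1), Real.cos (θ t) := by
    rw [hD, dot2_sum]
    exact Finset.sum_congr rfl fun t ht => (hθ t (Finset.mem_range.mp ht)).1
  have hs : cross2 a D = ∑ t ∈ Finset.range (2 * h + 1), Real.sin (θ t) := by
    rw [hD, cross2_sum]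
    exact Finset.sum_congr rfl fun t ht => (hθ t (Finset.mem_range.mp ht)).2
  have hDsq : dot2 a D ^ 2 + cross2 a D ^ 2 ≤ 1 := by
    have h1 := unit_sq ha
    have h2 := pt_norm_sq D
    have h3 : dot2 a D ^ 2 + cross2 a D ^ 2 = ‖D‖ ^ 2 := by
      rw [h2]; unfold dot2 cross2
      linear_combination (D 0 ^ 2 + D 1 ^ 2) * h1
    rw [h3]
    have := norm_nonneg D
    nlinarith
  rw [hc, hs] at hDsq
  have key := himo hDsq
  have hz := hθ 0 (by omega)
  simp only [Nat.cast_zero, add_zero] at hz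
  intro t ht
  obtain ⟨k1, k2⟩ := key t ht
  refine ⟨ext_ab ha ?_ ?_, ext_ab ha ?_ ?_⟩
  · rw [(hθ t (by omega)).1, hz.1, k1]
  · rw [(hθ t (by omega)).2, hz.2, k1]
  · rw [(hθ (2 * h - t) (by omega)).1, dot2_neg_right, hz.1, k2, Real.cos_add_pi]
  · rw [(hθ (2 * h - t) (by omega)).2, cross2_neg_right, hz.2, k2, Real.sin_add_pi]

end UnitPolygon



theorem sum_antisymm (h : ℕ) (g : ℕ → Pt) (hg : ∀ t < h, g (2 * h - t) = - g t) :
    ∑ t ∈ Finset.range (2 * h + 1), g t = g h := by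
  have h1 := Finset.sum_range_reflect g (2 * h + 1)
  have h2 : ∑ t ∈ Finset.range (2 * h + 1), (g t + g (2 * h + 1 - 1 - t)) = g h + g h := by
    rw [Finset.sum_eq_single h]
    · rw [show 2 * h + 1 - 1 - h = h by omega]
    · intro t ht hne
      have ht' := Finset.mem_range.mp ht
      rcases lt_or_gt_of_ne hne with h3 | h3
      · rw [show 2 * h + 1 - 1 - t = 2 * h - t by omega, hg t h3]; simp
      · have := hg (2 * h - t) (by omega)
        rw [show 2 * h - (2 * h - t) = t by omega] at this
        rw [show 2 * h + 1 - 1 - t = 2 * h - t by omega, this]; simp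
    · intro h3; exact absurd (Finset.mem_range.mpr (by omega)) h3
  rw [Finset.sum_add_distrib, h1, ← two_smul ℝ, ← two_smul ℝ] at h2
  exact smul_right_injective _ (two_ne_zero : (2 : ℝ) ≠ 0) h2

theorem seg_line (A w : Pt) {α β : ℝ} (h : α ≤ β) (x : Pt) :
    x ∈ segment ℝ (A + α • w) (A + β • w) ↔ ∃ s, α ≤ s ∧ s ≤ β ∧ x = A + s • w := by
  rw [segment_eq_image']
  constructor
  · rintro ⟨θ, ⟨h0, h1⟩, rfl⟩
    refine ⟨α + θ * (β - α), by nlinarith, by nlinarith, ?_⟩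
    module
  · rintro ⟨s, h0, h1, rfl⟩
    rcases h.lt_or_eq with h2 | h2
    · have h3 : 0 < β - α := by linarith
      refine ⟨(s - α) / (β - α), ⟨div_nonneg (by linarith) h3.le, ?_⟩, ?_⟩
      · rw [div_le_one h3]; linarith
      · simp only
        have : (s - α) / (β - α) * (β - α) = s - α := by field_simp
        rw [show A + β • w - (A + α • w) = (β - α) • w by module, smul_smul, this]
        module
    · refine ⟨0, ⟨le_rfl, zero_le_one⟩, ?_⟩
      rw [show s = α by linarith]; simp

theorem seg_split (A w : Pt) (m : ℕ) (hm : 1 ≤ m) (x : Pt) :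
    x ∈ segment ℝ A (A + (m : ℝ) • w) ↔
      ∃ t < m, x ∈ segment ℝ (A + (t : ℝ) • w) (A + ((t + 1 : ℕ) : ℝ) • w) := by
  have h0 := seg_line A w (Nat.cast_nonneg (α := ℝ) m) x
  rw [zero_smul, add_zero] at h0
  rw [h0]
  constructor
  · rintro ⟨s, s0, s1, hx⟩
    rcases s1.lt_or_eq with h | h
    · refine ⟨⌊s⌋₊, (Nat.floor_lt s0).mpr h, ?_⟩
      rw [seg_line A w (by push_cast; linarith)]
      refine ⟨s, Nat.floor_le s0, ?_, hx⟩
      push_cast; exact (Nat.lt_floor_add_one s).le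
    · refine ⟨m - 1, by omega, ?_⟩
      rw [seg_line A w (by push_cast; linarith), Nat.sub_add_cancel hm]
      exact ⟨s, by rw [h]; exact_mod_cast Nat.sub_le m 1, s1, hx⟩
  · rintro ⟨t, ht, hx⟩
    rw [seg_line A w (by push_cast; linarith)] at hx
    obtain ⟨s, s0, s1, hx⟩ := hx
    have : ((t + 1 : ℕ) : ℝ) ≤ m := by exact_mod_cast ht
    exact ⟨s, le_trans (Nat.cast_nonneg _) s0, s1.trans this, hx⟩

namespace UnitPolygon

variable {n : ℕ} (P : UnitPolygon n)

theorem vtx_run (j : ZMod (2 * n)) (s m : ℕ) (w : Pt)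
    (h : ∀ t, s ≤ t → t < s + m → P.e (j + t) = w) (t : ℕ) (ht : t ≤ m) :
    P.vtx (j + ((s + t : ℕ) : ZMod (2 * n))) = P.vtx (j + s) + (t : ℝ) • w := by
  have h1 := P.vtx_shift j s (s + t) (by omega)
  rw [Finset.sum_congr rfl (g := fun _ => w) (fun k hk => by
    have := Finset.mem_Ico.mp hk
    exact h k this.1 (by omega))] at h1
  rw [Finset.sum_const, Nat.card_Ico, show s + t - s = t by omega, ← Nat.cast_smul_eq_nsmul ℝ] at h1
  rw [← h1]; abel

theorem special_of (hn : 3 ≤ n) (j : ZMod (2 * n)) (v w : Pt) (h0 : P.e j = v)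
    (h1 : ∀ t, 1 ≤ t → t < 1 + (n - 1) → P.e (j + t) = w)
    (h2 : P.e (j + n) = -v)
    (h3 : ∀ t, n + 1 ≤ t → t < n + 1 + (n - 1) → P.e (j + t) = -w) : P.IsSpecial := by
  have hnz := P.neZero
  have hv : ‖v‖ = 1 := by rw [← h0]; exact P.norm_e _
  have hw : ‖w‖ = 1 := by rw [← h1 1 le_rfl (by omega)]; exact P.norm_e _
  have hn1 : ((n - 1 : ℕ) : ℝ) = (n : ℝ) - 1 := by rw [Nat.cast_sub (by omega)]; simp
  have r1 := P.vtx_run j 1 (n - 1) w h1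
  have r2 := P.vtx_run j (n + 1) (n - 1) (-w) h3
  have v1 : P.vtx (j + ((1 : ℕ) : ZMod (2 * n))) = P.vtx j + v := by
    rw [← h0]; unfold e; push_cast; abel
  have vn : P.vtx (j + (n : ZMod (2 * n))) = P.vtx j + v + ((n - 1 : ℕ) : ℝ) • w := by
    have := r1 (n - 1) le_rfl
    rw [show 1 + (n - 1) = n by omega, v1] at this
    exact this
  have vn1 : P.vtx (j + ((n + 1 : ℕ) : ZMod (2 * n))) = P.vtx j + ((n - 1 : ℕ) : ℝ) • w := by
    have : P.vtx (j + ((n + 1 : ℕ) : ZMod (2 * n))) = P.vtx (j + n) + P.e (j + n) := by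
      unfold e; push_cast; rw [← add_assoc]; abel
    rw [this, h2, vn]; abel
  refine ⟨hn, P.vtx j, v, ((n - 1 : ℕ) : ℝ) • w, hv, ?_, ?_⟩
  · rw [norm_smul, hw, mul_one, Real.norm_of_nonneg (Nat.cast_nonneg _), hn1]
  rw [P.frontier_eq]
  have s2 := seg_split (P.vtx j + v) w (n - 1) (by omega)
  have s4 := seg_split (P.vtx j + ((n - 1 : ℕ) : ℝ) • w) (-w) (n - 1) (by omega)
  rw [show P.vtx j + ((n - 1 : ℕ) : ℝ) • w + ((n - 1 : ℕ) : ℝ) • (-w) = P.vtx j by module] at s4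
  have u1 : ∀ t, t < n - 1 → segment ℝ (P.vtx (j + ((1 + t : ℕ) : ZMod (2 * n))))
      (P.vtx (j + ((1 + t : ℕ) : ZMod (2 * n)) + 1)) =
      segment ℝ (P.vtx j + v + (t : ℝ) • w) (P.vtx j + v + ((t + 1 : ℕ) : ℝ) • w) := by
    intro t ht
    rw [← v1, ← r1 t (by omega), ← r1 (t + 1) (by omega)]
    congr 2; push_cast; ring
  have u2 : ∀ t, t < n - 1 → segment ℝ (P.vtx (j + ((n + 1 + t : ℕ) : ZMod (2 * n))))
      (P.vtx (j + ((n + 1 + t : ℕ) : ZMod (2 * n)) + 1)) =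
      segment ℝ (P.vtx j + ((n - 1 : ℕ) : ℝ) • w + (t : ℝ) • (-w))
        (P.vtx j + ((n - 1 : ℕ) : ℝ) • w + ((t + 1 : ℕ) : ℝ) • (-w)) := by
    intro t ht
    rw [← vn1, ← r2 t (by omega), ← r2 (t + 1) (by omega)]
    congr 2; push_cast; ring
  have w0 : segment ℝ (P.vtx j) (P.vtx (j + 1)) = segment ℝ (P.vtx j) (P.vtx j + v) := by
    rw [← v1]; simp
  have wn : segment ℝ (P.vtx (j + n)) (P.vtx (j + n + 1)) =
      segment ℝ (P.vtx j + v + ((n - 1 : ℕ) : ℝ) • w) (P.vtx j + ((n - 1 : ℕ) : ℝ) • w) := by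
    rw [← vn1, ← vn]; push_cast; rw [add_assoc]
  ext x
  simp only [mem_iUnion, mem_union]
  constructor
  · rintro ⟨i, hi⟩
    set t := (i - j).val with ht
    have htN : t < 2 * n := ZMod.val_lt _
    have hit : i = j + t := by rw [ht, ZMod.natCast_zmod_val]; ring
    rcases Nat.eq_zero_or_pos t with c0 | c0
    · rw [hit, c0] at hi
      simp only [Nat.cast_zero, add_zero] at hi
      rw [w0] at hi
      exact Or.inl (Or.inl (Or.inl hi))
    rcases lt_or_ge t n with c1 | c1
    · obtain ⟨s, hs⟩ : ∃ s, t = 1 + s := ⟨t - 1, by omega⟩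
      rw [hit, hs, u1 s (by omega)] at hi
      exact Or.inl (Or.inl (Or.inr ((s2 x).mpr ⟨s, by omega, hi⟩)))
    rcases c1.eq_or_lt with c2 | c2
    · rw [hit, ← c2, wn] at hi
      exact Or.inl (Or.inr hi)
    · obtain ⟨s, hs⟩ : ∃ s, t = n + 1 + s := ⟨t - (n + 1), by omega⟩
      rw [hit, hs, u2 s (by omega)] at hi
      exact Or.inr ((s4 x).mpr ⟨s, by omega, hi⟩)
  · rintro (((hx | hx) | hx) | hx)
    · exact ⟨j, by rw [w0]; exact hx⟩
    · obtain ⟨t, ht, hx⟩ := (s2 x).mp hx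
      exact ⟨_, by rw [u1 t ht]; exact hx⟩
    · exact ⟨j + n, by rw [wn]; exact hx⟩
    · obtain ⟨t, ht, hx⟩ := (s4 x).mp hx
      exact ⟨_, by rw [u2 t ht]; exact hx⟩

theorem special_of_arc (i : ZMod (2 * n)) (h h' : ℕ) (hh : 1 ≤ h) (hh' : 1 ≤ h')
    (hn : n = h + h' + 1) {a : Pt} (ha : ‖a‖ = 1)
    (hd : ∀ t < 2 * h + 1, 0 ≤ dot2 a (P.e (i + t)))
    (hl : ‖P.vtx (i + ((2 * h + 1 : ℕ) : ZMod (2 * n))) - P.vtx i‖ ≤ 1) : P.IsSpecial := by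
  have A1 := P.arc i h ha hd hl
  have hlast : P.e (i + ((2 * h : ℕ) : ZMod (2 * n))) = -P.e i := (A1 0 (by omega)).2
  have hvL : P.vtx (i + ((2 * h + 1 : ℕ) : ZMod (2 * n))) =
      P.vtx (i + ((2 * h : ℕ) : ZMod (2 * n))) + P.e (i + ((2 * h : ℕ) : ZMod (2 * n))) := by
    unfold e; push_cast; rw [← add_assoc]; abel
  obtain ⟨r, hr1, hr2⟩ := P.turn i
  have hneg : ∀ t, 2 * h + 1 ≤ t → t < 2 * n → cross2 (P.e i) (P.e (i + t)) ≤ 0 := by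
    intro t ht1 ht2
    rcases lt_or_ge t r with c | c
    · have h1 := P.edge_vtx_nonneg (i + ((2 * h : ℕ) : ZMod (2 * n)))
        (i + ((t + 1 : ℕ) : ZMod (2 * n)))
      have h2 : P.vtx (i + ((t + 1 : ℕ) : ZMod (2 * n))) - P.vtx (i + ((2 * h : ℕ) : ZMod (2 * n)))
          = ∑ k ∈ Finset.Ico (2 * h) (t + 1), P.e (i + k) := P.vtx_shift i _ _ (by omega)
      rw [h2, cross2_sum, hlast, Finset.sum_eq_sum_Ico_succ_bot (by omega),
        Finset.sum_Ico_succ_top (by omega), hlast, cross2_self, zero_add] at h1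
      simp only [cross2_neg_left] at h1
      rw [Finset.sum_neg_distrib] at h1
      have h3 : 0 ≤ ∑ k ∈ Finset.Ico (2 * h + 1) t, cross2 (P.e i) (P.e (i + k)) :=
        Finset.sum_nonneg fun k hk => hr1 k (by have := (Finset.mem_Ico.mp hk).2; omega)
      linarith
    · exact hr2 t c ht2
  set i' := i + ((2 * h + 1 : ℕ) : ZMod (2 * n)) with hi'
  have hshift : ∀ t : ℕ, i' + (t : ZMod (2 * n)) = i + ((2 * h + 1 + t : ℕ) : ZMod (2 * n)) := by
    intro t; rw [hi']; push_cast; ring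
  have hwrap : ∀ t : ℕ, i + ((2 * n + t : ℕ) : ZMod (2 * n)) = i + t := by
    intro t; rw [add_comm (2 * n) t, cast_period]
  have hback : i' + ((2 * h' + 1 : ℕ) : ZMod (2 * n)) = i := by
    rw [hshift, show 2 * h + 1 + (2 * h' + 1) = 2 * n + 0 by omega, hwrap]; simp
  have A2 := P.arc i' h' (a := - J (P.e i)) (by rw [norm_neg, norm_J, P.norm_e]) (by
    intro t ht
    have : dot2 (-J (P.e i)) (P.e (i' + t)) = - cross2 (P.e i) (P.e (i' + t)) := by
      rw [← dot2_J]; simp [dot2]; ring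
    rw [this, hshift]
    have := hneg (2 * h + 1 + t) (by omega) (by omega)
    linarith) (by rw [hback, norm_sub_rev]; exact hl)
  -- f = - e i
  have hpred : P.e (i' + ((2 * h' : ℕ) : ZMod (2 * n))) = - P.e i' := (A2 0 (by omega)).2
  have hf : P.e i' = - P.e i := by
    have c1 := P.cross_e_succ (i + ((2 * h : ℕ) : ZMod (2 * n)))
    rw [hlast] at c1
    have e1 : i + ((2 * h : ℕ) : ZMod (2 * n)) + 1 = i' := by rw [hi']; push_cast; ring
    rw [e1] at c1
    have c2 := P.cross_e_succ (i' + ((2 * h' : ℕ) : ZMod (2 * n)))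
    rw [hpred] at c2
    have e2 : i' + ((2 * h' : ℕ) : ZMod (2 * n)) + 1 = i := by
      rw [← hback]; push_cast; ring
    rw [e2] at c2
    rw [cross2_neg_left] at c1 c2
    rw [cross2_comm] at c2
    have := P.e_succ_eq (i + ((2 * h : ℕ) : ZMod (2 * n))) (by
      rw [hlast, e1, cross2_neg_left]; linarith)
    rw [e1, hlast] at this
    exact this
  have S1 := P.vtx_shift i 0 (2 * h + 1) (by omega)
  rw [← Finset.range_eq_Ico, sum_antisymm h (fun t : ℕ => P.e (i + t)) (fun t ht => by
    rw [(A1 t ht).2, (A1 t ht).1])] at S1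
  have S2 := P.vtx_shift i' 0 (2 * h' + 1) (by omega)
  rw [← Finset.range_eq_Ico, sum_antisymm h' (fun t : ℕ => P.e (i' + t)) (fun t ht => by
    rw [(A2 t ht).2, (A2 t ht).1])] at S2
  rw [hback, Nat.cast_zero, add_zero] at S2
  rw [Nat.cast_zero, add_zero, ← hi'] at S1
  have hsh : ∀ t : ℕ, i + (h : ZMod (2 * n)) + (t : ZMod (2 * n)) = i + ((h + t : ℕ) : ZMod (2 * n)) := by
    intro t; push_cast; ring
  refine P.special_of (by omega) (i + h) (P.e (i + h)) (- P.e i) rfl ?_ ?_ ?_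
  · intro t ht1 ht2
    rw [hsh]
    rcases le_or_gt (h + t) (2 * h) with c | c
    · have := (A1 (2 * h - (h + t)) (by omega)).2
      rw [show 2 * h - (2 * h - (h + t)) = h + t by omega] at this
      exact this
    · obtain ⟨s, hs⟩ : ∃ s, h + t = 2 * h + 1 + s := ⟨h + t - (2 * h + 1), by omega⟩
      rw [hs, ← hshift, (A2 s (by omega)).1, hf]
  · rw [hsh, show h + n = 2 * h + 1 + h' by omega, ← hshift, ← S2, ← S1]; abel
  · intro t ht1 ht2
    rw [hsh, neg_neg]
    rcases lt_or_ge (h + t) (2 * n) with c | c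
    · obtain ⟨s, hs⟩ : ∃ s, h + t = 2 * h + 1 + s := ⟨h + t - (2 * h + 1), by omega⟩
      rw [hs, ← hshift]
      have := (A2 (2 * h' - s) (by omega)).2
      rw [show 2 * h' - (2 * h' - s) = s by omega, hf, neg_neg] at this
      exact this
    · obtain ⟨s, hs⟩ : ∃ s, h + t = 2 * n + s := ⟨h + t - 2 * n, by omega⟩
      rw [hs, hwrap]
      exact (A1 s (by omega)).1

theorem chord_gt (hns : ¬ P.IsSpecial) (i : ZMod (2 * n)) (h h' : ℕ) (hh : 1 ≤ h) (hh' : 1 ≤ h')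
    (hn : n = h + h' + 1) : 1 < ‖P.vtx (i + ((2 * h + 1 : ℕ) : ZMod (2 * n))) - P.vtx i‖ := by
  by_contra hlt
  push Not at hlt
  apply hns
  obtain ⟨r, hr1, hr2⟩ := P.turn i
  rcases le_or_gt (2 * h + 1) r with c | c
  · refine P.special_of_arc i h h' hh hh' hn (a := J (P.e i)) (by rw [norm_J, P.norm_e]) ?_ hlt
    intro t ht
    rw [dot2_J]; exact hr1 t (by omega)
  · refine P.special_of_arc (i + ((2 * h + 1 : ℕ) : ZMod (2 * n))) h' h hh' hh (by omega)
      (a := -J (P.e i)) (by rw [norm_neg, norm_J, P.norm_e]) ?_ ?_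
    · intro t ht
      have : ∀ v, dot2 (-J (P.e i)) v = - cross2 (P.e i) v := by
        intro v
        rw [← dot2_J]; simp [dot2]; ring
      rw [this]
      have := hr2 (2 * h + 1 + t) (by omega) (by omega)
      rw [Nat.cast_add, ← add_assoc] at this
      linarith
    · have : i + ((2 * h + 1 : ℕ) : ZMod (2 * n)) + ((2 * h' + 1 : ℕ) : ZMod (2 * n)) = i := by
        have := cast_period i 0
        rw [Nat.cast_zero, add_zero] at this
        rw [add_assoc, ← Nat.cast_add, show 2 * h + 1 + (2 * h' + 1) = 0 + 2 * n by omega, this]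
      rw [this, norm_sub_rev]; exact hlt

end UnitPolygon



namespace UnitPolygon

variable {n : ℕ} (P : UnitPolygon n)

/-- the alternating sign -/
def sg (k : ZMod (2 * n)) : ℝ := if Even k.val then 1 else -1

/-- alternating heights -/
def hgt (k : ZMod (2 * n)) : ℝ := if Even k.val then 0 else 1

theorem even_mod {a m : ℕ} : Even (a % (2 * m)) ↔ Even a := by
  rw [Nat.even_iff, Nat.even_iff, Nat.mod_mod_of_dvd _ (Dvd.intro m rfl)]

theorem even_shift {n : ℕ} (P : UnitPolygon n) (i : ZMod (2 * n)) (t : ℕ) :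
    Even (i + (t : ZMod (2 * n))).val ↔ Even (i.val + t) := by
  have := P.neZero
  rw [ZMod.val_add, ZMod.val_natCast, even_mod, Nat.even_add, Nat.even_add, even_mod]

theorem even_succ {n : ℕ} (P : UnitPolygon n) (i : ZMod (2 * n)) :
    Even (i + 1).val ↔ ¬ Even i.val := by
  have := P.even_shift i 1
  rw [Nat.cast_one] at this
  rw [this, Nat.even_add_one]

theorem hgt_succ {n : ℕ} (P : UnitPolygon n) (i : ZMod (2 * n)) : hgt (i + 1) = hgt i + sg i := by
  unfold hgt sg
  by_cases h : Even i.val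
  · rw [if_neg (by rw [P.even_succ]; exact not_not.mpr h), if_pos h, if_pos h]; ring
  · rw [if_pos ((P.even_succ i).mpr h), if_neg h, if_neg h]; ring

/-- the kinematic data -/
def XX (i j : ZMod (2 * n)) : ℝ := (‖P.vtx i - P.vtx j‖ ^ 2 - (hgt i - hgt j) ^ 2) / 2

theorem mm_XX (a b : ZMod (2 * n)) :
    Koba.mm P.XX a b = dot2 (P.e a) (P.e b) - sg a * sg b := by
  unfold Koba.mm XX
  simp only [pt_norm_sq, P.hgt_succ]
  have h1 : ∀ k c, P.vtx (k + 1) c = P.vtx k c + P.e k c := by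
    intro k c; unfold e; simp
  simp only [PiLp.sub_apply, h1]
  unfold dot2
  ring

theorem hgt_sq (i j : ZMod (2 * n)) : (hgt i - hgt j) ^ 2 ≤ 1 := by
  unfold hgt; split_ifs <;> norm_num

theorem exists_balanced (hns : ¬ P.IsSpecial) : ∃ x : ZMod (2 * n) → ℝ,
    (∀ a b : ZMod (2 * n), a.val < b.val → x a < x b) ∧ ∀ [NeZero (2 * n)] (k : ZMod (2 * n)),
      ∑ j, (dot2 (P.e k) (P.e j) - sg k * sg j) / (x k - x j) = 0 := by
  have hnz := P.neZero
  have hn := P.n_ge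
  have hX0 : ∀ i j, ¬ Koba.NonAdj i j → P.XX i j = 0 := by
    have hadj : ∀ i, P.XX i (i + 1) = 0 := by
      intro i
      unfold XX
      rw [P.hgt_succ, ← dist_eq_norm, P.unit_edges]
      unfold sg; split_ifs <;> ring
    have hs : ∀ i j, P.XX i j = P.XX j i := by
      intro i j; unfold XX; rw [norm_sub_rev]; ring
    intro i j h
    by_cases h1 : j = i
    · subst h1; unfold XX; simp
    by_cases h2 : j = i + 1
    · rw [h2]; exact hadj i
    by_cases h3 : i = j + 1
    · rw [h3, hs]; exact hadj j
    exact absurd ⟨h1, h2, h3⟩ h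
  have hXp : ∀ i j, Koba.NonAdj i j → 0 < P.XX i j := by
    rintro i j ⟨h1, h2, h3⟩
    set t := (j - i).val with ht
    have htN : t < 2 * n := ZMod.val_lt _
    have hj : j = i + t := by rw [ht, ZMod.natCast_zmod_val]; ring
    have t0 : t ≠ 0 := by rintro h; apply h1; rw [hj, h]; simp
    have t1 : t ≠ 1 := by rintro h; apply h2; rw [hj, h]; simp
    have t2 : t ≠ 2 * n - 1 := by
      intro h; apply h3
      have := cast_period i 0
      rw [zero_add, Nat.cast_zero, add_zero] at this
      have e1 : ((2 * n : ℕ) : ZMod (2 * n)) = ((2 * n - 1 : ℕ) : ZMod (2 * n)) + 1 := by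
        rw [← Nat.cast_add_one]; congr 1; omega
      rw [hj, h, add_assoc, ← e1, this]
    unfold XX
    rcases Nat.even_or_odd' t with ⟨m, hm | hm⟩
    · have : hgt i = hgt j := by
        unfold hgt
        have : Even j.val ↔ Even i.val := by
          rw [hj, P.even_shift, Nat.even_add, hm]; simp
        simp only [this]
      rw [this, norm_sub_rev]
      have h4 : P.vtx j - P.vtx i ≠ 0 := sub_ne_zero.mpr fun h => h1 (P.inj h)
      have h5 := norm_pos_iff.mpr h4
      have h6 : 0 < ‖P.vtx j - P.vtx i‖ ^ 2 := by positivity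
      simpa using h6
    · have := P.chord_gt hns i m (n - 1 - m) (by omega) (by omega) (by omega)
      rw [← hm, ← hj] at this
      rw [norm_sub_rev]
      have := hgt_sq i j
      nlinarith
  obtain ⟨x, hx, hR⟩ := Koba.exists_balanced P.XX (by omega) (by
      intro i j; unfold XX; rw [norm_sub_rev]; ring) hX0 hXp
  refine ⟨x, hx, fun {_} k => ?_⟩
  have := hR k
  unfold Koba.RR at this
  simp only [P.mm_XX] at this
  convert this

/-- balanced configurations give null curves -/
theorem null_curve [NeZero (2 * n)] {x : ZMod (2 * n) → ℝ}
    (hx : ∀ a b : ZMod (2 * n), a.val < b.val → x a < x b)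
    (hR : ∀ k : ZMod (2 * n), ∑ j, (dot2 (P.e k) (P.e j) - sg k * sg j) / (x k - x j) = 0)
    {z : ℂ} (hz : ∀ k, z - x k ≠ 0) :
    (∑ k, (P.e k 0 : ℂ) / (z - x k)) ^ 2 + (∑ k, (P.e k 1 : ℂ) / (z - x k)) ^ 2 =
      (∑ k : ZMod (2 * n), (sg k : ℂ) / (z - x k)) ^ 2 := by
  have key : ∑ k : ZMod (2 * n), ∑ j : ZMod (2 * n), ((dot2 (P.e k) (P.e j) - sg k * sg j : ℝ) : ℂ)
      / ((z - x k) * (z - x j)) = 0 := by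
    have h1 : ∀ k j : ZMod (2 * n), ((dot2 (P.e k) (P.e j) - sg k * sg j : ℝ) : ℂ)
      / ((z - x k) * (z - x j)) =
      (((dot2 (P.e k) (P.e j) - sg k * sg j) / (x k - x j) : ℝ) : ℂ) / (z - x k) +
      (((dot2 (P.e j) (P.e k) - sg j * sg k) / (x j - x k) : ℝ) : ℂ) / (z - x j) := by
      intro k j
      by_cases hkj : k = j
      · subst hkj
        have h2 : dot2 (P.e k) (P.e k) - sg k * sg k = 0 := by
          have := unit_sq (P.norm_e k)
          unfold dot2 sg
          split_ifs <;> linarith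
        rw [h2]; simp
      · have h3 : x k ≠ x j := by
          rcases lt_or_gt_of_ne (fun h => hkj (ZMod.val_injective _ h)) with h | h
          · exact (hx _ _ h).ne
          · exact (hx _ _ h).ne'
        have h4 : (x k : ℂ) - x j ≠ 0 := by
          rw [← Complex.ofReal_sub]; exact_mod_cast sub_ne_zero.mpr h3
        have h5 : (x j : ℂ) - x k ≠ 0 := by rw [← neg_sub]; exact neg_ne_zero.mpr h4
        have h6 : dot2 (P.e j) (P.e k) = dot2 (P.e k) (P.e j) := by unfold dot2; ring
        rw [h6, mul_comm (sg j) (sg k)]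
        push_cast
        have e1 : ((dot2 (P.e k) (P.e j) : ℂ) - sg k * sg j) / ((x j : ℂ) - x k)
          = - (((dot2 (P.e k) (P.e j) : ℂ) - sg k * sg j) / ((x k : ℂ) - x j)) := by
          rw [← neg_sub (x k : ℂ), div_neg]
        rw [e1]
        have := hz k
        have := hz j
        field_simp
        ring
    simp only [h1, Finset.sum_add_distrib]
    rw [Finset.sum_comm (f := fun k j : ZMod (2 * n) =>
      (((dot2 (P.e j) (P.e k) - sg j * sg k) / (x j - x k) : ℝ) : ℂ) / (z - x j))]
    simp only [← Finset.sum_div, ← Complex.ofReal_sum, hR]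
    simp
  have expand : ∀ f : ZMod (2 * n) → ℂ, (∑ k, f k / (z - x k)) ^ 2 =
      ∑ k, ∑ j, (f k * f j) / ((z - x k) * (z - x j)) := by
    intro f
    rw [sq, Finset.sum_mul_sum]
    refine Finset.sum_congr rfl fun k _ => Finset.sum_congr rfl fun j _ => ?_
    rw [div_mul_div_comm]
  rw [expand, expand, expand, ← sub_eq_zero, ← Finset.sum_add_distrib, ← Finset.sum_sub_distrib]
  rw [← key]
  refine Finset.sum_congr rfl fun k _ => ?_
  rw [← Finset.sum_add_distrib, ← Finset.sum_sub_distrib]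
  refine Finset.sum_congr rfl fun j _ => ?_
  rw [← add_div, ← sub_div]
  unfold dot2; push_cast; ring

end UnitPolygon



/-! ### Part B1: the affine map of angles -/

namespace UnitPolygon

variable {n : ℕ} (P : UnitPolygon n)

theorem sum_zmod {M : Type*} [AddCommMonoid M] [NeZero (2 * n)] (f : ZMod (2 * n) → M) :
    ∑ k : ZMod (2 * n), f k = ∑ t ∈ Finset.range (2 * n), f (t : ZMod (2 * n)) := by
  refine Finset.sum_nbij' (fun k => k.val) (fun t => (t : ZMod (2 * n))) ?_ ?_ ?_ ?_ ?_
  · intro k _; exact Finset.mem_range.2 (ZMod.val_lt k)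
  · intro t _; exact Finset.mem_univ _
  · intro k _; exact ZMod.natCast_zmod_val k
  · intro t ht; exact ZMod.val_cast_of_lt (Finset.mem_range.1 ht)
  · intro k _; simp

theorem abel_sum (g s : ℕ → ℝ) (m : ℕ) :
    g 0 - ∑ t ∈ Finset.range (m + 1), s t * (g (t + 1) - g t) =
      g 0 + s 0 * g 0 - s m * g (m + 1)
        + ∑ t ∈ Finset.range m, (s (t + 1) - s t) * g (t + 1) := by
  induction m with
  | zero => simp; ring
  | succ m ih =>
    rw [Finset.sum_range_succ _ (m + 1),
      Finset.sum_range_succ (fun t => (s (t + 1) - s t) * g (t + 1)) m]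
    linear_combination ih

/-- the affine map of angles -/
def Amap [NeZero (2 * n)] (θ : ZMod (2 * n) → ℝ) : Pt :=
  P.vtx 0 - ∑ k, (θ k / Real.pi) • P.e k

theorem Amap_mem [NeZero (2 * n)] (θ : ZMod (2 * n) → ℝ)
    (h0 : ∀ k, 0 < θ k) (h1 : ∀ k, θ k < Real.pi)
    (hm : ∀ a b : ZMod (2 * n), a.val < b.val → θ a < θ b) : P.Amap θ ∈ P.Ω := by
  apply P.mem_of_pos
  intro k
  have hpi := Real.pi_pos
  have hn := P.n_ge
  obtain ⟨N, hN⟩ : ∃ N, 2 * n = N + 1 := ⟨2 * n - 1, by omega⟩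
  set g : ℕ → ℝ := fun t => cross2 (P.e k) (P.vtx (t : ZMod (2 * n)) - P.vtx k) with hg
  set s : ℕ → ℝ := fun t => θ (t : ZMod (2 * n)) / Real.pi with hs
  have key : cross2 (P.e k) (P.Amap θ - P.vtx k) =
      g 0 - ∑ t ∈ Finset.range (N + 1), s t * (g (t + 1) - g t) := by
    unfold Amap
    rw [sum_zmod, show Finset.range (2 * n) = Finset.range (N + 1) from congrArg _ hN]
    have : ∀ v w z : Pt, cross2 (P.e k) (v - w - z) = cross2 (P.e k) (v - z) - cross2 (P.e k) w := by
      intro v w z; simp [cross2]; ring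
    rw [this]
    congr 1
    · simp [hg]
    · rw [cross2_sum]
      apply Finset.sum_congr rfl
      intro t _
      rw [cross2_smul_right]
      simp only [hs, hg]
      rw [← cross2_sub_right]
      congr 2
      unfold e
      push_cast
      abel
  rw [key, abel_sum]
  have hgN : g (N + 1) = g 0 := by
    simp only [hg]
    rw [show ((N + 1 : ℕ) : ZMod (2 * n)) = 0 from by rw [← hN, ZMod.natCast_self]]; simp
  have hgnn : ∀ t, 0 ≤ g t := fun t => P.edge_vtx_nonneg k _
  have hmono : ∀ t ∈ Finset.range N, 0 < s (t + 1) - s t := by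
    intro t ht
    have ht := Finset.mem_range.1 ht
    have := hm (t : ZMod (2 * n)) ((t + 1 : ℕ) : ZMod (2 * n)) (by
      rw [ZMod.val_cast_of_lt (by omega), ZMod.val_cast_of_lt (by omega)]; omega)
    simp only [hs]
    rw [← sub_div]
    apply div_pos _ hpi
    linarith
  have hs0 : 0 < 1 + s 0 - s N := by
    have a1 : 0 < s 0 := div_pos (h0 _) hpi
    have a2 : s N < 1 := (div_lt_one hpi).2 (h1 _)
    linarith
  rw [hgN]
  obtain ⟨j, hj⟩ : ∃ j : ZMod (2 * n), 0 < cross2 (P.e k) (P.vtx j - P.vtx k) := by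
    by_contra! hcon
    have hz : ∀ j, cross2 (P.e k) (P.vtx j - P.vtx k) = 0 := fun j =>
      le_antisymm (hcon j) (P.edge_vtx_nonneg k j)
    obtain ⟨j, hj⟩ := P.exists_dot_ne (a := J (P.e k)) (by
      intro h
      have := norm_J (P.e k)
      rw [h, P.norm_e] at this; simp at this)
    rw [dot2_J] at hj
    apply hj
    have a := hz (j + 1)
    have b := hz j
    have : P.e j = (P.vtx (j + 1) - P.vtx k) - (P.vtx j - P.vtx k) := by unfold e; abel
    rw [this, cross2_sub_right, a, b]; ring
  have hsum : 0 ≤ ∑ t ∈ Finset.range N, (s (t + 1) - s t) * g (t + 1) :=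
    Finset.sum_nonneg (fun t ht => mul_nonneg (hmono t ht).le (hgnn _))
  have hfirst : 0 ≤ (1 + s 0 - s N) * g 0 := mul_nonneg hs0.le (hgnn 0)
  rcases Nat.eq_zero_or_pos j.val with hj0 | hj0
  · have : 0 < g 0 := by
      simp only [hg]
      rw [← hj0, ZMod.natCast_zmod_val]; exact hj
    have := mul_pos hs0 this
    nlinarith
  · have hjl := ZMod.val_lt j
    have : 0 < ∑ t ∈ Finset.range N, (s (t + 1) - s t) * g (t + 1) := by
      apply Finset.sum_pos' (fun t ht => mul_nonneg (hmono t ht).le (hgnn _))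
      have hr : j.val - 1 ∈ Finset.range N := Finset.mem_range.2 (by omega)
      refine ⟨j.val - 1, hr, mul_pos (hmono _ hr) ?_⟩
      rw [Nat.sub_add_cancel hj0]
      simp only [hg]
      rw [ZMod.natCast_zmod_val]; exact hj
    nlinarith

theorem Amap_step [NeZero (2 * n)] (θ : ZMod (2 * n) → ℝ) (k : ZMod (2 * n))
    (h0 : ∀ j : ZMod (2 * n), j.val < k.val → θ j = 0)
    (h1 : ∀ j : ZMod (2 * n), k.val < j.val → θ j = Real.pi) :
    P.Amap θ = P.vtx (k + 1) - (θ k / Real.pi) • P.e k := by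
  have hpi := Real.pi_pos.ne'
  have hk := ZMod.val_lt k
  unfold Amap
  rw [sum_zmod, ← Finset.sum_range_add_sum_Ico _ hk.le,
    Finset.sum_eq_sum_Ico_succ_bot hk]
  have a1 : ∑ t ∈ Finset.range k.val, (θ (t : ZMod (2 * n)) / Real.pi) • P.e (t : ZMod (2 * n)) = 0 := by
    apply Finset.sum_eq_zero
    intro t ht
    have ht := Finset.mem_range.1 ht
    rw [h0 _ (by rw [ZMod.val_cast_of_lt (by omega)]; exact ht)]; simp
  have a2 : ∑ t ∈ Finset.Ico (k.val + 1) (2 * n), (θ (t : ZMod (2 * n)) / Real.pi) • P.e (t : ZMod (2 * n))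
      = P.vtx 0 - P.vtx (k + 1) := by
    have := P.vtx_shift 0 (k.val + 1) (2 * n) hk
    simp only [zero_add] at this
    rw [ZMod.natCast_self] at this
    push_cast [ZMod.natCast_zmod_val] at this
    rw [this]
    apply Finset.sum_congr rfl
    intro t ht
    have ht := Finset.mem_Ico.1 ht
    rw [h1 _ (by rw [ZMod.val_cast_of_lt (by omega)]; omega), div_self hpi, one_smul]
  rw [a1, a2, ZMod.natCast_zmod_val]
  abel

theorem step_mem (k : ZMod (2 * n)) {τ : ℝ} (h0 : 0 ≤ τ) (h1 : τ ≤ Real.pi) :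
    P.vtx (k + 1) - (τ / Real.pi) • P.e k ∈ segment ℝ (P.vtx k) (P.vtx (k + 1)) := by
  have hpi := Real.pi_pos
  rw [segment_symm, segment_eq_image']
  refine ⟨τ / Real.pi, ⟨by positivity, (div_le_one hpi).2 h1⟩, ?_⟩
  unfold e
  simp only [smul_sub]; abel

theorem Amap_const [NeZero (2 * n)] (c : ℝ) : P.Amap (fun _ => c) = P.vtx 0 := by
  unfold Amap
  rw [← Finset.smul_sum, P.sum_e]; simp

theorem continuous_Amap [NeZero (2 * n)] : Continuous P.Amap := by
  unfold Amap
  fun_prop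

end UnitPolygon



/-! ### Part B2: angles and boundary limits -/

theorem arg_pos' {w : ℂ} (h : 0 < w.im) : 0 < w.arg := by
  have h1 := Complex.arg_nonneg_iff.2 h.le
  rcases h1.lt_or_eq with h2 | h2
  · exact h2
  · have := Complex.arg_eq_zero_iff.1 h2.symm
    exact absurd this.2 h.ne'

theorem arg_lt' {w : ℂ} (h : 0 < w.im) : w.arg < Real.pi :=
  Complex.arg_lt_pi_iff.2 (Or.inr h.ne')

theorem arg_lt_arg {z : ℂ} (h : 0 < z.im) {a b : ℝ} (hab : a < b) :
    (z - a).arg < (z - b).arg := by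
  have ia : 0 < (z - a).im := by simpa using h
  have ib : 0 < (z - b).im := by simpa using h
  have na : (z - a) ≠ 0 := fun h0 => by rw [h0] at ia; simp at ia
  have nb : (z - b) ≠ 0 := fun h0 => by rw [h0] at ib; simp at ib
  have hs : 0 < Real.sin ((z - b).arg - (z - a).arg) := by
    rw [Real.sin_sub, Complex.sin_arg, Complex.cos_arg na, Complex.cos_arg nb, Complex.sin_arg]
    have pa : 0 < ‖z - a‖ := norm_pos_iff.2 na
    have pb : 0 < ‖z - b‖ := norm_pos_iff.2 nb
    have : (z - b).im / ‖z - b‖ * ((z - a).re / ‖z - a‖) - (z - b).re / ‖z - b‖ * ((z - a).im / ‖z - a‖)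
        = z.im * (b - a) / (‖z - a‖ * ‖z - b‖) := by
      simp; field_simp; ring
    rw [this]
    have : 0 < b - a := by linarith
    positivity
  by_contra hcon
  push Not at hcon
  have := Real.sin_nonpos_of_nonpos_of_neg_pi_le (x := (z - b).arg - (z - a).arg) (by linarith)
    (by linarith [arg_pos' ib, arg_lt' ia])
  linarith

namespace UnitPolygon

variable {n : ℕ} (P : UnitPolygon n)

/-- the vector of angles -/
def ang (x : ZMod (2 * n) → ℝ) (z : ℂ) (k : ZMod (2 * n)) : ℝ := (z - x k).arg

/-- the harmonic map to the polygon -/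
def fmap [NeZero (2 * n)] (x : ZMod (2 * n) → ℝ) (z : ℂ) : Pt := P.Amap (ang x z)

theorem ang_mem (x : ZMod (2 * n) → ℝ) {z : ℂ} (hz : 0 < z.im) (k) :
    ang x z k ∈ Icc 0 Real.pi := by
  have ia : 0 < (z - x k).im := by simpa using hz
  exact ⟨(arg_pos' ia).le, (arg_lt' ia).le⟩

theorem fmap_mem [NeZero (2 * n)] {x : ZMod (2 * n) → ℝ}
    (hx : ∀ a b : ZMod (2 * n), a.val < b.val → x a < x b) {z : ℂ} (hz : 0 < z.im) :
    P.fmap x z ∈ P.Ω := by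
  have ia : ∀ k, 0 < (z - x k).im := fun k => by simpa using hz
  exact P.Amap_mem _ (fun k => arg_pos' (ia k)) (fun k => arg_lt' (ia k))
    (fun a b hab => arg_lt_arg hz (hx a b hab))

theorem fmap_limit [NeZero (2 * n)] {x : ZMod (2 * n) → ℝ}
    (hx : ∀ a b : ZMod (2 * n), a.val < b.val → x a < x b)
    (U : Ultrafilter ℂ) (hU : ∀ᶠ z in (U : Filter ℂ), 0 < z.im) :
    (∃ z : ℂ, 0 < z.im ∧ (U : Filter ℂ) ≤ 𝓝 z) ∨
    ∃ k, ∃ y ∈ segment ℝ (P.vtx k) (P.vtx (k + 1)), Tendsto (P.fmap x) U (𝓝 y) ∧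
      ((U : Filter ℂ) ≤ 𝓝 (x k : ℂ) ∨ y = P.vtx k ∨ y = P.vtx (k + 1)) := by
  classical
  have hn := P.n_ge
  -- limits of angles
  have hlim : ∀ k, ∃ τ ∈ Icc (0 : ℝ) Real.pi, Tendsto (fun z => ang x z k) U (𝓝 τ) := by
    intro k
    have hmem : Icc (0 : ℝ) Real.pi ∈ (U.map (fun z => ang x z k) : Filter ℝ) := by
      rw [Ultrafilter.coe_map, Filter.mem_map]
      filter_upwards [hU] with z hz using ang_mem x hz k
    obtain ⟨τ, hτ, h⟩ := isCompact_Icc.ultrafilter_le_nhds' _ hmem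
    exact ⟨τ, hτ, h⟩
  choose τ hτ hτl using hlim
  have hfl : Tendsto (P.fmap x) U (𝓝 (P.Amap τ)) := by
    have h1 : Tendsto (fun z => ang x z) U (𝓝 τ) := tendsto_pi_nhds.2 hτl
    exact (P.continuous_Amap.tendsto τ).comp h1
  by_cases hb : ∃ R : ℝ, ∀ᶠ z in (U : Filter ℂ), ‖z‖ ≤ R
  · obtain ⟨R, hR⟩ := hb
    obtain ⟨ζ, hζ, hle⟩ := (isCompact_closedBall (0 : ℂ) R).ultrafilter_le_nhds' U (by
      filter_upwards [hR] with z hz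
      simpa using hz)
    have him : 0 ≤ ζ.im := by
      have ht : Tendsto Complex.im U (𝓝 ζ.im) := (Complex.continuous_im.tendsto ζ).mono_left hle
      exact ge_of_tendsto ht (hU.mono fun z hz => hz.le)
    rcases him.lt_or_eq with him | him
    · exact Or.inl ⟨ζ, him, hle⟩
    right
    -- angles
    have ζr : ζ = (ζ.re : ℂ) := Complex.ext (by simp) (by simp [him.symm])
    have h0 : ∀ j, x j < ζ.re → τ j = 0 := by
      intro j hj
      have hc : ContinuousAt (fun z : ℂ => (z - x j).arg) ζ := by
        have : ζ - x j ∈ Complex.slitPlane := by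
          left; simpa using hj
        exact (Complex.continuousAt_arg this).comp (f := fun z : ℂ => z - x j)
          (continuous_sub_right _).continuousAt
      have h1 : Tendsto (fun z => ang x z j) U (𝓝 ((ζ - x j).arg)) := hc.tendsto.mono_left hle
      have h2 : (ζ - x j).arg = 0 := by
        rw [Complex.arg_eq_zero_iff]
        constructor
        · simpa using hj.le
        · simp [him.symm]
      rw [h2] at h1
      exact tendsto_nhds_unique (hτl j) h1
    have h1 : ∀ j, ζ.re < x j → τ j = Real.pi := by
      intro j hj
      have hc := Complex.continuousWithinAt_arg_of_re_neg_of_im_zero (z := ζ - x j)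
        (by simpa using hj) (by simp [him.symm])
      have ht : Tendsto (fun z : ℂ => z - x j) U (𝓝[{z : ℂ | 0 ≤ z.im}] (ζ - x j)) := by
        apply tendsto_nhdsWithin_of_tendsto_nhds_of_eventually_within
        · exact ((continuous_sub_right (x j : ℂ)).tendsto ζ).mono_left hle
        · filter_upwards [hU] with z hz
          simpa using hz.le
      have h1 : Tendsto (fun z => ang x z j) U (𝓝 ((ζ - x j).arg)) := hc.tendsto.comp ht
      have h2 : (ζ - x j).arg = Real.pi := by
        rw [Complex.arg_eq_pi_iff]
        constructor
        · simpa using hj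
        · simp [him.symm]
      rw [h2] at h1
      exact tendsto_nhds_unique (hτl j) h1
    have hxinj : ∀ j k, x j = x k → j = k := by
      intro j k hjk
      apply ZMod.val_injective
      rcases lt_trichotomy j.val k.val with h | h | h
      · exact absurd hjk (hx _ _ h).ne
      · exact h
      · exact absurd hjk (hx _ _ h).ne'
    have hxmono : ∀ j k, x j < x k → j.val < k.val := by
      intro j k hjk
      by_contra hcon
      rcases (not_lt.1 hcon).lt_or_eq with h | h
      · exact absurd (hx _ _ h) (not_lt.2 hjk.le)
      · rw [ZMod.val_injective _ h] at hjk; exact lt_irrefl _ hjk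
    obtain ⟨k, hk⟩ : ∃ k : ZMod (2 * n), (∀ j, j.val < k.val → τ j = 0) ∧
        (∀ j, k.val < j.val → τ j = Real.pi) ∧ (ζ.re = x k ∨ τ k = 0 ∨ τ k = Real.pi) := by
      by_cases hex : ∃ k, ζ.re ≤ x k
      · obtain ⟨k, hk, hmin⟩ := (Set.toFinite {k | ζ.re ≤ x k}).exists_minimalFor x _ hex
        refine ⟨k, ?_, ?_, ?_⟩
        · intro j hj
          apply h0
          by_contra hcon
          have a := hx _ _ hj
          have b := hmin (not_lt.1 hcon) a.le
          linarith
        · intro j hj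
          exact h1 _ (lt_of_le_of_lt hk (hx _ _ hj))
        · rcases (show ζ.re ≤ x k from hk).lt_or_eq with h | h
          · exact Or.inr (Or.inr (h1 _ h))
          · exact Or.inl h
      · push Not at hex
        refine ⟨((2 * n - 1 : ℕ) : ZMod (2 * n)), ?_, ?_, ?_⟩
        · intro j _; exact h0 j (hex j)
        · intro j hj
          rw [ZMod.val_cast_of_lt (by omega)] at hj
          have := ZMod.val_lt j
          omega
        · exact Or.inr (Or.inl (h0 _ (hex _)))
    obtain ⟨hk0, hk1, hk2⟩ := hk
    refine ⟨k, P.Amap τ, ?_, hfl, ?_⟩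
    · rw [P.Amap_step τ k hk0 hk1]
      exact P.step_mem k (hτ k).1 (hτ k).2
    · rw [P.Amap_step τ k hk0 hk1]
      rcases hk2 with h | h | h
      · left; rw [← h, ← ζr]; exact hle
      · right; right; rw [h]; simp
      · right; left; rw [h, div_self Real.pi_pos.ne']; unfold e; simp
  · right
    push Not at hb
    have hinf : Tendsto (fun z : ℂ => ‖z‖) U atTop := by
      rw [Filter.tendsto_atTop]
      intro b
      have := hb b
      filter_upwards [this] with z hz using hz.le
    -- all angle limits agree
    have hcmp : ∀ j, τ j = τ 0 := by
      intro j
      have hinv : Tendsto (fun z : ℂ => (z - x j) / (z - x 0)) U (𝓝 1) := by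
        have h0 : Tendsto (fun z : ℂ => ‖z - x 0‖) U atTop := by
          apply tendsto_atTop_mono (f := fun z => ‖z‖ - ‖(x 0 : ℂ)‖)
          · intro z; exact norm_sub_norm_le _ _
          · exact tendsto_atTop_add_const_right _ _ hinf
        have h1 : Tendsto (fun z : ℂ => (z - x 0)⁻¹) U (𝓝 0) := by
          rw [tendsto_zero_iff_norm_tendsto_zero]
          simp only [norm_inv]
          exact tendsto_inv_atTop_zero.comp h0
        have h2 : Tendsto (fun z : ℂ => 1 + ((x 0 : ℂ) - x j) * (z - x 0)⁻¹) U (𝓝 1) := by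
          have := (h1.const_mul ((x 0 : ℂ) - x j)).const_add 1
          simpa using this
        apply h2.congr'
        filter_upwards [hU] with z hz
        have : z - x 0 ≠ 0 := fun h => by
          have h' := congrArg Complex.im h
          simp at h'; exact hz.ne' h'
        field_simp; ring
      have hre : Tendsto (fun z : ℂ => ((z - x j) / (z - x 0)) / (‖z - x j‖ / ‖z - x 0‖ : ℝ)) U (𝓝 1) := by
        have hnorm : Tendsto (fun z : ℂ => ((‖z - x j‖ / ‖z - x 0‖ : ℝ) : ℂ)) U (𝓝 1) := by
          have := hinv.norm
          simp only [norm_div, norm_one] at this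
          have h2 := (Complex.continuous_ofReal.tendsto 1).comp this
          simpa [Function.comp_def] using h2
        have := hinv.div hnorm one_ne_zero
        rw [div_one] at this
        exact this
      have hexp : Tendsto (fun z : ℂ => Complex.exp ((ang x z j - ang x z 0 : ℝ) * Complex.I)) U (𝓝 1) := by
        apply hre.congr'
        filter_upwards [hU] with z hz
        have hne : ∀ j, z - x j ≠ 0 := fun j h => by
          have h' := congrArg Complex.im h
          simp at h'; exact hz.ne' h'
        have e1 : ∀ j, z - x j = ‖z - x j‖ * Complex.exp (ang x z j * Complex.I) := fun j =>
          (Complex.norm_mul_exp_arg_mul_I _).symm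
        have np : ∀ j, (‖z - x j‖ : ℂ) ≠ 0 := fun j => by
          exact_mod_cast norm_ne_zero_iff.2 (hne j)
        have e2 : Complex.exp ((ang x z j - ang x z 0 : ℝ) * Complex.I)
            = Complex.exp (ang x z j * Complex.I) / Complex.exp (ang x z 0 * Complex.I) := by
          rw [← Complex.exp_sub]; congr 1; push_cast; ring
        have e3 : ∀ j, Complex.exp (ang x z j * Complex.I) = (z - x j) / ‖z - x j‖ := fun j => by
          rw [eq_div_iff (np j), mul_comm, ← e1]
        rw [e2, e3, e3]
        push_cast
        have := np j; have := np 0; have := hne 0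
        field_simp
      have hexp2 : Tendsto (fun z : ℂ => Complex.exp ((ang x z j - ang x z 0 : ℝ) * Complex.I)) U
          (𝓝 (Complex.exp ((τ j - τ 0 : ℝ) * Complex.I))) := by
        have hc : Continuous (fun t : ℝ => Complex.exp ((t : ℂ) * Complex.I)) := by fun_prop
        exact (hc.tendsto _).comp ((hτl j).sub (hτl 0))
      have heq := tendsto_nhds_unique hexp2 hexp
      rw [Complex.exp_eq_one_iff] at heq
      obtain ⟨m, hm⟩ := heq
      have hm' : τ j - τ 0 = m * (2 * Real.pi) := by
        have : ((τ j - τ 0 : ℝ) : ℂ) * Complex.I = ((m * (2 * Real.pi) : ℝ) : ℂ) * Complex.I := by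
          rw [hm]; push_cast; ring
        exact_mod_cast mul_right_cancel₀ Complex.I_ne_zero this
      have hpi := Real.pi_pos
      have hm1 : (m : ℝ) < 1 := by
        have := (hτ j).2; have := (hτ 0).1
        by_contra h; push Not at h; nlinarith
      have hm2 : (-1 : ℝ) < m := by
        have := (hτ j).1; have := (hτ 0).2
        by_contra h; push Not at h; nlinarith
      have hm3 : m = 0 := by
        have a : m < 1 := by exact_mod_cast hm1
        have b : -1 < m := by exact_mod_cast hm2
        omega
      rw [hm3] at hm'
      simp at hm'; linarith
    have hA : P.Amap τ = P.vtx 0 := by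
      rw [show τ = fun _ => τ 0 from funext hcmp]; exact P.Amap_const _
    refine ⟨0, P.vtx 0, left_mem_segment _ _ _, hA ▸ hfl, Or.inr (Or.inl rfl)⟩

end UnitPolygon



/-! ### Part B3: logarithmic sums, nonvanishing -/

namespace UnitPolygon

variable {n : ℕ} (P : UnitPolygon n)

/-- logarithmic sum -/
def LL [NeZero (2 * n)] (x c : ZMod (2 * n) → ℝ) (z : ℂ) : ℂ := ∑ k, (c k : ℂ) * Complex.log (z - x k)
/-- its derivative -/
def FF [NeZero (2 * n)] (x c : ZMod (2 * n) → ℝ) (z : ℂ) : ℂ := ∑ k, (c k : ℂ) / (z - x k)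

theorem sub_ne {z : ℂ} (hz : 0 < z.im) (a : ℝ) : z - a ≠ 0 := fun h => by
  have h' := congrArg Complex.im h
  simp at h'; exact hz.ne' h'

theorem hasDerivAt_LL [NeZero (2 * n)] (x c : ZMod (2 * n) → ℝ) {z : ℂ} (hz : 0 < z.im) :
    HasDerivAt (LL x c) (FF x c z) z := by
  unfold LL FF
  apply HasDerivAt.fun_sum
  intro k _
  have h1 : HasDerivAt (fun z : ℂ => Complex.log (z - x k)) (1 / (z - x k)) z := by
    apply HasDerivAt.clog
    · exact (hasDerivAt_id z).sub_const _
    · right; simpa using hz.ne'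
  have := h1.const_mul (c k : ℂ)
  rw [mul_one_div] at this
  exact this

theorem fmap_coord [NeZero (2 * n)] (x : ZMod (2 * n) → ℝ) (z : ℂ) (i : Fin 2) :
    P.fmap x z i = P.vtx 0 i - (LL x (fun k => P.e k i) z).im / Real.pi := by
  unfold fmap Amap LL ang
  simp only [PiLp.sub_apply, Complex.im_sum, Complex.im_ofReal_mul, Complex.log_im]
  congr 1
  rw [Finset.sum_div]
  simp only [WithLp.ofLp_sum, Finset.sum_apply, PiLp.smul_apply, smul_eq_mul]
  apply Finset.sum_congr rfl
  intro k _
  ring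

theorem exists_sep [NeZero (2 * n)] {x : ZMod (2 * n) → ℝ}
    (hx : ∀ a b : ZMod (2 * n), a.val < b.val → x a < x b) (m : ℕ) :
    ∃ A : ℝ, (∀ k, k.val < m → x k < A) ∧ (∀ k, m ≤ k.val → A < x k) := by
  classical
  obtain ⟨A, h1, h2⟩ := Order.exists_between_finsets
    (lo := (Finset.univ.filter (fun k : ZMod (2 * n) => k.val < m)).image x)
    (hi := (Finset.univ.filter (fun k : ZMod (2 * n) => m ≤ k.val)).image x) (by
      intro a ha b hb
      simp only [Finset.mem_image, Finset.mem_filter, Finset.mem_univ, true_and] at ha hb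
      obtain ⟨k, hk, rfl⟩ := ha
      obtain ⟨l, hl, rfl⟩ := hb
      exact hx _ _ (by omega))
  refine ⟨A, fun k hk => h1 _ ?_, fun k hk => h2 _ ?_⟩
  · simp only [Finset.mem_image, Finset.mem_filter, Finset.mem_univ, true_and]
    exact ⟨k, hk, rfl⟩
  · simp only [Finset.mem_image, Finset.mem_filter, Finset.mem_univ, true_and]
    exact ⟨k, hk, rfl⟩

theorem FF_ne_aux [NeZero (2 * n)] {x : ZMod (2 * n) → ℝ}
    (hx : ∀ a b : ZMod (2 * n), a.val < b.val → x a < x b) (c : ZMod (2 * n) → ℝ)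
    (hc : ∑ k, c k = 0) (hne : ∃ k, c k ≠ 0) {m1 m2 : ℕ} (hm : m1 ≤ m2)
    (h1 : ∀ k, m1 ≤ k.val → k.val < m2 → c k ≤ 0)
    (h2 : ∀ k, ¬ (m1 ≤ k.val ∧ k.val < m2) → 0 ≤ c k) {z : ℂ} (hz : 0 < z.im) :
    FF x c z ≠ 0 := by
  intro hF
  obtain ⟨A, hA1, hA2⟩ := exists_sep hx m1
  obtain ⟨B, hB1, hB2⟩ := exists_sep hx m2
  have hq : ∀ k, x k - A ≠ 0 ∧ x k - B ≠ 0 := by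
    intro k
    constructor
    · rcases lt_or_ge k.val m1 with h | h
      · exact (sub_neg.2 (hA1 k h)).ne
      · exact (sub_pos.2 (hA2 k h)).ne'
    · rcases lt_or_ge k.val m2 with h | h
      · exact (sub_neg.2 (hB1 k h)).ne
      · exact (sub_pos.2 (hB2 k h)).ne'
  have hd : ∀ k, 0 ≤ c k * ((x k - A) * (x k - B)) := by
    intro k
    rcases lt_or_ge k.val m1 with h | h
    · have a := sub_neg.2 (hA1 k h)
      have b := sub_neg.2 (hB1 k (by omega))
      have := h2 k (by omega)
      exact mul_nonneg this (mul_pos_of_neg_of_neg a b).le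
    · have a := sub_pos.2 (hA2 k h)
      rcases lt_or_ge k.val m2 with h' | h'
      · have b := sub_neg.2 (hB1 k h')
        exact mul_nonneg_of_nonpos_of_nonpos (h1 k h h') (mul_neg_of_pos_of_neg a b).le
      · have b := sub_pos.2 (hB2 k h')
        exact mul_nonneg (h2 k (by omega)) (mul_pos a b).le
  have hid : ∑ k, ((c k * ((x k - A) * (x k - B)) : ℝ) : ℂ) / (z - x k)
      = ((-∑ k, c k * x k : ℝ) : ℂ) := by
    have e1 : ∀ k, ((c k * ((x k - A) * (x k - B)) : ℝ) : ℂ) / (z - x k)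
        = (z - A) * (z - B) * ((c k : ℂ) / (z - x k)) - (c k : ℂ) * (z - A - B) - (c k : ℂ) * x k := by
      intro k
      have := sub_ne hz (x k)
      push_cast
      field_simp
      ring
    rw [Finset.sum_congr rfl (fun k _ => e1 k), Finset.sum_sub_distrib, Finset.sum_sub_distrib,
      ← Finset.mul_sum, ← Finset.sum_mul]
    have e2 : ∑ k, (c k : ℂ) / (z - x k) = 0 := hF
    have e3 : ∑ k, (c k : ℂ) = 0 := by exact_mod_cast hc
    rw [e2, e3]
    push_cast
    ring
  have him := congrArg Complex.im hid
  rw [Complex.ofReal_im, Complex.im_sum] at him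
  have hterm : ∀ k, (((c k * ((x k - A) * (x k - B)) : ℝ) : ℂ) / (z - x k)).im
      = - (c k * ((x k - A) * (x k - B)) * (z.im / Complex.normSq (z - x k))) := by
    intro k
    rw [Complex.div_im]
    simp
    ring
  rw [Finset.sum_congr rfl (fun k _ => hterm k), Finset.sum_neg_distrib, neg_eq_zero] at him
  have hp : ∀ k, 0 < z.im / Complex.normSq (z - x k) := fun k =>
    div_pos hz (Complex.normSq_pos.2 (sub_ne hz _))
  rw [Finset.sum_eq_zero_iff_of_nonneg (fun k _ => mul_nonneg (hd k) (hp k).le)] at him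
  obtain ⟨k, hk⟩ := hne
  have := him k (Finset.mem_univ k)
  have h3 := (hp k).ne'
  have h4 := (hq k).1
  have h5 := (hq k).2
  rcases mul_eq_zero.1 this with h | h
  · rcases mul_eq_zero.1 h with h | h
    · exact hk h
    · rcases mul_eq_zero.1 h with h | h
      · exact h4 h
      · exact h5 h
  · exact h3 h

theorem FF_ne [NeZero (2 * n)] {x : ZMod (2 * n) → ℝ}
    (hx : ∀ a b : ZMod (2 * n), a.val < b.val → x a < x b) {a : Pt} (ha : a ≠ 0)
    {z : ℂ} (hz : 0 < z.im) : FF x (fun k => dot2 a (P.e k)) z ≠ 0 := by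
  obtain ⟨M, r, hr0, hr, h1, h2⟩ := P.unimodal ha
  have hsum : ∀ a : Pt, ∑ k, dot2 a (P.e k) = 0 := by
    intro a
    have := P.sum_e
    have h : ∀ s : Finset (ZMod (2 * n)), ∑ k ∈ s, dot2 a (P.e k) = dot2 a (∑ k ∈ s, P.e k) := by
      classical
      intro s
      induction s using Finset.induction_on with
      | empty => simp [dot2]
      | insert i s hi ih => rw [Finset.sum_insert hi, Finset.sum_insert hi, ih, dot2_add_right]
    rw [h, this]; simp [dot2]
  have hne := P.exists_dot_ne ha
  have hML := ZMod.val_lt M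
  have hrep : ∀ (k : ZMod (2 * n)) (t : ℕ), (k.val = M.val + t ∨ k.val + 2 * n = M.val + t) → k = M + t := by
    intro k t h
    rw [← ZMod.natCast_zmod_val k, ← ZMod.natCast_zmod_val M]
    rcases h with h | h
    · rw [h]; push_cast; ring
    · have : ((k.val + 2 * n : ℕ) : ZMod (2 * n)) = ((M.val + t : ℕ) : ZMod (2 * n)) := by rw [h]
      rw [Nat.cast_add, ZMod.natCast_self, add_zero] at this
      rw [this]; push_cast; ring
  rcases le_or_gt (M.val + r) (2 * n) with hc | hc
  · apply FF_ne_aux hx _ (hsum a) hne (m1 := M.val) (m2 := M.val + r) (by omega) _ _ hz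
    · intro k hk1 hk2
      have := hrep k (k.val - M.val) (by omega)
      rw [this]; exact h1 _ (by omega)
    · intro k hk
      have hkl := ZMod.val_lt k
      rcases lt_or_ge k.val M.val with h | h
      · have := hrep k (k.val + 2 * n - M.val) (by omega)
        rw [this]; exact h2 _ (by omega) (by omega)
      · have := hrep k (k.val - M.val) (by omega)
        rw [this]; exact h2 _ (by omega) (by omega)
  · have key : FF x (fun k => dot2 (-a) (P.e k)) z ≠ 0 := by
      have hneg : ∀ v, dot2 (-a) v = - dot2 a v := by intro v; simp [dot2]; ring
      apply FF_ne_aux hx _ (hsum (-a)) _ (m1 := M.val + r - 2 * n) (m2 := M.val) (by omega) _ _ hz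
      · obtain ⟨k, hk⟩ := hne
        exact ⟨k, by rw [hneg]; exact neg_ne_zero.2 hk⟩
      · intro k hk1 hk2
        have := hrep k (k.val + 2 * n - M.val) (by omega)
        rw [hneg, this, neg_nonpos]; exact h2 _ (by omega) (by omega)
      · intro k hk
        have hkl := ZMod.val_lt k
        rw [hneg, neg_nonneg]
        rcases lt_or_ge k.val M.val with h | h
        · have := hrep k (k.val + 2 * n - M.val) (by omega)
          rw [this]; exact h1 _ (by omega)
        · have := hrep k (k.val - M.val) (by omega)
          rw [this]; exact h1 _ (by omega)
    intro h0
    apply key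
    have : FF x (fun k => dot2 (-a) (P.e k)) z = - FF x (fun k => dot2 a (P.e k)) z := by
      unfold FF
      rw [← Finset.sum_neg_distrib]
      apply Finset.sum_congr rfl
      intro k _
      simp [dot2]; ring
    rw [this, h0, neg_zero]

/-- the two derivative functions are never real-proportional -/
theorem FF_indep [NeZero (2 * n)] {x : ZMod (2 * n) → ℝ}
    (hx : ∀ a b : ZMod (2 * n), a.val < b.val → x a < x b)
    {z : ℂ} (hz : 0 < z.im) :
    (FF x (fun k => P.e k 0) z).re * (FF x (fun k => P.e k 1) z).im
      - (FF x (fun k => P.e k 0) z).im * (FF x (fun k => P.e k 1) z).re ≠ 0 := by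
  set α := FF x (fun k => P.e k 0) z with hα
  set β := FF x (fun k => P.e k 1) z with hβ
  have key : ∀ a b : ℝ, (a : ℂ) * α + b * β = 0 → a = 0 ∧ b = 0 := by
    intro a b h
    by_contra hcon
    apply P.FF_ne hx (a := vec2 a b) _ hz
    · rw [← h, hα, hβ]
      unfold FF
      rw [Finset.mul_sum, Finset.mul_sum, ← Finset.sum_add_distrib]
      apply Finset.sum_congr rfl
      intro k _
      simp only [dot2, vec2_zero, vec2_one]
      push_cast
      ring
    · intro h0
      apply hcon
      constructor
      · have := congrArg (fun v : Pt => v 0) h0; simpa [vec2_zero] using this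
      · have := congrArg (fun v : Pt => v 1) h0; simpa [vec2_one] using this
  intro h
  have h1 := key β.im (-α.im) (by
    apply Complex.ext
    · simp; linarith
    · simp; ring)
  have hα0 : α.im = 0 := by linarith [h1.2]
  have hβ0 : β.im = 0 := h1.1
  have h2 := key β.re (-α.re) (by
    apply Complex.ext
    · simp [hα0, hβ0]; ring
    · simp [hα0, hβ0])
  have h3 := key 1 0 (by
    apply Complex.ext
    · simp; linarith [h2.2]
    · simp [hα0])
  exact one_ne_zero h3.1

end UnitPolygon



/-! ### Part B4: the harmonic map is a diffeomorphism -/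

theorem bijective_of_proper_localHomeo {E X : Type} [TopologicalSpace E] [TopologicalSpace X]
    [T2Space E] [PreconnectedSpace E] [SimplyConnectedSpace X] [LocallyPathConnectedSpace X]
    {F : E → X} (hp : IsProperMap F) (hl : IsLocalHomeomorph F) (e₀ : E) :
    Function.Bijective F := by
  have hfin : ∀ y, (F ⁻¹' {y}).Finite := by
    intro y
    apply IsCompact.finite (hp.isCompact_preimage isCompact_singleton)
    have hd : DiscreteTopology (F '' (F ⁻¹' {y})) := by
      have : Subsingleton (F '' (F ⁻¹' {y})) :=
        Set.subsingleton_coe _ |>.2 (Set.subsingleton_singleton.anti (Set.image_preimage_subset _ _))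
      exact Subsingleton.discreteTopology
    have := IsLocalHomeomorphOn.discreteTopology_of_image
      (f := F) (s := F ⁻¹' {y}) (hl.isLocalHomeomorphOn.mono (Set.subset_univ _)) 
    exact ⟨this⟩
  have hc : IsCoveringMap F := by
    rw [isCoveringMap_iff_isCoveringMapOn_univ]
    exact IsClosedMap.isCoveringMapOn_of_isLocalHomeomorphOn hp.isClosedMap
      (fun y _ => hfin y) (hl.isLocalHomeomorphOn)
  obtain ⟨s, ⟨hs0, hs⟩, _⟩ := hc.existsUnique_continuousMap_lifts (ContinuousMap.id X) (F e₀) e₀ rfl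
  have hsF : s ∘ F = id := by
    apply hc.eq_of_comp_eq (s.continuous.comp hp.continuous) continuous_id _ e₀
    · simp [hs0]
    · rw [← Function.comp_assoc, hs]; rfl
  exact Function.bijective_iff_has_inverse.2 ⟨s, fun a => congrFun hsF a, fun b => congrFun hs b⟩

namespace UnitPolygon

variable {n : ℕ} (P : UnitPolygon n)

theorem contDiffAt_LL [NeZero (2 * n)] (x c : ZMod (2 * n) → ℝ) {z : ℂ} (hz : 0 < z.im)
    {m : WithTop ℕ∞} : ContDiffAt ℝ m (LL x c) z := by
  unfold LL
  apply ContDiffAt.sum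
  intro k _
  apply ContDiffAt.mul contDiffAt_const
  apply ContDiffAt.restrict_scalars ℝ (𝕜' := ℂ)
  apply (Complex.contDiffAt_log _).comp
  · exact contDiffAt_id.sub contDiffAt_const
  · right; simpa using hz.ne'

theorem contDiffAt_fmap [NeZero (2 * n)] (x : ZMod (2 * n) → ℝ) {z : ℂ} (hz : 0 < z.im)
    {m : WithTop ℕ∞} : ContDiffAt ℝ m (P.fmap x) z := by
  rw [contDiffAt_euclidean]
  intro i
  simp only [P.fmap_coord x]
  apply contDiffAt_const.sub
  apply ContDiffAt.div_const
  exact Complex.imCLM.contDiff.contDiffAt.comp z (contDiffAt_LL x _ hz)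

/-- The derivative of `Im (LL x c)`. -/
theorem hasFDerivAt_im_LL [NeZero (2 * n)] (x c : ZMod (2 * n) → ℝ) {z : ℂ} (hz : 0 < z.im) (h : ℂ) :
    fderiv ℝ (fun z => (LL x c z).im) z h = (FF x c z * h).im := by
  have h1 := (hasDerivAt_LL x c hz).hasFDerivAt.restrictScalars ℝ
  have h2 := Complex.imCLM.hasFDerivAt.comp z h1
  have : HasFDerivAt (fun z => (LL x c z).im) _ z := h2
  rw [this.fderiv]
  simp [mul_comm]

theorem hasFDerivAt_re_LL [NeZero (2 * n)] (x c : ZMod (2 * n) → ℝ) {z : ℂ} (hz : 0 < z.im) (h : ℂ) :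
    fderiv ℝ (fun z => (LL x c z).re) z h = (FF x c z * h).re := by
  have h1 := (hasDerivAt_LL x c hz).hasFDerivAt.restrictScalars ℝ
  have h2 := Complex.reCLM.hasFDerivAt.comp z h1
  have : HasFDerivAt (fun z => (LL x c z).re) _ z := h2
  rw [this.fderiv]
  simp [mul_comm]

theorem fderiv_fmap_coord [NeZero (2 * n)] (x : ZMod (2 * n) → ℝ) {z : ℂ} (hz : 0 < z.im) (h : ℂ)
    (i : Fin 2) : fderiv ℝ (P.fmap x) z h i = - (FF x (fun k => P.e k i) z * h).im / Real.pi := by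
  have hd : DifferentiableAt ℝ (P.fmap x) z := (P.contDiffAt_fmap x hz (m := 1)).differentiableAt one_ne_zero
  have h1 : HasFDerivAt (fun z => P.fmap x z i) ((EuclideanSpace.proj i : Pt →L[ℝ] ℝ) ∘L fderiv ℝ (P.fmap x) z) z :=
    (EuclideanSpace.proj i : Pt →L[ℝ] ℝ).hasFDerivAt.comp z hd.hasFDerivAt
  have h2 : fderiv ℝ (P.fmap x) z h i = fderiv ℝ (fun z => P.fmap x z i) z h := by
    rw [h1.fderiv]; simp
  rw [h2]
  simp only [P.fmap_coord x]
  rw [fderiv_const_sub]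
  have h3 : (fun z => (LL x (fun k => P.e k i) z).im / Real.pi) =
      (fun z => (Real.pi)⁻¹ • (LL x (fun k => P.e k i) z).im) := by
    funext z; simp [div_eq_inv_mul]
  have hd2 : DifferentiableAt ℝ (fun z => (LL x (fun k => P.e k i) z).im) z :=
    (Complex.imCLM.contDiff.contDiffAt.comp z (contDiffAt_LL x _ hz (m := 1))).differentiableAt one_ne_zero
  rw [h3, fderiv_fun_const_smul hd2]
  simp [hasFDerivAt_im_LL x _ hz]
  ring

theorem exists_equiv_fmap [NeZero (2 * n)] {x : ZMod (2 * n) → ℝ}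
    (hx : ∀ a b : ZMod (2 * n), a.val < b.val → x a < x b) {z : ℂ} (hz : 0 < z.im) :
    ∃ A : ℂ ≃L[ℝ] Pt, HasFDerivAt (P.fmap x) (A : ℂ →L[ℝ] Pt) z := by
  have hd : DifferentiableAt ℝ (P.fmap x) z := (P.contDiffAt_fmap x hz (m := 1)).differentiableAt one_ne_zero
  have hinj : Function.Injective (fderiv ℝ (P.fmap x) z) := by
    rw [injective_iff_map_eq_zero]
    intro h hh
    have hpi := Real.pi_pos.ne'
    have a0 := P.fderiv_fmap_coord x hz h 0
    have a1 := P.fderiv_fmap_coord x hz h 1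
    rw [hh] at a0 a1
    have hI := P.FF_indep hx hz
    set α := FF x (fun k => P.e k 0) z
    set β := FF x (fun k => P.e k 1) z
    have b0 : (α * h).im = 0 := by
      have := a0.symm
      simp only [PiLp.zero_apply, div_eq_zero_iff, hpi, or_false, neg_eq_zero] at this; exact this
    have b1 : (β * h).im = 0 := by
      have := a1.symm
      simp only [PiLp.zero_apply, div_eq_zero_iff, hpi, or_false, neg_eq_zero] at this; exact this
    rw [Complex.mul_im] at b0 b1
    have c0 : (α.re * β.im - α.im * β.re) * h.re = 0 := by linear_combination α.re * b1 - β.re * b0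
    have c1 : (α.re * β.im - α.im * β.re) * h.im = 0 := by linear_combination β.im * b0 - α.im * b1
    apply Complex.ext
    · simpa using (mul_eq_zero.1 c0).resolve_left hI
    · simpa using (mul_eq_zero.1 c1).resolve_left hI
  have hsurj : Function.Surjective (fderiv ℝ (P.fmap x) z) := by
    have hr : Module.finrank ℝ ℂ = Module.finrank ℝ Pt := by simp
    exact (LinearMap.injective_iff_surjective_of_finrank_eq_finrank hr
      (f := (fderiv ℝ (P.fmap x) z : ℂ →ₗ[ℝ] Pt))).1 hinj
  refine ⟨ContinuousLinearEquiv.ofBijective (fderiv ℝ (P.fmap x) z)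
    (LinearMap.ker_eq_bot.2 hinj) (LinearMap.range_eq_top.2 hsurj), ?_⟩
  rw [ContinuousLinearEquiv.coe_ofBijective]
  exact hd.hasFDerivAt

theorem isOpen_HH : IsOpen {z : ℂ | 0 < z.im} := isOpen_lt continuous_const Complex.continuous_im

theorem bijOn_fmap [NeZero (2 * n)] {x : ZMod (2 * n) → ℝ}
    (hx : ∀ a b : ZMod (2 * n), a.val < b.val → x a < x b) :
    BijOn (P.fmap x) {z : ℂ | 0 < z.im} P.Ω := by
  have hmaps : MapsTo (P.fmap x) {z : ℂ | 0 < z.im} P.Ω := fun z hz => P.fmap_mem hx hz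
  have hcont : ∀ z : ℂ, 0 < z.im → ContinuousAt (P.fmap x) z := fun z hz =>
    (P.contDiffAt_fmap x hz (m := 1)).continuousAt
  set F : {z : ℂ | 0 < z.im} → P.Ω := hmaps.restrict with hF
  have hFc : Continuous F := by
    apply Continuous.subtype_mk
    apply continuous_iff_continuousAt.2
    intro z
    exact (hcont z z.2).comp continuous_subtype_val.continuousAt
  have hloc : IsLocalHomeomorphOn (P.fmap x) {z : ℂ | 0 < z.im} := by
    apply IsLocalHomeomorphOn.mk
    intro z hz
    obtain ⟨A, hA⟩ := P.exists_equiv_fmap hx hz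
    refine ⟨(P.contDiffAt_fmap x hz (m := 1)).toOpenPartialHomeomorph (P.fmap x) hA one_ne_zero, ?_, ?_⟩
    · exact ContDiffAt.mem_toOpenPartialHomeomorph_source _ hA one_ne_zero
    · intro w _; rfl
  have hFl : IsLocalHomeomorph F := by
    refine IsLocalHomeomorph.of_comp (g := Subtype.val) ?_ P.isOpen.isOpenEmbedding_subtypeVal.isLocalHomeomorph hFc
    have : (Subtype.val ∘ F) = P.fmap x ∘ (Subtype.val : {z : ℂ | 0 < z.im} → ℂ) := rfl
    rw [this, isLocalHomeomorph_iff_isLocalHomeomorphOn_univ]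
    exact hloc.comp isOpen_HH.isOpenEmbedding_subtypeVal.isLocalHomeomorph.isLocalHomeomorphOn
      (fun z _ => z.2)
  have hFp : IsProperMap F := by
    rw [isProperMap_iff_ultrafilter]
    refine ⟨hFc, fun U y hy => ?_⟩
    have hy' : Tendsto (P.fmap x) (U.map (Subtype.val)) (𝓝 (y : Pt)) := by
      rw [Ultrafilter.coe_map, tendsto_map'_iff]
      exact (continuous_subtype_val.tendsto y).comp hy
    rcases P.fmap_limit hx (U.map Subtype.val) (by
      rw [Ultrafilter.coe_map]
      exact Filter.eventually_map.2 (Eventually.of_forall fun z => z.2)) with ⟨z, hz, hle⟩ | ⟨k, y', hy1, hy2, _⟩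
    · refine ⟨⟨z, hz⟩, ?_, ?_⟩
      · apply Subtype.ext
        exact tendsto_nhds_unique ((hcont z hz).tendsto.mono_left hle) hy'
      · rw [nhds_subtype_eq_comap, ← Filter.map_le_iff_le_comap]
        exact hle
    · exfalso
      have := tendsto_nhds_unique hy2 hy'
      have h1 := P.seg_sub_frontier k hy1
      rw [this] at h1
      rw [P.isOpen.frontier_eq] at h1
      exact h1.2 y.2
  have hconv : Convex ℝ {z : ℂ | 0 < z.im} := convex_halfSpace_im_gt 0
  have hpre : PreconnectedSpace {z : ℂ | 0 < z.im} :=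
    isPreconnected_iff_preconnectedSpace.1 hconv.isPreconnected
  have := Convex.contractibleSpace P.convex P.nonempty
  have : SimplyConnectedSpace P.Ω := inferInstance
  have := P.isOpen.locallyPathConnectedSpace
  have hb := bijective_of_proper_localHomeo hFp hFl ⟨Complex.I, by simp⟩
  refine ⟨hmaps, ?_, ?_⟩
  · exact hmaps.restrict_inj.1 hb.1
  · intro y hy
    obtain ⟨z, hz⟩ := hb.2 ⟨y, hy⟩
    exact ⟨z, z.2, congrArg Subtype.val hz⟩

/-- inverse of the harmonic map -/
theorem exists_inverse [NeZero (2 * n)] {x : ZMod (2 * n) → ℝ}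
    (hx : ∀ a b : ZMod (2 * n), a.val < b.val → x a < x b) :
    ∃ g : Pt → ℂ, (∀ p ∈ P.Ω, 0 < (g p).im ∧ P.fmap x (g p) = p) ∧
      ∀ p ∈ P.Ω, ContDiffAt ℝ 3 g p := by
  have hb := P.bijOn_fmap hx
  have hcont : ContinuousOn (P.fmap x) {z : ℂ | 0 < z.im} := fun z hz =>
    (P.contDiffAt_fmap x hz (m := 1)).continuousAt.continuousWithinAt
  have hloc : IsLocalHomeomorphOn (P.fmap x) {z : ℂ | 0 < z.im} := by
    apply IsLocalHomeomorphOn.mk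
    intro z hz
    obtain ⟨A, hA⟩ := P.exists_equiv_fmap hx hz
    refine ⟨(P.contDiffAt_fmap x hz (m := 1)).toOpenPartialHomeomorph (P.fmap x) hA one_ne_zero, ?_, ?_⟩
    · exact ContDiffAt.mem_toOpenPartialHomeomorph_source _ hA one_ne_zero
    · intro w _; rfl
  have hopen : IsOpenMap ({z : ℂ | 0 < z.im}.domRestrict (P.fmap x)) := by
    have : IsLocalHomeomorph ({z : ℂ | 0 < z.im}.domRestrict (P.fmap x)) := by
      rw [Set.domRestrict_eq, isLocalHomeomorph_iff_isLocalHomeomorphOn_univ]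
      exact hloc.comp isOpen_HH.isOpenEmbedding_subtypeVal.isLocalHomeomorph.isLocalHomeomorphOn
        (fun z _ => z.2)
    exact this.isOpenMap
  have : Nonempty ℂ := ⟨0⟩
  set Φ := OpenPartialHomeomorph.ofContinuousOpenRestrict
    (hb.toPartialEquiv (P.fmap x) _ _) hcont hopen isOpen_HH with hΦ
  have hcoe : (Φ : ℂ → Pt) = P.fmap x := rfl
  have hs : Φ.source = {z : ℂ | 0 < z.im} := rfl
  have ht : Φ.target = P.Ω := rfl
  refine ⟨Φ.symm, fun p hp => ⟨?_, ?_⟩, fun p hp => ?_⟩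
  · exact Φ.map_target (ht ▸ hp)
  · exact Φ.right_inv (ht ▸ hp)
  · have hz : 0 < (Φ.symm p).im := Φ.map_target (ht ▸ hp)
    obtain ⟨A, hA⟩ := P.exists_equiv_fmap hx hz
    exact Φ.contDiffAt_symm (f₀' := A) (ht ▸ hp) hA (P.contDiffAt_fmap x hz)

end UnitPolygon



/-! ### Part B5: the minimal surface equation -/

theorem grad_coord (u : Pt → ℝ) (p : Pt) (i : Fin 2) :
    gradient u p i = fderiv ℝ u p (EuclideanSpace.single i 1) := by
  have : inner ℝ (gradient u p) (EuclideanSpace.single i (1 : ℝ)) = fderiv ℝ u p (EuclideanSpace.single i 1) := by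
    unfold gradient
    rw [InnerProductSpace.toDual_symm_apply]
  rw [← this]
  rw [EuclideanSpace.inner_single_right]; simp

/-- Algebra: the null relation gives the conjugate gradient. -/
theorem null_algebra {α β κ : ℂ} {p q P Q W : ℝ}
    (hD : α.re * β.im - α.im * β.re ≠ 0)
    (h1 : (p : ℂ) * α + q * β = Complex.I * κ) (h2 : (P : ℂ) * α + Q * β = κ)
    (h3 : α ^ 2 + β ^ 2 = κ ^ 2) (hW : 0 < W) (hW2 : W ^ 2 = 1 + p ^ 2 + q ^ 2) :
    (0 < α.re * β.im - α.im * β.re → p = W * (-Q) ∧ q = W * P) ∧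
    (α.re * β.im - α.im * β.re < 0 → p = W * Q ∧ q = W * (-P)) := by
  have hα : α ≠ 0 := by rintro rfl; simp at hD
  obtain ⟨c, rfl⟩ : ∃ c, β = c * α := ⟨β / α, by field_simp⟩
  have hDc : α.re * (c * α).im - α.im * (c * α).re = c.im * Complex.normSq α := by
    rw [Complex.normSq_apply]; simp; ring
  rw [hDc] at hD ⊢
  have hN : 0 < Complex.normSq α := Complex.normSq_pos.2 hα
  have hb : c.im ≠ 0 := fun h => hD (by rw [h]; simp)
  have e1 : (1 + q ^ 2 : ℂ) * c ^ 2 + 2 * p * q * c + 1 + p ^ 2 = 0 := by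
    have : α ^ 2 * ((1 + q ^ 2 : ℂ) * c ^ 2 + 2 * p * q * c + 1 + p ^ 2) = 0 := by
      have hI : Complex.I ^ 2 = -1 := Complex.I_sq
      linear_combination h3 + (p * α + q * (c * α) + Complex.I * κ) * h1 + κ ^ 2 * hI
    exact (mul_eq_zero.1 this).resolve_left (pow_ne_zero 2 hα)
  have e2 : (P : ℂ) + Q * c = - Complex.I * (p + q * c) := by
    have : α * ((P : ℂ) + Q * c) = α * (- Complex.I * (p + q * c)) := by
      have hI : Complex.I ^ 2 = -1 := Complex.I_sq
      linear_combination h2 + Complex.I * h1 + κ * hI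
    exact mul_left_cancel₀ hα this
  have r1 := congrArg Complex.re e1
  have i1 := congrArg Complex.im e1
  have r2 := congrArg Complex.re e2
  have i2 := congrArg Complex.im e2
  simp [pow_two] at r1 i1 r2 i2
  set a := c.re
  set b := c.im
  -- a (1+q²) = - p q
  have ha : (1 + q ^ 2) * a = - (p * q) := by
    have : b * ((1 + q ^ 2) * a + p * q) = 0 := by linear_combination i1 / 2
    have := (mul_eq_zero.1 this).resolve_left hb
    linarith
  have hq : 0 < 1 + q ^ 2 := by positivity
  have hb2 : ((1 + q ^ 2) * b) ^ 2 = W ^ 2 := by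
    rw [hW2]
    linear_combination - (1 + q ^ 2) * r1 + ((1 + q ^ 2) * a + p * q) * ha
  have hQ : Q * b * (1 + q ^ 2) = - p := by linear_combination (1 + q ^ 2) * i2 - q * ha
  have hP : P = q * b - Q * a := by linarith
  have hfac : ((1 + q ^ 2) * b - W) * ((1 + q ^ 2) * b + W) = 0 := by linear_combination hb2
  have key : ∀ s : ℝ, s ≠ 0 → (1 + q ^ 2) * b = s → s ^ 2 = W ^ 2 → p = s * (-Q) ∧ q = s * P := by
    intro s hs hsb hsW
    have hp : p = s * (-Q) := by rw [← hsb]; linarith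
    refine ⟨hp, ?_⟩
    have : (1 + q ^ 2) * (s * P) = (1 + q ^ 2) * q := by
      have h5 : (1 + q ^ 2) * (s * P) = q * s ^ 2 - s * Q * ((1 + q ^ 2) * a) := by
        rw [hP, ← hsb]; ring
      rw [h5, ha, hsW, hW2]
      linear_combination (p * q) * hp
    exact (mul_left_cancel₀ hq.ne' this).symm
  constructor
  · intro hpos
    have hbp : 0 < b := by
      by_contra h
      have := mul_nonpos_of_nonpos_of_nonneg (not_lt.1 h) hN.le
      linarith
    have : (1 + q ^ 2) * b = W := by
      rcases mul_eq_zero.1 hfac with h | h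
      · linarith
      · have : 0 < (1 + q ^ 2) * b := by positivity
        linarith
    exact key W hW.ne' this rfl
  · intro hneg
    have hbp : b < 0 := by
      by_contra h
      have := mul_nonneg (not_lt.1 h) hN.le
      linarith
    have : (1 + q ^ 2) * b = -W := by
      rcases mul_eq_zero.1 hfac with h | h
      · have : (1 + q ^ 2) * b < 0 := mul_neg_of_pos_of_neg hq hbp
        linarith
      · linarith
    have := key (-W) (neg_ne_zero.2 hW.ne') this (by ring)
    exact ⟨by linarith [this.1], by linarith [this.2]⟩

/-- rotated gradients are divergence free -/
theorem div_rot {ψ : Pt → ℝ} {p : Pt} (hψ : ContDiffAt ℝ 2 ψ p) (σ : ℝ) :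
    (∑ i : Fin 2, fderiv ℝ (fun q => vec2 (σ * -(fderiv ℝ ψ q (EuclideanSpace.single 1 1)))
      (σ * (fderiv ℝ ψ q (EuclideanSpace.single 0 1)))) p (EuclideanSpace.single i 1) i) = 0 := by
  have hsym : IsSymmSndFDerivAt ℝ ψ p := hψ.isSymmSndFDerivAt (by simp)
  have hd : DifferentiableAt ℝ (fderiv ℝ ψ) p :=
    (hψ.fderiv_right (m := 1) (by norm_num)).differentiableAt one_ne_zero
  set Y : Pt → Pt := fun q => vec2 (σ * -(fderiv ℝ ψ q (EuclideanSpace.single 1 1)))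
      (σ * (fderiv ℝ ψ q (EuclideanSpace.single 0 1))) with hY
  have hdv : ∀ v, HasFDerivAt (fun q => fderiv ℝ ψ q v) ((fderiv ℝ (fderiv ℝ ψ) p).flip v) p := by
    intro v
    have := hd.hasFDerivAt.clm_apply (hasFDerivAt_const v p)
    rw [ContinuousLinearMap.comp_zero, zero_add] at this
    exact this
  have hYd : DifferentiableAt ℝ Y p := by
    rw [differentiableAt_euclidean]
    intro i
    fin_cases i
    · exact ((hdv _).neg.const_mul σ).differentiableAt
    · exact ((hdv _).const_mul σ).differentiableAt
  have hc : ∀ (i : Fin 2) (v : Pt), fderiv ℝ Y p v i = fderiv ℝ (fun q => Y q i) p v := by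
    intro i v
    have h1 : HasFDerivAt (fun z => Y z i) ((EuclideanSpace.proj i : Pt →L[ℝ] ℝ) ∘L fderiv ℝ Y p) p :=
      (EuclideanSpace.proj i : Pt →L[ℝ] ℝ).hasFDerivAt.comp p hYd.hasFDerivAt
    rw [h1.fderiv]; simp
  rw [Fin.sum_univ_two, hc, hc]
  have e0 : fderiv ℝ (fun q => Y q 0) p = σ • -((fderiv ℝ (fderiv ℝ ψ) p).flip (EuclideanSpace.single 1 1)) :=
    ((hdv _).neg.const_mul σ).fderiv
  have e1 : fderiv ℝ (fun q => Y q 1) p = σ • ((fderiv ℝ (fderiv ℝ ψ) p).flip (EuclideanSpace.single 0 1)) :=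
    ((hdv _).const_mul σ).fderiv
  rw [e0, e1]
  have := hsym (EuclideanSpace.single 0 1) (EuclideanSpace.single 1 1)
  simp [this]

namespace UnitPolygon

variable {n : ℕ} (P : UnitPolygon n)

theorem minimal_graph_of [NeZero (2 * n)] {x : ZMod (2 * n) → ℝ}
    (hx : ∀ a b : ZMod (2 * n), a.val < b.val → x a < x b) (c : ZMod (2 * n) → ℝ)
    (hnull : ∀ z : ℂ, 0 < z.im → FF x (fun k => P.e k 0) z ^ 2 + FF x (fun k => P.e k 1) z ^ 2
      = FF x c z ^ 2)
    {g : Pt → ℂ} (hg : ∀ p ∈ P.Ω, 0 < (g p).im ∧ P.fmap x (g p) = p)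
    (hgs : ∀ p ∈ P.Ω, ContDiffAt ℝ 3 g p) :
    MinimalGraph P.Ω (fun p => -(LL x c (g p)).re / Real.pi) := by
  set u : Pt → ℝ := fun p => -(LL x c (g p)).re / Real.pi with hu
  set ψ : Pt → ℝ := fun p => -(LL x c (g p)).im / Real.pi with hψ
  have hLg : ∀ p ∈ P.Ω, ContDiffAt ℝ 3 (fun p => LL x c (g p)) p := fun p hp =>
    (contDiffAt_LL x c (hg p hp).1).comp p (hgs p hp)
  have hus : ∀ p ∈ P.Ω, ContDiffAt ℝ 3 u p := fun p hp =>
    (Complex.reCLM.contDiff.contDiffAt.comp p (hLg p hp)).neg.div_const _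
  have hψs : ∀ p ∈ P.Ω, ContDiffAt ℝ 3 ψ p := fun p hp =>
    (Complex.imCLM.contDiff.contDiffAt.comp p (hLg p hp)).neg.div_const _
  have hpi := Real.pi_pos.ne'
  set D : Pt → ℝ := fun p => (FF x (fun k => P.e k 0) (g p)).re * (FF x (fun k => P.e k 1) (g p)).im
      - (FF x (fun k => P.e k 0) (g p)).im * (FF x (fun k => P.e k 1) (g p)).re with hDdef
  have hDc : ∀ p ∈ P.Ω, ContinuousAt D p := by
    intro p hp
    have hF : ∀ d : ZMod (2 * n) → ℝ, ContinuousAt (fun p => FF x d (g p)) p := by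
      intro d
      unfold FF
      apply tendsto_finsetSum
      intro k _
      have h1 : ContinuousAt (fun p => (d k : ℂ) / (g p - x k)) p :=
        ContinuousAt.div continuousAt_const ((hgs p hp).continuousAt.sub continuousAt_const)
          (sub_ne (hg p hp).1 _)
      exact h1
    have hre : ∀ d, ContinuousAt (fun p => (FF x d (g p)).re) p := fun d =>
      Complex.continuous_re.continuousAt.comp (hF d)
    have him : ∀ d, ContinuousAt (fun p => (FF x d (g p)).im) p := fun d =>
      Complex.continuous_im.continuousAt.comp (hF d)
    exact ((hre _).mul (him _)).sub ((him _).mul (hre _))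
  have key : ∀ p ∈ P.Ω,
      (0 < D p → (Wu u p)⁻¹ • gradient u p = vec2 (1 * -(fderiv ℝ ψ p (EuclideanSpace.single 1 1)))
        (1 * (fderiv ℝ ψ p (EuclideanSpace.single 0 1)))) ∧
      (D p < 0 → (Wu u p)⁻¹ • gradient u p = vec2 (-1 * -(fderiv ℝ ψ p (EuclideanSpace.single 1 1)))
        (-1 * (fderiv ℝ ψ p (EuclideanSpace.single 0 1)))) := by
    intro p hp
    obtain ⟨hz, hfg⟩ := hg p hp
    have hgd : DifferentiableAt ℝ g p := (hgs p hp).differentiableAt (by norm_num)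
    have hfd : DifferentiableAt ℝ (P.fmap x) (g p) :=
      (P.contDiffAt_fmap x hz (m := 1)).differentiableAt one_ne_zero
    have hcomp : ∀ v : Pt, fderiv ℝ (P.fmap x) (g p) (fderiv ℝ g p v) = v := by
      intro v
      have h1 : HasFDerivAt (fun q => P.fmap x (g q)) ((fderiv ℝ (P.fmap x) (g p)) ∘L (fderiv ℝ g p)) p :=
        hfd.hasFDerivAt.comp p hgd.hasFDerivAt
      have h2 : HasFDerivAt (fun q => P.fmap x (g q)) (ContinuousLinearMap.id ℝ Pt) p := by
        apply (hasFDerivAt_id p).congr_of_eventuallyEq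
        filter_upwards [P.isOpen.mem_nhds hp] with q hq using (hg q hq).2
      have := congrArg (fun L : Pt →L[ℝ] Pt => L v) (h1.unique h2)
      simpa using this
    have hcoord : ∀ (v : Pt) (i : Fin 2),
        (FF x (fun k => P.e k i) (g p) * fderiv ℝ g p v).im = - Real.pi * v i := by
      intro v i
      have := P.fderiv_fmap_coord x hz (fderiv ℝ g p v) i
      rw [hcomp] at this
      field_simp at this
      linarith
    have hdu : ∀ v, fderiv ℝ u p v = -(FF x c (g p) * fderiv ℝ g p v).re / Real.pi := by
      intro v
      have hd : DifferentiableAt ℝ (fun z => (LL x c z).re) (g p) :=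
        (Complex.reCLM.contDiff.contDiffAt.comp _ (contDiffAt_LL x c hz (m := 1))).differentiableAt one_ne_zero
      have h1 : HasFDerivAt (fun q => (LL x c (g q)).re)
          ((fderiv ℝ (fun z => (LL x c z).re) (g p)) ∘L fderiv ℝ g p) p :=
        hd.hasFDerivAt.comp p hgd.hasFDerivAt
      have h2 := h1.neg.mul_const (Real.pi)⁻¹
      have h3 : HasFDerivAt u _ p := h2
      rw [h3.fderiv]
      simp [hasFDerivAt_re_LL x c hz]
      ring
    have hdψ : ∀ v, fderiv ℝ ψ p v = -(FF x c (g p) * fderiv ℝ g p v).im / Real.pi := by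
      intro v
      have hd : DifferentiableAt ℝ (fun z => (LL x c z).im) (g p) :=
        (Complex.imCLM.contDiff.contDiffAt.comp _ (contDiffAt_LL x c hz (m := 1))).differentiableAt one_ne_zero
      have h1 : HasFDerivAt (fun q => (LL x c (g q)).im)
          ((fderiv ℝ (fun z => (LL x c z).im) (g p)) ∘L fderiv ℝ g p) p :=
        hd.hasFDerivAt.comp p hgd.hasFDerivAt
      have h2 := h1.neg.mul_const (Real.pi)⁻¹
      have h3 : HasFDerivAt ψ _ p := h2
      rw [h3.fderiv]
      simp [hasFDerivAt_im_LL x c hz]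
      ring
    have a00 := hcoord (EuclideanSpace.single 0 1) 0
    have a01 := hcoord (EuclideanSpace.single 0 1) 1
    have a10 := hcoord (EuclideanSpace.single 1 1) 0
    have a11 := hcoord (EuclideanSpace.single 1 1) 1
    have u0 := hdu (EuclideanSpace.single 0 1)
    have u1 := hdu (EuclideanSpace.single 1 1)
    have w0 := hdψ (EuclideanSpace.single 0 1)
    have w1 := hdψ (EuclideanSpace.single 1 1)
    have hn := hnull (g p) hz
    have hDp : D p ≠ 0 := P.FF_indep hx hz
    simp only [hDdef] at hDp ⊢
    have g0 := grad_coord u p 0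
    have g1 := grad_coord u p 1
    set α := FF x (fun k => P.e k 0) (g p)
    set β := FF x (fun k => P.e k 1) (g p)
    set κ := FF x c (g p)
    set h0 := fderiv ℝ g p (EuclideanSpace.single 0 1)
    set h1 := fderiv ℝ g p (EuclideanSpace.single 1 1)
    set pp := fderiv ℝ u p (EuclideanSpace.single 0 1)
    set qq := fderiv ℝ u p (EuclideanSpace.single 1 1)
    set PP := fderiv ℝ ψ p (EuclideanSpace.single 0 1)
    set QQ := fderiv ℝ ψ p (EuclideanSpace.single 1 1)
    simp at a00 a01 a10 a11
    rw [eq_div_iff hpi] at u0 u1 w0 w1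
    simp only [Complex.mul_re, Complex.mul_im] at u0 u1 w0 w1
    have hdet : h0.im * h1.re - h0.re * h1.im ≠ 0 := by
      intro h
      have : (α.re * β.im - α.im * β.re) * (h0.im * h1.re - h0.re * h1.im) = Real.pi ^ 2 := by
        linear_combination (β.re * h1.im + β.im * h1.re) * a00 - Real.pi * a11 - (α.re * h1.im + α.im * h1.re) * a01
      rw [h, mul_zero] at this
      exact (pow_ne_zero 2 hpi) this.symm
    have hzero : ∀ w : ℂ, (w * h0).im = 0 → (w * h1).im = 0 → w = 0 := by
      intro w e0 e1
      rw [Complex.mul_im] at e0 e1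
      apply Complex.ext
      · have : (h0.im * h1.re - h0.re * h1.im) * w.re = 0 := by
          linear_combination h1.re * e0 - h0.re * e1
        simpa using (mul_eq_zero.1 this).resolve_left hdet
      · have : (h0.im * h1.re - h0.re * h1.im) * w.im = 0 := by
          linear_combination h0.im * e1 - h1.im * e0
        simpa using (mul_eq_zero.1 this).resolve_left hdet
    have hc1 : (pp : ℂ) * α + qq * β = Complex.I * κ := by
      rw [← sub_eq_zero]
      apply hzero
      · simp; linear_combination pp * a00 + qq * a01 - u0
      · simp; linear_combination pp * a10 + qq * a11 - u1
    have hc2 : (PP : ℂ) * α + QQ * β = κ := by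
      rw [← sub_eq_zero]
      apply hzero
      · simp; linear_combination PP * a00 + QQ * a01 - w0
      · simp; linear_combination PP * a10 + QQ * a11 - w1
    have hWp : 0 < Wu u p := by unfold Wu; positivity
    have hW2 : Wu u p ^ 2 = 1 + pp ^ 2 + qq ^ 2 := by
      unfold Wu
      rw [Real.sq_sqrt (by positivity), pt_norm_sq, g0, g1]; ring
    obtain ⟨k1, k2⟩ := null_algebra hDp hc1 hc2 hn hWp hW2
    constructor
    · intro h
      obtain ⟨j1, j2⟩ := k1 h
      apply pt_ext
      · simp only [PiLp.smul_apply, vec2_zero, g0, smul_eq_mul]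
        rw [inv_mul_eq_iff_eq_mul₀ hWp.ne', j1]; ring
      · simp only [PiLp.smul_apply, vec2_one, g1, smul_eq_mul]
        rw [inv_mul_eq_iff_eq_mul₀ hWp.ne', j2]; ring
    · intro h
      obtain ⟨j1, j2⟩ := k2 h
      apply pt_ext
      · simp only [PiLp.smul_apply, vec2_zero, g0, smul_eq_mul]
        rw [inv_mul_eq_iff_eq_mul₀ hWp.ne', j1]; ring
      · simp only [PiLp.smul_apply, vec2_one, g1, smul_eq_mul]
        rw [inv_mul_eq_iff_eq_mul₀ hWp.ne', j2]; ring
  refine ⟨P.isOpen, fun p hp => ((hus p hp).of_le (by norm_num)).contDiffWithinAt, fun p hp => ?_⟩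
  have hDp : D p ≠ 0 := P.FF_indep hx (hg p hp).1
  obtain ⟨σ, hσ⟩ : ∃ σ : ℝ, (fun q => (Wu u q)⁻¹ • gradient u q) =ᶠ[𝓝 p]
      (fun q => vec2 (σ * -(fderiv ℝ ψ q (EuclideanSpace.single 1 1)))
      (σ * (fderiv ℝ ψ q (EuclideanSpace.single 0 1)))) := by
    rcases hDp.lt_or_gt with h | h
    · refine ⟨-1, ?_⟩
      filter_upwards [P.isOpen.mem_nhds hp, (hDc p hp).eventually (gt_mem_nhds h)] with q hq h'
      exact (key q hq).2 h'
    · refine ⟨1, ?_⟩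
      filter_upwards [P.isOpen.mem_nhds hp, (hDc p hp).eventually (lt_mem_nhds h)] with q hq h'
      exact (key q hq).1 h'
  rw [hσ.fderiv_eq]
  exact div_rot ((hψs p hp).of_le (by norm_num)) σ

end UnitPolygon



/-! ### Part B6: boundary behaviour and existence -/

namespace UnitPolygon

variable {n : ℕ} (P : UnitPolygon n)

theorem edge_unique {k k' : ZMod (2 * n)} {t : Pt} (h : t ∈ openSegment ℝ (P.vtx k) (P.vtx (k + 1)))
    (h' : t ∈ segment ℝ (P.vtx k') (P.vtx (k' + 1))) : k = k' := by
  have hnz := P.neZero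
  have hz := P.cross_seg_eq_zero k' h'
  rw [openSegment_eq_image'] at h
  obtain ⟨s, ⟨hs0, hs1⟩, rfl⟩ := h
  rw [segment_eq_image'] at h'
  obtain ⟨s', ⟨hs0', hs1'⟩, ht⟩ := h'
  simp only at ht hz
  have a1 := P.edge_vtx_nonneg k' k
  have a2 := P.edge_vtx_nonneg k' (k + 1)
  have hlin : cross2 (P.e k') (P.vtx k + s • (P.vtx (k + 1) - P.vtx k) - P.vtx k')
      = (1 - s) * cross2 (P.e k') (P.vtx k - P.vtx k') + s * cross2 (P.e k') (P.vtx (k + 1) - P.vtx k') := by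
    rw [← cross2_smul_right, ← cross2_smul_right, ← cross2_add_right]; congr 1; module
  rw [hlin] at hz
  have b1 : cross2 (P.e k') (P.vtx k - P.vtx k') = 0 := by nlinarith
  have b2 : cross2 (P.e k') (P.vtx (k + 1) - P.vtx k') = 0 := by nlinarith
  have hpar : cross2 (P.e k') (P.e k) = 0 := by
    have : P.e k = (P.vtx (k + 1) - P.vtx k') - (P.vtx k - P.vtx k') := by unfold e; abel
    rw [this, cross2_sub_right, b1, b2]; ring
  rcases unit_parallel (P.norm_e k') (P.norm_e k) hpar with he | he
  swap
  · exfalso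
    obtain ⟨y, hy⟩ := P.nonempty
    have c1 := P.edge_pos k' y hy
    have c2 := P.edge_pos k y hy
    rw [he, cross2_neg_left] at c2
    have : y - P.vtx k' = (y - P.vtx k) + (P.vtx k - P.vtx k') := by abel
    rw [this, cross2_add_right, b1] at c1
    linarith
  -- same direction
  have hm : P.vtx k = P.vtx k' + (s' - s) • P.e k' := by
    have e1 : P.vtx (k + 1) - P.vtx k = P.e k' := he
    have e2 : P.vtx (k' + 1) - P.vtx k' = P.e k' := rfl
    rw [e1, e2] at ht
    rw [sub_smul, ← add_sub_assoc, ht]; abel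
  have hinj : ∀ a b : ℝ, P.vtx k' + a • P.e k' = P.vtx k' + b • P.e k' → a = b := by
    intro a b hab
    exact smul_left_injective ℝ (P.e_ne_zero k') (add_left_cancel hab)
  set t0 := (k - k').val with ht0
  have ht0l : t0 < 2 * n := ZMod.val_lt _
  have hk : k = k' + (t0 : ZMod (2 * n)) := by rw [ht0, ZMod.natCast_zmod_val]; ring
  obtain ⟨r, hr1, hr2⟩ := P.turn k'
  have hsum : ∀ a b : ℕ, a ≤ b → ∑ i ∈ Finset.Ico a b, cross2 (P.e k') (P.e (k' + i))
      = cross2 (P.e k') (P.vtx (k' + b) - P.vtx k') - cross2 (P.e k') (P.vtx (k' + a) - P.vtx k') := by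
    intro a b hab
    rw [← cross2_sum, ← P.vtx_shift k' a b hab, ← cross2_sub_right]; congr 1; abel
  have hrun : ∀ a m : ℕ, P.e (k' + a) = P.e k' →
      (∀ i, a ≤ i → i < a + m → cross2 (P.e k') (P.e (k' + i)) = 0) →
      ∀ i, a ≤ i → i < a + m → P.e (k' + i) = P.e k' := by
    intro a m ha0 hall i hai
    induction i, hai using Nat.le_induction with
    | base => intro _; exact ha0
    | succ i hi ih =>
      intro hlt
      have h1 := ih (by omega)
      have h2 := hall (i + 1) (by omega) hlt
      have h3 : k' + ((i + 1 : ℕ) : ZMod (2 * n)) = k' + i + 1 := by push_cast; ring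
      rw [h3] at h2 ⊢
      rw [← h1] at h2
      rw [P.e_succ_eq _ h2, h1]
  rcases lt_or_ge t0 r with hc | hc
  · have h0 := hsum 0 t0 (Nat.zero_le _)
    rw [← hk, b1, Nat.cast_zero, add_zero, sub_self] at h0
    simp only [cross2, PiLp.zero_apply, mul_zero, sub_self] at h0
    have h0' := (Finset.sum_eq_zero_iff_of_nonneg (fun i hi => by
      have := Finset.mem_Ico.1 hi
      exact hr1 i (by omega))).1 h0
    have hr := hrun 0 t0 (by simp) (fun i _ hi => h0' i (Finset.mem_Ico.2 ⟨by omega, by omega⟩))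
    have hv := P.vtx_run k' 0 t0 (P.e k') hr t0 le_rfl
    rw [zero_add, ← hk, Nat.cast_zero, add_zero, hm] at hv
    have := hinj _ _ hv
    have ht1 : (t0 : ℝ) < 1 := by linarith
    have : t0 = 0 := by
      have : t0 < 1 := by exact_mod_cast ht1
      omega
    rw [hk, this]; simp
  · exfalso
    have h0 := hsum t0 (2 * n) ht0l.le
    rw [← hk, b1, ZMod.natCast_self, add_zero, sub_self] at h0
    simp only [cross2, PiLp.zero_apply, mul_zero, sub_self] at h0
    have h0' := (Finset.sum_eq_zero_iff_of_nonpos (fun i hi => by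
      have := Finset.mem_Ico.1 hi
      exact hr2 i (by omega) (by omega))).1 h0
    have hr := hrun t0 (2 * n - t0) (by rw [← hk]; exact he)
      (fun i h1 h2 => h0' i (Finset.mem_Ico.2 ⟨by omega, by omega⟩))
    have hv := P.vtx_run k' t0 (2 * n - t0) (P.e k') hr (2 * n - t0) le_rfl
    rw [show t0 + (2 * n - t0) = 2 * n by omega, ZMod.natCast_self, add_zero, ← hk, hm, add_assoc,
      ← add_smul] at hv
    have h3 := hinj 0 (s' - s + ((2 * n - t0 : ℕ) : ℝ)) (by rw [zero_smul, add_zero]; exact hv)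
    have h4 : (1 : ℝ) ≤ ((2 * n - t0 : ℕ) : ℝ) := by exact_mod_cast (by omega : 1 ≤ 2 * n - t0)
    linarith

theorem openSeg_not_vtx {k j : ZMod (2 * n)} (h : P.vtx j ∈ openSegment ℝ (P.vtx k) (P.vtx (k + 1))) :
    False := by
  have hn := P.n_ge
  have a := P.edge_unique h (left_mem_segment ℝ _ _)
  have hb : P.vtx j ∈ segment ℝ (P.vtx (j - 1)) (P.vtx (j - 1 + 1)) := by
    rw [sub_add_cancel]; exact right_mem_segment _ _ _
  have b := P.edge_unique h hb
  rw [a] at b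
  have h1 : (1 : ZMod (2 * n)) = 0 := by
    have := sub_eq_self.1 b.symm; exact this
  have : ((1 : ℕ) : ZMod (2 * n)) = 0 := by exact_mod_cast h1
  rw [ZMod.natCast_eq_zero_iff] at this
  have := Nat.le_of_dvd one_pos this
  omega

theorem re_LL_tendsto [NeZero (2 * n)] {x : ZMod (2 * n) → ℝ}
    (hx : ∀ a b : ZMod (2 * n), a.val < b.val → x a < x b) (c : ZMod (2 * n) → ℝ)
    {l : Filter ℂ} (hl : ∀ᶠ z in l, 0 < z.im) {k : ZMod (2 * n)} (hk : l ≤ 𝓝 (x k : ℂ)) :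
    (0 < c k → Tendsto (fun z => -(LL x c z).re / Real.pi) l atTop) ∧
    (c k < 0 → Tendsto (fun z => -(LL x c z).re / Real.pi) l atBot) := by
  classical
  have hre : ∀ z : ℂ, (LL x c z).re = c k * Real.log ‖z - x k‖ +
      ∑ j ∈ Finset.univ.erase k, c j * Real.log ‖z - x j‖ := by
    intro z
    rw [Finset.add_sum_erase _ (fun j => c j * Real.log ‖z - x j‖) (Finset.mem_univ k)]
    unfold LL
    simp [Complex.log_re]
  have hxne : ∀ j, j ≠ k → x k ≠ x j := by
    intro j hj hjk
    apply hj
    apply ZMod.val_injective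
    rcases lt_trichotomy j.val k.val with h | h | h
    · exact absurd hjk.symm (hx _ _ h).ne
    · exact h
    · exact absurd hjk.symm (hx _ _ h).ne'
  have hrest : Tendsto (fun z : ℂ => ∑ j ∈ Finset.univ.erase k, c j * Real.log ‖z - x j‖) l
      (𝓝 (∑ j ∈ Finset.univ.erase k, c j * Real.log ‖(x k : ℂ) - x j‖)) := by
    apply tendsto_finsetSum
    intro j hj
    apply Tendsto.const_mul
    have hne : ‖(x k : ℂ) - x j‖ ≠ 0 := by
      rw [norm_ne_zero_iff, sub_ne_zero]
      exact_mod_cast hxne j (Finset.ne_of_mem_erase hj)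
    apply Tendsto.log _ hne
    exact ((continuous_norm.comp (continuous_sub_right (x j : ℂ))).tendsto _).mono_left hk
  have hlog : Tendsto (fun z : ℂ => Real.log ‖z - x k‖) l atBot := by
    apply Real.tendsto_log_nhdsGT_zero.comp
    apply tendsto_nhdsWithin_of_tendsto_nhds_of_eventually_within
    · have : Tendsto (fun z : ℂ => ‖z - x k‖) (𝓝 (x k : ℂ)) (𝓝 ‖(x k : ℂ) - x k‖) :=
        (continuous_norm.comp (continuous_sub_right (x k : ℂ))).tendsto _
      rw [sub_self, norm_zero] at this
      exact this.mono_left hk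
    · filter_upwards [hl] with z hz
      exact norm_pos_iff.2 (sub_ne hz _)
  have hpi := Real.pi_pos
  constructor
  · intro hc
    simp only [hre]
    have := ((hlog.const_mul_atBot hc).atBot_add hrest)
    exact (tendsto_neg_atBot_atTop.comp this).atTop_div_const hpi
  · intro hc
    simp only [hre]
    have := ((hlog.const_mul_atBot_of_neg hc).atTop_add hrest)
    exact (tendsto_neg_atTop_atBot.comp this).atBot_div_const hpi

theorem exists_graph (hns : ¬ P.IsSpecial) : ∃ u, JSGraph P u := by
  have hnz := P.neZero
  obtain ⟨x, hx, hR⟩ := P.exists_balanced hns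
  obtain ⟨g, hg, hgs⟩ := P.exists_inverse hx
  refine ⟨fun p => -(LL x sg (g p)).re / Real.pi, ?_, ?_⟩
  · apply P.minimal_graph_of hx sg _ hg hgs
    intro z hz
    exact P.null_curve hx hR (fun k => sub_ne hz _)
  · intro i t ht
    -- the ultrafilter argument
    have key : ∀ U : Ultrafilter Pt, (U : Filter Pt) ≤ 𝓝[P.Ω] t →
        (U.map g : Filter ℂ) ≤ 𝓝 (x i : ℂ) ∧ ∀ᶠ z in (U.map g : Filter ℂ), 0 < z.im := by
      intro U hU
      have hUΩ : ∀ᶠ p in (U : Filter Pt), p ∈ P.Ω := hU self_mem_nhdsWithin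
      have him : ∀ᶠ z in (U.map g : Filter ℂ), 0 < z.im := by
        rw [Ultrafilter.coe_map]
        exact Filter.eventually_map.2 (hUΩ.mono fun p hp => (hg p hp).1)
      refine ⟨?_, him⟩
      have hft : Tendsto (P.fmap x) (U.map g) (𝓝 t) := by
        rw [Ultrafilter.coe_map, tendsto_map'_iff]
        have : Tendsto id (U : Filter Pt) (𝓝 t) := hU.trans nhdsWithin_le_nhds
        exact this.congr' (hUΩ.mono fun p hp => (hg p hp).2.symm)
      have htF := P.seg_sub_frontier i (openSegment_subset_segment ℝ _ _ ht)
      rw [P.isOpen.frontier_eq] at htF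
      rcases P.fmap_limit hx (U.map g) him with ⟨z, hz, hle⟩ | ⟨k, y, hy1, hy2, hy3⟩
      · exfalso
        have h1 : Tendsto (P.fmap x) (U.map g) (𝓝 (P.fmap x z)) :=
          (P.contDiffAt_fmap x hz (m := 1)).continuousAt.tendsto.mono_left hle
        have := tendsto_nhds_unique h1 hft
        exact htF.2 (this ▸ P.fmap_mem hx hz)
      · have hyt := tendsto_nhds_unique hy2 hft
        rw [hyt] at hy1 hy3
        have hik := P.edge_unique ht hy1
        rcases hy3 with h | h | h
        · rw [hik]; exact h
        · rw [h] at ht; exact (P.openSeg_not_vtx ht).elim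
        · rw [h] at ht; exact (P.openSeg_not_vtx ht).elim
    constructor
    · intro he
      rw [tendsto_iff_ultrafilter]
      intro U hU
      obtain ⟨h1, h2⟩ := key U hU
      have := (re_LL_tendsto hx sg h2 h1).1 (by simp [sg, he])
      rw [Ultrafilter.coe_map, tendsto_map'_iff] at this
      exact this
    · intro he
      rw [tendsto_iff_ultrafilter]
      intro U hU
      obtain ⟨h1, h2⟩ := key U hU
      have := (re_LL_tendsto hx sg h2 h1).2 (by simp [sg, he])
      rw [Ultrafilter.coe_map, tendsto_map'_iff] at this
      exact this

end UnitPolygon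



/-! ### Part E1: the flux estimate in a rectangle -/

theorem arctan_le_self' {x : ℝ} (h : 0 ≤ x) : Real.arctan x ≤ x := by
  have := Real.le_tan (Real.arctan_nonneg.2 h) (Real.arctan_lt_pi_div_two x)
  rwa [Real.tan_arctan] at this

theorem flux_core {U A B : ℝ × ℝ → ℝ} {D : Set (ℝ × ℝ)} (hD : IsOpen D) {a b δ₀ : ℝ} (hab : a ≤ b)
    (hδ₀ : 0 < δ₀) (hR : Icc a b ×ˢ Ioc 0 δ₀ ⊆ D)
    (hU : ContDiffOn ℝ 1 U D) (hA : ContDiffOn ℝ 1 A D) (hB : ContDiffOn ℝ 1 B D)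
    (hdiv : ∀ p ∈ D, fderiv ℝ A p (1, 0) + fderiv ℝ B p (0, 1) = 0)
    (hA1 : ∀ p ∈ D, |A p| ≤ 1) (hB0 : ∀ p ∈ D, 0 ≤ B p) (hB2 : ∀ p ∈ D, B p ≤ 2)
    (hmon : ∀ p ∈ D, -1 ≤ A p * fderiv ℝ U p (1, 0) + B p * fderiv ℝ U p (0, 1))
    (hinf : ∀ M : ℝ, ∃ τ > 0, ∀ s ∈ Icc a b, ∀ t, 0 < t → t < τ → M ≤ U (s, t))
    {m : ℝ} (hm : 0 < m) {τ : ℝ} (hτ : 0 < τ) :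
    ∃ η, 0 < η ∧ η < τ ∧ η ≤ δ₀ ∧ ∫ s in a..b, B (s, η) ≤ m := by
  have hpi := Real.pi_pos
  set δ := min δ₀ (m / 8) with hδ
  have hδ0 : 0 < δ := lt_min hδ₀ (by positivity)
  have hδ1 : δ ≤ δ₀ := min_le_left _ _
  have hδ2 : δ ≤ m / 8 := min_le_right _ _
  have memD : ∀ s ∈ Icc a b, ∀ t, 0 < t → t ≤ δ → (s, t) ∈ D := fun s hs t h0 h1 =>
    hR ⟨hs, h0, h1.trans hδ1⟩
  -- bound of U on the top edge
  obtain ⟨K, hK⟩ : ∃ K : ℝ, ∀ s ∈ Icc a b, |U (s, δ)| ≤ K := by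
    have hc : ContinuousOn (fun s : ℝ => U (s, δ)) (Icc a b) :=
      hU.continuousOn.comp (by fun_prop) (fun s hs => memD s hs δ hδ0 le_rfl)
    obtain ⟨K, hK⟩ := isCompact_Icc.exists_bound_of_continuousOn hc
    exact ⟨K, hK⟩
  have hK0 : 0 ≤ K := (abs_nonneg _).trans (hK a ⟨le_rfl, hab⟩)
  set C := MeasureTheory.volume.real (Icc ((a, 0) : ℝ × ℝ) (b, δ)) with hC
  have hC0 : 0 ≤ C := MeasureTheory.measureReal_nonneg
  set ε := (Real.pi * m / 8) / (2 * (b - a) * K + C + 1) with hε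
  have hden : 0 < 2 * (b - a) * K + C + 1 := by
    have : 0 ≤ (b - a) * K := mul_nonneg (by linarith) hK0
    nlinarith
  have hε0 : 0 < ε := by positivity
  have hεb : ε * (2 * (b - a) * K + C) ≤ Real.pi * m / 8 := by
    have h1 : ε * (2 * (b - a) * K + C + 1) = Real.pi * m / 8 := by
      rw [hε]; field_simp
    nlinarith
  obtain ⟨τ', hτ', hbig⟩ := hinf (1 / ε)
  obtain ⟨η, hη0, hη1⟩ := exists_between (lt_min (lt_min hτ hτ') hδ0)
  have hητ : η < τ := hη1.trans_le ((min_le_left _ _).trans (min_le_left _ _))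
  have hητ' : η < τ' := hη1.trans_le ((min_le_left _ _).trans (min_le_right _ _))
  have hηδ : η < δ := hη1.trans_le (min_le_right _ _)
  refine ⟨η, hη0, hητ, hηδ.le.trans hδ1, ?_⟩
  set g : ℝ × ℝ → ℝ := fun p => Real.arctan (ε * U p) with hg
  have hgc : ContDiffOn ℝ 1 g D :=
    Real.contDiff_arctan.comp_contDiffOn (contDiffOn_const.mul hU)
  have hg1 : ∀ p, |g p| ≤ Real.pi / 2 := fun p => by
    rw [abs_le]; exact ⟨(Real.neg_pi_div_two_lt_arctan _).le, (Real.arctan_lt_pi_div_two _).le⟩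
  set f : ℝ × ℝ → ℝ := fun p => g p * A p with hf
  set G : ℝ × ℝ → ℝ := fun p => g p * B p with hG
  have hfc : ContDiffOn ℝ 1 f D := hgc.mul hA
  have hGc : ContDiffOn ℝ 1 G D := hgc.mul hB
  have hsub : Icc ((a, η) : ℝ × ℝ) (b, δ) ⊆ D := by
    rintro ⟨s, t⟩ ⟨⟨h1, h2⟩, h3, h4⟩
    exact memD s ⟨h1, h3⟩ t (hη0.trans_le h2) h4
  have hda : ∀ {F : ℝ × ℝ → ℝ}, ContDiffOn ℝ 1 F D → ∀ p ∈ D, HasFDerivAt F (fderiv ℝ F p) p :=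
    fun hF p hp => ((hF.differentiableOn one_ne_zero).differentiableAt (hD.mem_nhds hp)).hasFDerivAt
  have hdc : ContinuousOn (fun p => fderiv ℝ f p (1, 0) + fderiv ℝ G p (0, 1)) D := by
    have h1 := hfc.continuousOn_fderiv_of_isOpen hD le_rfl
    have h2 := hGc.continuousOn_fderiv_of_isOpen hD le_rfl
    exact (h1.clm_apply continuousOn_const).add (h2.clm_apply continuousOn_const)
  have hintg : MeasureTheory.IntegrableOn (fun p => fderiv ℝ f p (1, 0) + fderiv ℝ G p (0, 1))
      (Icc ((a, η) : ℝ × ℝ) (b, δ)) := (hdc.mono hsub).integrableOn_compact isCompact_Icc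
  have hIoo : Ioo a b ×ˢ Ioo η δ ⊆ D := fun p hp =>
    hsub ⟨⟨hp.1.1.le, hp.2.1.le⟩, hp.1.2.le, hp.2.2.le⟩
  have hthm := MeasureTheory.integral_divergence_prod_Icc_of_hasFDerivAt_of_le f G (fderiv ℝ f)
    (fderiv ℝ G) (a, η) (b, δ) ⟨hab, hηδ.le⟩ (hfc.continuousOn.mono hsub) (hGc.continuousOn.mono hsub)
    (fun p hp => hda hfc p (hIoo hp)) (fun p hp => hda hGc p (hIoo hp)) hintg
  -- pointwise lower bound
  have hpt : ∀ p ∈ D, -ε ≤ fderiv ℝ f p (1, 0) + fderiv ℝ G p (0, 1) := by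
    intro p hp
    have hgd : HasFDerivAt g ((1 / (1 + (ε * U p) ^ 2)) • (ε • fderiv ℝ U p)) p :=
      ((hda hU p hp).const_mul ε).arctan
    have e1 : fderiv ℝ f p = g p • fderiv ℝ A p + A p • ((1 / (1 + (ε * U p) ^ 2)) • (ε • fderiv ℝ U p)) :=
      (hgd.mul (hda hA p hp)).fderiv
    have e2 : fderiv ℝ G p = g p • fderiv ℝ B p + B p • ((1 / (1 + (ε * U p) ^ 2)) • (ε • fderiv ℝ U p)) :=
      (hgd.mul (hda hB p hp)).fderiv
    rw [e1, e2]
    simp only [add_apply, smul_apply, smul_eq_mul]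
    have h1 := hdiv p hp
    have h2 := hmon p hp
    set q := 1 / (1 + (ε * U p) ^ 2) with hq
    have hq0 : 0 ≤ q := by positivity
    have hq1 : q ≤ 1 := by
      rw [hq, div_le_one (by positivity)]; nlinarith [sq_nonneg (ε * U p)]
    have : g p * fderiv ℝ A p (1, 0) + A p * (q * (ε * fderiv ℝ U p (1, 0))) +
        (g p * fderiv ℝ B p (0, 1) + B p * (q * (ε * fderiv ℝ U p (0, 1))))
        = q * ε * (A p * fderiv ℝ U p (1, 0) + B p * fderiv ℝ U p (0, 1)) +
          g p * (fderiv ℝ A p (1, 0) + fderiv ℝ B p (0, 1)) := by ring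
    rw [this, h1]
    have h3 : q * ε * (-1) ≤ q * ε * (A p * fderiv ℝ U p (1, 0) + B p * fderiv ℝ U p (0, 1)) :=
      mul_le_mul_of_nonneg_left h2 (by positivity)
    nlinarith
  have hlow : -(ε * C) ≤ ∫ p in Icc ((a, η) : ℝ × ℝ) (b, δ),
      (fderiv ℝ f p (1, 0) + fderiv ℝ G p (0, 1)) := by
    have hvol : MeasureTheory.volume.real (Icc ((a, η) : ℝ × ℝ) (b, δ)) ≤ C := by
      apply MeasureTheory.measureReal_mono
      · apply Icc_subset_Icc_left; exact ⟨le_rfl, hη0.le⟩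
      · exact isCompact_Icc.measure_lt_top.ne
    have h1 := MeasureTheory.setIntegral_mono_on (μ := MeasureTheory.volume)
      (f := fun _ : ℝ × ℝ => -ε) (MeasureTheory.integrableOn_const isCompact_Icc.measure_lt_top.ne)
      hintg measurableSet_Icc (fun p hp => hpt p (hsub hp))
    rw [MeasureTheory.setIntegral_const, smul_eq_mul] at h1
    nlinarith
  rw [hthm] at hlow
  simp only at hlow
  -- the sides
  have hside : ∀ c ∈ Icc a b, |∫ t in η..δ, f (c, t)| ≤ Real.pi / 2 * δ := by
    intro c hc
    have := intervalIntegral.norm_integral_le_of_norm_le_const (a := η) (b := δ)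
      (f := fun t => f (c, t)) (C := Real.pi / 2) (by
        intro t ht
        rw [uIoc_of_le hηδ.le] at ht
        have hh := memD c hc t (hη0.trans ht.1) ht.2
        rw [Real.norm_eq_abs, hf]
        simp only
        rw [abs_mul]
        have := mul_le_mul (hg1 (c, t)) (hA1 _ hh) (abs_nonneg _) (by positivity)
        linarith)
    rw [Real.norm_eq_abs, abs_of_pos (sub_pos.2 hηδ)] at this
    refine this.trans ?_
    apply mul_le_mul_of_nonneg_left _ (by positivity)
    linarith
  have htop : |∫ s in a..b, G (s, δ)| ≤ 2 * (ε * K) * (b - a) := by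
    have := intervalIntegral.norm_integral_le_of_norm_le_const (a := a) (b := b)
      (f := fun s => G (s, δ)) (C := 2 * (ε * K)) (by
        intro s hs
        rw [uIoc_of_le hab] at hs
        have hs' : s ∈ Icc a b := ⟨hs.1.le, hs.2⟩
        have hh := memD s hs' δ hδ0 le_rfl
        rw [Real.norm_eq_abs, hG]
        simp only
        rw [abs_mul, abs_of_nonneg (hB0 _ hh), mul_comm 2]
        apply mul_le_mul _ (hB2 _ hh) (hB0 _ hh) (by positivity)
        have h1 : ∀ x : ℝ, |Real.arctan x| ≤ |x| := by
          intro x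
          rcases le_total 0 x with h | h
          · rw [abs_of_nonneg h, abs_of_nonneg (Real.arctan_nonneg.2 h)]
            exact arctan_le_self' h
          · rw [abs_of_nonpos h, abs_of_nonpos (by
              rw [← neg_nonneg, ← Real.arctan_neg]; exact Real.arctan_nonneg.2 (by linarith)),
              ← Real.arctan_neg]
            exact arctan_le_self' (by linarith)
        refine (h1 _).trans ?_
        rw [abs_mul, abs_of_pos hε0]
        exact mul_le_mul_of_nonneg_left (hK s hs') hε0.le)
    rwa [Real.norm_eq_abs, abs_of_nonneg (sub_nonneg.2 hab)] at this
  have hcB : ContinuousOn (fun s : ℝ => B (s, η)) (Icc a b) :=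
    hB.continuousOn.comp (by fun_prop) (fun s hs => memD s hs η hη0 hηδ.le)
  have hcG : ContinuousOn (fun s : ℝ => G (s, η)) (Icc a b) :=
    hGc.continuousOn.comp (by fun_prop) (fun s hs => memD s hs η hη0 hηδ.le)
  have hbot : Real.pi / 4 * ∫ s in a..b, B (s, η) ≤ ∫ s in a..b, G (s, η) := by
    rw [← intervalIntegral.integral_const_mul]
    apply intervalIntegral.integral_mono_on hab
    · exact (ContinuousOn.intervalIntegrable_of_Icc hab hcB).const_mul _
    · exact ContinuousOn.intervalIntegrable_of_Icc hab hcG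
    · intro s hs
      have hh := memD s hs η hη0 hηδ.le
      apply mul_le_mul_of_nonneg_right _ (hB0 _ hh)
      rw [← Real.arctan_one]
      apply Real.arctan_strictMono.monotone
      have := hbig s hs η hη0 hητ'
      rwa [div_le_iff₀' hε0] at this
  have s1 := abs_le.1 (hside a ⟨le_rfl, hab⟩)
  have s2 := abs_le.1 (hside b ⟨hab, le_rfl⟩)
  have s3 := abs_le.1 htop
  have hfin : Real.pi / 4 * ∫ s in a..b, B (s, η) ≤ Real.pi / 4 * m := by
    have : Real.pi * δ ≤ Real.pi * (m / 8) := mul_le_mul_of_nonneg_left hδ2 hpi.le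
    nlinarith [s1.1, s1.2, s2.1, s2.2, s3.1, s3.2]
  exact le_of_mul_le_mul_left hfin (by positivity)



/-! ### Part E2: the normalized gradient and the conjugate function -/


open UnitPolygon

def Xf (u : Pt → ℝ) (p : Pt) : Pt := (Wu u p)⁻¹ • gradient u p

theorem Wu_pos (u : Pt → ℝ) (p : Pt) : 0 < Wu u p := Real.sqrt_pos.2 (by positivity)

theorem Wu_sq (u : Pt → ℝ) (p : Pt) : Wu u p ^ 2 = 1 + ‖gradient u p‖ ^ 2 :=
  Real.sq_sqrt (by positivity)

theorem Wu_gt (u : Pt → ℝ) (p : Pt) : ‖gradient u p‖ < Wu u p := by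
  have h1 := Wu_pos u p
  have h2 := Wu_sq u p
  nlinarith [norm_nonneg (gradient u p)]

theorem one_le_Wu (u : Pt → ℝ) (p : Pt) : 1 ≤ Wu u p := by
  have h1 := Wu_pos u p
  have h2 := Wu_sq u p
  nlinarith [norm_nonneg (gradient u p)]

theorem norm_Xf_lt (u : Pt → ℝ) (p : Pt) : ‖Xf u p‖ < 1 := by
  unfold Xf
  rw [norm_smul, norm_inv, Real.norm_eq_abs, abs_of_pos (Wu_pos u p), inv_mul_lt_iff₀ (Wu_pos u p),
    mul_one]
  exact Wu_gt u p

theorem contDiffOn_gradient {u : Pt → ℝ} {Ω : Set Pt} (hΩ : IsOpen Ω) (hu : ContDiffOn ℝ 2 u Ω) :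
    ContDiffOn ℝ 1 (gradient u) Ω := by
  have h1 : ContDiffOn ℝ 1 (fderiv ℝ u) Ω := hu.fderiv_of_isOpen hΩ (by norm_num)
  exact ((InnerProductSpace.toDual ℝ Pt).symm.toContinuousLinearEquiv.toContinuousLinearMap.contDiff).comp_contDiffOn h1

theorem contDiffOn_Xf {u : Pt → ℝ} {Ω : Set Pt} (hΩ : IsOpen Ω) (hu : ContDiffOn ℝ 2 u Ω) :
    ContDiffOn ℝ 1 (Xf u) Ω := by
  have hg := contDiffOn_gradient hΩ hu
  have hW : ContDiffOn ℝ 1 (Wu u) Ω := by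
    apply ContDiffOn.sqrt
    · exact contDiffOn_const.add (hg.norm_sq ℝ)
    · intro x _; positivity
  exact (hW.inv fun x _ => (Wu_pos u x).ne').smul hg

theorem inner_eq_dot2 (v w : Pt) : inner ℝ v w = dot2 v w := by
  simp [dot2, PiLp.inner_apply, Fin.sum_univ_two]; ring

theorem dot2_comm (v w : Pt) : dot2 v w = dot2 w v := by unfold dot2; ring

theorem abs_dot2_le (v w : Pt) : |dot2 v w| ≤ ‖v‖ * ‖w‖ := by
  rw [← inner_eq_dot2]; exact abs_real_inner_le_norm v w

theorem dot2_self' (v : Pt) : dot2 v v = ‖v‖ ^ 2 := by rw [pt_norm_sq]; unfold dot2; ring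

theorem fderiv_eq_dot2 (u : Pt → ℝ) (p v : Pt) : fderiv ℝ u p v = dot2 (gradient u p) v := by
  rw [← inner_eq_dot2]; unfold gradient; rw [InnerProductSpace.toDual_symm_apply]

theorem Xf_mono (u : Pt → ℝ) (p : Pt) {ν : Pt} (hν : ‖ν‖ = 1) :
    -1 ≤ dot2 (Xf u p) (gradient u p) + dot2 (gradient u p) ν := by
  have h1 := Wu_pos u p
  have h2 := Wu_sq u p
  have h3 := one_le_Wu u p
  have h4 := Wu_gt u p
  have h5 := (abs_le.1 (abs_dot2_le (gradient u p) ν)).1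
  rw [hν, mul_one] at h5
  have h6 : dot2 (Xf u p) (gradient u p) = Wu u p - (Wu u p)⁻¹ := by
    rw [dot2_comm]; unfold Xf; rw [dot2_smul_right, dot2_self']
    have : ‖gradient u p‖ ^ 2 = Wu u p ^ 2 - 1 := by linarith
    rw [this]; field_simp
  have h7 : (Wu u p)⁻¹ ≤ 1 := inv_le_one_of_one_le₀ h3
  linarith

theorem conjField_eq (u : Pt → ℝ) (p : Pt) : conjField u p = J (Xf u p) := by
  apply pt_ext
  · simp [conjField, J, Xf, vec2_zero]
  · simp [conjField, J, Xf, vec2_one]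

theorem pt_decomp (v : Pt) :
    v = v 0 • EuclideanSpace.single 0 (1:ℝ) + v 1 • EuclideanSpace.single 1 (1:ℝ) := by
  apply pt_ext <;> simp

/-- trace identities for a linear endomorphism of the plane -/
theorem trace_rot (L : Pt →L[ℝ] Pt) (h : L (EuclideanSpace.single 0 1) 0 + L (EuclideanSpace.single 1 1) 1 = 0)
    (e : Pt) : dot2 (L e) e + dot2 (L (J e)) (J e) = 0 := by
  have h1 : L e = e 0 • L (EuclideanSpace.single 0 1) + e 1 • L (EuclideanSpace.single 1 1) := by
    conv_lhs => rw [pt_decomp e]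
    simp
  have h2 : L (J e) = (-e 1) • L (EuclideanSpace.single 0 1) + e 0 • L (EuclideanSpace.single 1 1) := by
    conv_lhs => rw [pt_decomp (J e)]
    simp [J, vec2_zero, vec2_one]
  rw [h1, h2]
  simp only [dot2, J, vec2_zero, vec2_one, PiLp.add_apply, PiLp.smul_apply, smul_eq_mul]
  linear_combination (e 0 ^ 2 + e 1 ^ 2) * h

theorem symm_rot (L : Pt →L[ℝ] Pt) (h : L (EuclideanSpace.single 0 1) 0 + L (EuclideanSpace.single 1 1) 1 = 0)
    (x y : Pt) : dot2 (J (L x)) y = dot2 (J (L y)) x := by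
  have h1 : ∀ e : Pt, L e = e 0 • L (EuclideanSpace.single 0 1) + e 1 • L (EuclideanSpace.single 1 1) := by
    intro e
    conv_lhs => rw [pt_decomp e]
    simp
  rw [h1 x, h1 y]
  simp only [dot2, J, vec2_zero, vec2_one, PiLp.add_apply, PiLp.smul_apply, smul_eq_mul]
  linear_combination (x 0 * y 1 - x 1 * y 0) * h

def JL : Pt →L[ℝ] Pt := LinearMap.toContinuousLinearMap
  { toFun := J
    map_add' := fun x y => by apply pt_ext <;> simp [J, vec2_zero, vec2_one]; ring
    map_smul' := fun c x => by apply pt_ext <;> simp [J, vec2_zero, vec2_one] }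

theorem JL_apply (v : Pt) : JL v = J v := rfl

theorem exists_conj {Ω : Set Pt} (hc : Convex ℝ Ω) {u : Pt → ℝ} (hu : MinimalGraph Ω u) :
    ∃ ψ : Pt → ℝ, LipschitzWith 1 ψ ∧ ∀ p ∈ Ω, HasFDerivAt ψ (innerSL ℝ (J (Xf u p))) p := by
  obtain ⟨hΩ, hu2, hdiv⟩ := hu
  have hX := contDiffOn_Xf hΩ hu2
  have hXd : ∀ p ∈ Ω, HasFDerivAt (Xf u) (fderiv ℝ (Xf u) p) p := fun p hp =>
    ((hX.differentiableOn one_ne_zero).differentiableAt (hΩ.mem_nhds hp)).hasFDerivAt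
  set ω : Pt → Pt →L[ℝ] ℝ := fun p => innerSL ℝ (J (Xf u p)) with hω
  have hωd : ∀ p ∈ Ω, HasFDerivAt ω (((innerSL ℝ : Pt →L[ℝ] Pt →L[ℝ] ℝ) ∘L JL) ∘L fderiv ℝ (Xf u) p) p := by
    intro p hp
    exact ((innerSL ℝ : Pt →L[ℝ] Pt →L[ℝ] ℝ) ∘L JL).hasFDerivAt.comp p (hXd p hp)
  obtain ⟨f, hf⟩ := hc.exists_forall_hasFDerivAt_of_fderiv_symmetric (ω := ω) hΩ
    (fun p hp => (hωd p hp).differentiableAt.differentiableWithinAt) (by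
      intro a ha x y
      rw [(hωd a ha).fderiv]
      change inner ℝ (J (fderiv ℝ (Xf u) a x)) y = inner ℝ (J (fderiv ℝ (Xf u) a y)) x
      rw [inner_eq_dot2, inner_eq_dot2]
      apply symm_rot
      have := hdiv a ha
      rw [Fin.sum_univ_two] at this
      exact this)
  have hlip : LipschitzOnWith 1 f Ω := by
    apply Convex.lipschitzOnWith_of_nnnorm_hasFDerivWithin_le (𝕜 := ℝ) (f' := ω)
      (fun x hx => (hf x hx).hasFDerivWithinAt) _ hc
    intro x hx
    have : ‖ω x‖ ≤ 1 := by
      rw [hω]; simp only [innerSL_apply_norm, norm_J]; exact (norm_Xf_lt u x).le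
    exact_mod_cast this
  obtain ⟨ψ, h1, h2⟩ := hlip.extend_real
  refine ⟨ψ, h1, fun p hp => ?_⟩
  exact (hf p hp).congr_of_eventuallyEq
    (Filter.eventually_of_mem (hΩ.mem_nhds hp) (fun q hq => (h2 hq).symm))



/-! ### Part E3: the conjugate function along an edge -/

namespace UnitPolygon

variable {n : ℕ} (P : UnitPolygon n)

/-- coordinates adapted to an edge -/
def Lam (k : ZMod (2 * n)) (p : ℝ × ℝ) : Pt := P.vtx k + (p.1 • P.e k + p.2 • J (P.e k))

def LamL (k : ZMod (2 * n)) : ℝ × ℝ →L[ℝ] Pt :=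
  (ContinuousLinearMap.fst ℝ ℝ ℝ).smulRight (P.e k) + (ContinuousLinearMap.snd ℝ ℝ ℝ).smulRight (J (P.e k))

theorem Lam_eq (k : ZMod (2 * n)) (p : ℝ × ℝ) : P.Lam k p = P.vtx k + P.LamL k p := rfl

theorem hasFDerivAt_Lam (k : ZMod (2 * n)) (p : ℝ × ℝ) : HasFDerivAt (P.Lam k) (P.LamL k) p :=
  (P.LamL k).hasFDerivAt.const_add (P.vtx k)

theorem contDiff_Lam (k : ZMod (2 * n)) : ContDiff ℝ 2 (P.Lam k) :=
  contDiff_const.add (P.LamL k).contDiff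

theorem continuous_Lam (k : ZMod (2 * n)) : Continuous (P.Lam k) := (P.contDiff_Lam k).continuous

theorem LamL_fst (k : ZMod (2 * n)) : P.LamL k (1, 0) = P.e k := by simp [LamL]
theorem LamL_snd (k : ZMod (2 * n)) : P.LamL k (0, 1) = J (P.e k) := by simp [LamL]

theorem Lam_mem_openSegment (k : ZMod (2 * n)) {s : ℝ} (h0 : 0 < s) (h1 : s < 1) :
    P.Lam k (s, 0) ∈ openSegment ℝ (P.vtx k) (P.vtx (k + 1)) := by
  rw [openSegment_eq_image']
  exact ⟨s, ⟨h0, h1⟩, by simp [Lam, e]⟩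

theorem Lam_mem (k : ZMod (2 * n)) {s : ℝ} (h0 : 0 < s) (h1 : s < 1) :
    ∀ᶠ z : ℝ × ℝ in 𝓝 (0, s), 0 < z.1 → P.Lam k (z.2, z.1) ∈ P.Ω := by
  obtain ⟨y, hy⟩ := P.nonempty
  have hyt := P.edge_pos k y hy
  set yt := cross2 (P.e k) (y - P.vtx k) with hyt'
  set ys := dot2 (P.e k) (y - P.vtx k) with hys'
  have hyd : y = P.vtx k + (ys • P.e k + yt • J (P.e k)) := by
    have hu := unit_sq (P.norm_e k)
    apply pt_ext
    · simp only [hys', hyt', J, dot2, cross2, PiLp.add_apply, PiLp.smul_apply, PiLp.sub_apply, smul_eq_mul,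
        vec2_zero]
      linear_combination -(y 0 - P.vtx k 0) * hu
    · simp only [hys', hyt', J, dot2, cross2, PiLp.add_apply, PiLp.smul_apply, PiLp.sub_apply, smul_eq_mul,
        vec2_one]
      linear_combination -(y 1 - P.vtx k 1) * hu
  have hc : ContinuousAt (fun z : ℝ × ℝ => (z.2 - z.1 / yt * ys) / (1 - z.1 / yt)) (0, s) := by
    apply ContinuousAt.div
    · fun_prop
    · fun_prop
    · simp
  have hl : ContinuousAt (fun z : ℝ × ℝ => z.1 / yt) (0, s) := by fun_prop
  have e1 := hc.eventually_mem (Ioo_mem_nhds (a := 0) (b := 1) (by simpa using h0) (by simpa using h1))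
  have e2 := hl.eventually_mem (Iio_mem_nhds (show (0:ℝ) / yt < 1 by rw [zero_div]; exact one_pos))
  filter_upwards [e1, e2] with z hz1 hz2 hz
  have hz2' : z.1 / yt < 1 := hz2
  set l := z.1 / yt with hldef
  set s' := (z.2 - l * ys) / (1 - l) with hs'
  have hl0 : 0 < l := div_pos hz hyt
  have hmem : P.vtx k + s' • P.e k ∈ closure P.Ω := by
    apply frontier_subset_closure
    apply P.seg_sub_frontier k
    apply openSegment_subset_segment
    have := P.Lam_mem_openSegment k hz1.1 hz1.2
    simpa [Lam] using this
  have := P.convex.combo_interior_closure_mem_interior (by rwa [P.isOpen.interior_eq]) hmem hl0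
    (by linarith : 0 ≤ 1 - l) (by ring) (x := y)
  rw [P.isOpen.interior_eq] at this
  convert this using 1
  have hA : (1 - l) * s' = z.2 - l * ys := by
    rw [hs']; field_simp [(by linarith : (1 - l) ≠ 0)]
  have hB : l * yt = z.1 := by rw [hldef]; field_simp
  unfold Lam
  rw [← hB, (by linarith : z.2 = (1 - l) * s' + l * ys)]
  clear_value ys yt l s'
  rw [hyd]
  module

theorem edge_ge (k : ZMod (2 * n)) {u ψ : Pt → ℝ} (hu : MinimalGraph P.Ω u) (hψ : LipschitzWith 1 ψ)
    (hd : ∀ p ∈ P.Ω, HasFDerivAt ψ (innerSL ℝ (J (Xf u p))) p)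
    (hinf : ∀ t ∈ openSegment ℝ (P.vtx k) (P.vtx (k + 1)), Tendsto u (𝓝[P.Ω] t) atTop) :
    1 ≤ ψ (P.vtx (k + 1)) - ψ (P.vtx k) := by
  obtain ⟨hΩ, hu2, hdiv⟩ := hu
  set e := P.e k with he
  have hen : ‖e‖ = 1 := P.norm_e k
  have hνn : ‖J e‖ = 1 := by rw [norm_J, hen]
  have hX := contDiffOn_Xf hΩ hu2
  set D := P.Lam k ⁻¹' P.Ω with hDdef
  have hD : IsOpen D := hΩ.preimage (P.continuous_Lam k)
  set U : ℝ × ℝ → ℝ := fun p => u (P.Lam k p) with hUdef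
  set A : ℝ × ℝ → ℝ := fun p => innerSL ℝ e (Xf u (P.Lam k p)) with hAdef
  set B : ℝ × ℝ → ℝ := fun p => 1 + innerSL ℝ (J e) (Xf u (P.Lam k p)) with hBdef
  have hmaps : MapsTo (P.Lam k) D P.Ω := fun p hp => hp
  have hU : ContDiffOn ℝ 1 U D :=
    (hu2.of_le (by norm_num)).comp (((P.contDiff_Lam k).of_le (by norm_num)).contDiffOn) hmaps
  have hXL : ContDiffOn ℝ 1 (fun p => Xf u (P.Lam k p)) D :=
    hX.comp (((P.contDiff_Lam k).of_le (by norm_num)).contDiffOn) hmaps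
  have hA : ContDiffOn ℝ 1 A D := (innerSL ℝ e).contDiff.comp_contDiffOn hXL
  have hB : ContDiffOn ℝ 1 B D := contDiffOn_const.add ((innerSL ℝ (J e)).contDiff.comp_contDiffOn hXL)
  have hXd : ∀ p ∈ P.Ω, HasFDerivAt (Xf u) (fderiv ℝ (Xf u) p) p := fun p hp =>
    ((hX.differentiableOn one_ne_zero).differentiableAt (hΩ.mem_nhds hp)).hasFDerivAt
  have hud : ∀ p ∈ P.Ω, HasFDerivAt u (fderiv ℝ u p) p := fun p hp =>
    ((hu2.differentiableOn two_ne_zero).differentiableAt (hΩ.mem_nhds hp)).hasFDerivAt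
  have hXLd : ∀ p ∈ D, HasFDerivAt (fun p => Xf u (P.Lam k p))
      (fderiv ℝ (Xf u) (P.Lam k p) ∘L P.LamL k) p := fun p hp =>
    (hXd _ hp).comp p (P.hasFDerivAt_Lam k p)
  have hAB : ∀ p, |A p| < 1 ∧ |B p - 1| < 1 := by
    intro p
    have hlt := norm_Xf_lt u (P.Lam k p)
    constructor
    · change |inner ℝ e (Xf u (P.Lam k p))| < 1
      have := abs_real_inner_le_norm e (Xf u (P.Lam k p))
      rw [hen] at this; linarith
    · change |1 + inner ℝ (J e) (Xf u (P.Lam k p)) - 1| < 1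
      rw [add_sub_cancel_left]
      have := abs_real_inner_le_norm (J e) (Xf u (P.Lam k p))
      rw [hνn] at this; linarith
  have hdivD : ∀ p ∈ D, fderiv ℝ A p (1, 0) + fderiv ℝ B p (0, 1) = 0 := by
    intro p hp
    have hA' : fderiv ℝ A p = innerSL ℝ e ∘L (fderiv ℝ (Xf u) (P.Lam k p) ∘L P.LamL k) :=
      ((innerSL ℝ e).hasFDerivAt.comp p (hXLd p hp)).fderiv
    have hB' : fderiv ℝ B p = innerSL ℝ (J e) ∘L (fderiv ℝ (Xf u) (P.Lam k p) ∘L P.LamL k) :=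
      (((innerSL ℝ (J e)).hasFDerivAt.comp p (hXLd p hp)).const_add 1).fderiv
    rw [hA', hB']
    simp only [ContinuousLinearMap.comp_apply, LamL_fst, LamL_snd]
    change inner ℝ e _ + inner ℝ (J e) _ = 0
    rw [inner_eq_dot2, inner_eq_dot2, dot2_comm, dot2_comm (J e)]
    apply trace_rot
    have := hdiv _ hp
    rw [Fin.sum_univ_two] at this
    exact this
  have hmon : ∀ p ∈ D, -1 ≤ A p * fderiv ℝ U p (1, 0) + B p * fderiv ℝ U p (0, 1) := by
    intro p hp
    have hU' : fderiv ℝ U p = fderiv ℝ u (P.Lam k p) ∘L P.LamL k :=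
      ((hud _ hp).comp p (P.hasFDerivAt_Lam k p)).fderiv
    rw [hU']
    simp only [ContinuousLinearMap.comp_apply, LamL_fst, LamL_snd]
    rw [fderiv_eq_dot2, fderiv_eq_dot2]
    change -1 ≤ inner ℝ e (Xf u (P.Lam k p)) * _ + (1 + inner ℝ (J e) (Xf u (P.Lam k p))) * _
    rw [inner_eq_dot2, inner_eq_dot2]
    have h1 := Xf_mono u (P.Lam k p) hνn
    have hu := unit_sq hen
    refine h1.trans (le_of_eq ?_)
    rw [← he]
    simp only [J, dot2, vec2_zero, vec2_one]
    linear_combination (-(Xf u (P.Lam k p) 0 * gradient u (P.Lam k p) 0 + Xf u (P.Lam k p) 1 * gradient u (P.Lam k p) 1)) * hu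
  -- epsilon argument
  refine le_of_forall_pos_le_add fun ε hε => ?_
  set m := min (ε / 7) (1 / 3) with hm
  have hm0 : 0 < m := lt_min (by positivity) (by norm_num)
  have hm1 : 7 * m ≤ ε := by have := min_le_left (ε / 7) (1 / 3); linarith
  have hm2 : m ≤ 1 / 3 := min_le_right _ _
  have hin : ∀ s ∈ Icc m (1 - m), 0 < s ∧ s < 1 := fun s hs => ⟨by linarith [hs.1], by linarith [hs.2]⟩
  have c1 : ∀ᶠ t in 𝓝 (0 : ℝ), ∀ s ∈ Icc m (1 - m), 0 < t → P.Lam k (s, t) ∈ P.Ω :=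
    isCompact_Icc.eventually_forall_of_forall_eventually fun s hs =>
      P.Lam_mem k (hin s hs).1 (hin s hs).2
  obtain ⟨δ₁, hδ₁, hball⟩ := Metric.eventually_nhds_iff.1 c1
  have hlip : ∀ p q : Pt, |ψ p - ψ q| ≤ ‖p - q‖ := by
    intro p q
    have := hψ.dist_le_mul p q
    rw [NNReal.coe_one, one_mul, Real.dist_eq, dist_eq_norm] at this
    exact this
  obtain ⟨η, hη0, hηm, hηδ, hintg⟩ := flux_core (U := U) (A := A) (B := B) hD (a := m) (b := 1 - m)
    (δ₀ := δ₁ / 2) (by linarith) (by positivity)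
    (by
      rintro ⟨s, t⟩ ⟨hs, ht0, ht1⟩
      refine hball ?_ s hs ht0
      simp only at ht0 ht1
      rw [Real.dist_eq, sub_zero, abs_of_pos ht0]
      linarith)
    hU hA hB hdivD (fun p _ => (hAB p).1.le) (fun p _ => by linarith [(abs_lt.1 (hAB p).2).1])
    (fun p _ => by linarith [(abs_lt.1 (hAB p).2).2]) hmon
    (by
      intro M
      have c2 : ∀ᶠ t in 𝓝 (0 : ℝ), ∀ s ∈ Icc m (1 - m), 0 < t → M ≤ u (P.Lam k (s, t)) := by
        apply isCompact_Icc.eventually_forall_of_forall_eventually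
        intro s hs
        have h1 := P.Lam_mem k (hin s hs).1 (hin s hs).2
        have h2 := (hinf _ (P.Lam_mem_openSegment k (hin s hs).1 (hin s hs).2)).eventually_ge_atTop M
        rw [eventually_nhdsWithin_iff] at h2
        have hcont : Continuous (fun z : ℝ × ℝ => P.Lam k (z.2, z.1)) :=
          (P.continuous_Lam k).comp (by fun_prop)
        have h3 := (hcont.tendsto (0, s)).eventually h2
        filter_upwards [h1, h3] with z hz1 hz2 hz
        exact hz2 (hz1 hz)
      obtain ⟨τ, hτ, hb⟩ := Metric.eventually_nhds_iff.1 c2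
      refine ⟨τ, hτ, fun s hs t ht0 ht1 => hb ?_ s hs ht0⟩
      rw [Real.dist_eq, sub_zero, abs_of_pos ht0]
      exact ht1)
    hm0 hm0
  have hηD : ∀ s ∈ Icc m (1 - m), P.Lam k (s, η) ∈ P.Ω := fun s hs => by
    refine hball ?_ s hs hη0
    rw [Real.dist_eq, sub_zero, abs_of_pos hη0]
    linarith
  have hle : m ≤ 1 - m := by linarith
  have hftc : ∫ s in m..(1 - m), B (s, η) =
      ((1 - m) - ψ (P.Lam k (1 - m, η))) - (m - ψ (P.Lam k (m, η))) := by
    apply intervalIntegral.integral_eq_sub_of_hasDerivAt (f := fun s => s - ψ (P.Lam k (s, η)))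
    · intro s hs
      rw [uIcc_of_le hle] at hs
      have hp := hηD s hs
      have h1 : HasDerivAt (fun s : ℝ => ((s, η) : ℝ × ℝ)) (1, 0) s :=
        (hasDerivAt_id s).prodMk (hasDerivAt_const s η)
      have h2 := ((hd _ hp).comp _ (P.hasFDerivAt_Lam k (s, η))).comp_hasDerivAt s h1
      have h3 := (hasDerivAt_id s).sub h2
      suffices h4 : B (s, η) = 1 - (innerSL ℝ (J (Xf u (P.Lam k (s, η)))) ∘L P.LamL k) (1, 0) by
        rw [h4]; exact h3
      rw [ContinuousLinearMap.comp_apply, LamL_fst]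
      change 1 + inner ℝ (J e) _ = 1 - inner ℝ (J _) e
      rw [inner_eq_dot2, inner_eq_dot2]
      simp only [J, dot2, vec2_zero, vec2_one]
      ring
    · apply ContinuousOn.intervalIntegrable_of_Icc hle
      exact hB.continuousOn.comp (by fun_prop) (fun s hs => hηD s hs)
  rw [hftc] at hintg
  have d1 : |ψ (P.Lam k (1 - m, η)) - ψ (P.vtx (k + 1))| ≤ m + η := by
    refine (hlip _ _).trans ?_
    have : P.Lam k (1 - m, η) - P.vtx (k + 1) = (-m) • e + η • J e := by
      have : P.vtx (k + 1) = P.vtx k + e := by rw [he, UnitPolygon.e]; abel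
      rw [this, Lam]; module
    rw [this]
    refine (norm_add_le _ _).trans ?_
    rw [norm_smul, norm_smul, hen, hνn, norm_neg, Real.norm_eq_abs, Real.norm_eq_abs, abs_of_pos hm0, abs_of_pos hη0]
    linarith
  have d2 : |ψ (P.Lam k (m, η)) - ψ (P.vtx k)| ≤ m + η := by
    refine (hlip _ _).trans ?_
    have : P.Lam k (m, η) - P.vtx k = m • e + η • J e := by
      rw [Lam]; module
    rw [this]
    refine (norm_add_le _ _).trans ?_
    rw [norm_smul, norm_smul, hen, hνn, Real.norm_eq_abs, Real.norm_eq_abs, abs_of_pos hm0, abs_of_pos hη0]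
    linarith
  have d1' := abs_le.1 d1
  have d2' := abs_le.1 d2
  linarith [d1'.1, d1'.2, d2'.1, d2'.2]

theorem Xf_neg (u : Pt → ℝ) (p : Pt) : Xf (fun q => -u q) p = -Xf u p := by
  have hg : gradient (fun q => -u q) p = - gradient u p := by
    unfold gradient
    rw [fderiv_fun_neg, map_neg]
  unfold Xf Wu
  rw [hg, norm_neg, smul_neg]

theorem minimalGraph_neg {Ω : Set Pt} {u : Pt → ℝ} (hu : MinimalGraph Ω u) :
    MinimalGraph Ω (fun q => -u q) := by
  obtain ⟨h1, h2, h3⟩ := hu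
  refine ⟨h1, h2.neg, fun p hp => ?_⟩
  have : (fun q => (Wu (fun q => -u q) q)⁻¹ • gradient (fun q => -u q) q)
      = fun q => -((Wu u q)⁻¹ • gradient u q) := by
    funext q; exact Xf_neg u q
  rw [this, fderiv_fun_neg]
  have := h3 p hp
  rw [Fin.sum_univ_two] at this ⊢
  simp only [neg_apply, PiLp.neg_apply]
  linarith

theorem edge_le (k : ZMod (2 * n)) {u ψ : Pt → ℝ} (hu : MinimalGraph P.Ω u) (hψ : LipschitzWith 1 ψ)
    (hd : ∀ p ∈ P.Ω, HasFDerivAt ψ (innerSL ℝ (J (Xf u p))) p)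
    (hinf : ∀ t ∈ openSegment ℝ (P.vtx k) (P.vtx (k + 1)), Tendsto u (𝓝[P.Ω] t) atBot) :
    ψ (P.vtx (k + 1)) - ψ (P.vtx k) ≤ -1 := by
  have := P.edge_ge k (u := fun q => -u q) (ψ := fun q => -ψ q) (minimalGraph_neg hu) hψ.neg
    (by
      intro p hp
      have h := (hd p hp).neg
      rw [Xf_neg, ← JL_apply, map_neg, map_neg, JL_apply]
      exact h)
    (fun t ht => tendsto_neg_atBot_atTop.comp (hinf t ht))
  linarith

end UnitPolygon



/-! ### Part E4: special polygons carry no Jenkins–Serrin graph -/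

namespace UnitPolygon

variable {n : ℕ} (P : UnitPolygon n)

def PF (q v w : Pt) : Prop := ∀ x, x ∈ frontier P.Ω ↔ ∃ α β : ℝ, 0 ≤ α ∧ α ≤ 1 ∧ 0 ≤ β ∧ β ≤ 1 ∧
  x = q + (α • v + β • w) ∧ (α = 0 ∨ α = 1 ∨ β = 0 ∨ β = 1)

theorem PF_flip {q v w : Pt} (h : P.PF q v w) : P.PF (q + v) (-v) w := by
  intro x
  rw [h x]
  constructor
  · rintro ⟨α, β, h1, h2, h3, h4, rfl, h5⟩
    refine ⟨1 - α, β, by linarith, by linarith, h3, h4, by module, ?_⟩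
    rcases h5 with h | h | h | h
    · right; left; rw [h]; ring
    · left; rw [h]; ring
    · simp [h]
    · simp [h]
  · rintro ⟨α, β, h1, h2, h3, h4, rfl, h5⟩
    refine ⟨1 - α, β, by linarith, by linarith, h3, h4, by module, ?_⟩
    rcases h5 with h | h | h | h
    · right; left; rw [h]; ring
    · left; rw [h]; ring
    · simp [h]
    · simp [h]

theorem coord_unique {v w : Pt} (hvw : cross2 v w ≠ 0) {q : Pt} {a b c d : ℝ}
    (h : q + (a • v + b • w) = q + (c • v + d • w)) : a = c ∧ b = d := by
  have h' := add_left_cancel h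
  have h0 := congrArg (fun x : Pt => x 0) h'
  have h1 := congrArg (fun x : Pt => x 1) h'
  simp only [PiLp.add_apply, PiLp.smul_apply, smul_eq_mul] at h0 h1
  unfold cross2 at hvw
  constructor
  · have : (a - c) * (v 0 * w 1 - v 1 * w 0) = 0 := by linear_combination w 1 * h0 - w 0 * h1
    exact sub_eq_zero.1 ((mul_eq_zero.1 this).resolve_right hvw)
  · have : (b - d) * (v 0 * w 1 - v 1 * w 0) = 0 := by linear_combination v 0 * h1 - v 1 * h0
    exact sub_eq_zero.1 ((mul_eq_zero.1 this).resolve_right hvw)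

theorem PF_of {q v w : Pt} (h : frontier P.Ω = segment ℝ q (q + v) ∪ segment ℝ (q + v) (q + v + w) ∪
      segment ℝ (q + v + w) (q + w) ∪ segment ℝ (q + w) q) : P.PF q v w := by
  intro x
  rw [h]
  simp only [mem_union, segment_eq_image', mem_image, mem_Icc]
  constructor
  · rintro (((⟨t, ⟨h0, h1⟩, rfl⟩ | ⟨t, ⟨h0, h1⟩, rfl⟩) | ⟨t, ⟨h0, h1⟩, rfl⟩) | ⟨t, ⟨h0, h1⟩, rfl⟩)
    · exact ⟨t, 0, h0, h1, le_rfl, zero_le_one, by module, by simp⟩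
    · exact ⟨1, t, zero_le_one, le_rfl, h0, h1, by module, by simp⟩
    · exact ⟨1 - t, 1, by linarith, by linarith, zero_le_one, le_rfl, by module, by simp⟩
    · exact ⟨0, 1 - t, le_rfl, zero_le_one, by linarith, by linarith, by module, by simp⟩
  · rintro ⟨α, β, h1, h2, h3, h4, rfl, rfl | rfl | rfl | rfl⟩
    · right; exact ⟨1 - β, ⟨by linarith, by linarith⟩, by module⟩
    · left; left; right; exact ⟨β, ⟨h3, h4⟩, by module⟩
    · left; left; left; exact ⟨α, ⟨h1, h2⟩, by module⟩
    · left; right; exact ⟨1 - α, ⟨by linarith, by linarith⟩, by module⟩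

theorem PF_indep {q v w : Pt} (h : P.PF q v w) (hv : ‖v‖ = 1) : cross2 v w ≠ 0 := by
  intro h0
  have hl : ∀ k, cross2 v (P.vtx k - q) = 0 := by
    intro k
    obtain ⟨α, β, -, -, -, -, hx, -⟩ := (h _).1 (P.vtx_mem_frontier k)
    rw [hx, add_sub_cancel_left, cross2_add_right, cross2_smul_right, cross2_smul_right, cross2_self, h0]
    ring
  have he : ∀ k, cross2 v (P.e k) = 0 := by
    intro k
    have : P.e k = (P.vtx (k + 1) - q) - (P.vtx k - q) := by unfold e; abel
    rw [this, cross2_sub_right, hl, hl, sub_zero]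
  obtain ⟨k, hk⟩ := P.exists_cross_pos
  have h1 := he k
  have h2 := he (k + 1)
  rcases unit_parallel hv (P.norm_e k) h1 with h3 | h3
  · rw [h3, h2] at hk; exact lt_irrefl _ hk
  · rw [h3, cross2_neg_left, h2, neg_zero] at hk; exact lt_irrefl _ hk

theorem nbr {q v w : Pt} {L : ℝ} (h : P.PF q v w) (hv : ‖v‖ = 1) (hw : ‖w‖ = L) (hL : 1 < L)
    {x : Pt} (hx : ‖x - q‖ = 1) (hseg : segment ℝ q x ⊆ frontier P.Ω) :
    x = q + v ∨ x = q + L⁻¹ • w := by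
  have hind := P.PF_indep h hv
  obtain ⟨α, β, a0, a1, b0, b1, rfl, -⟩ := (h x).1 (hseg (right_mem_segment ℝ q x))
  have hmid : q + ((α / 2) • v + (β / 2) • w) ∈ frontier P.Ω := by
    apply hseg
    rw [segment_eq_image']
    exact ⟨1 / 2, ⟨by norm_num, by norm_num⟩, by module⟩
  obtain ⟨α', β', -, -, -, -, he, hor⟩ := (h _).1 hmid
  obtain ⟨h1, h2⟩ := coord_unique hind he
  rw [add_sub_cancel_left] at hx
  have hor' : α = 0 ∨ β = 0 := by
    rcases hor with h | h | h | h
    · left; linarith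
    · linarith
    · right; linarith
    · linarith
  rcases hor' with rfl | rfl
  · right
    rw [zero_smul, zero_add, norm_smul, hw, Real.norm_eq_abs, abs_of_nonneg b0] at hx
    rw [zero_smul, zero_add, eq_inv_of_mul_eq_one_left hx]
  · left
    rw [zero_smul, add_zero, norm_smul, hv, mul_one, Real.norm_eq_abs, abs_of_nonneg a0] at hx
    rw [hx]; module

theorem corner_nbrs {q v w : Pt} {L : ℝ} (h : P.PF q v w) (hv : ‖v‖ = 1) (hw : ‖w‖ = L) (hL : 1 < L)
    {i : ZMod (2 * n)} (hi : P.vtx i = q) :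
    (P.vtx (i + 1) = q + v ∧ P.vtx (i - 1) = q + L⁻¹ • w) ∨
    (P.vtx (i + 1) = q + L⁻¹ • w ∧ P.vtx (i - 1) = q + v) := by
  have h1 := P.nbr h hv hw hL (x := P.vtx (i + 1)) (by
    rw [← hi]; exact P.norm_e i) (by rw [← hi]; exact P.seg_sub_frontier i)
  have h2 := P.nbr h hv hw hL (x := P.vtx (i - 1)) (by
    rw [← hi, norm_sub_rev]; have := P.norm_e (i - 1); unfold e at this; rwa [sub_add_cancel] at this) (by
    rw [← hi, segment_symm]; have := P.seg_sub_frontier (i - 1); rwa [sub_add_cancel] at this)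
  have hne : P.vtx (i + 1) ≠ P.vtx (i - 1) := by
    intro hh
    have := P.inj hh
    apply P.two_ne_zero'
    linear_combination this
  rcases h1 with h1 | h1 <;> rcases h2 with h2 | h2
  · exact absurd (h1.trans h2.symm) hne
  · exact Or.inl ⟨h1, h2⟩
  · exact Or.inr ⟨h1, h2⟩
  · exact absurd (h1.trans h2.symm) hne

theorem corner_vtx {q v w : Pt} (h : P.PF q v w) (hv : ‖v‖ = 1) : ∃ i, P.vtx i = q := by
  have hind := P.PF_indep h hv
  have hq : q ∈ frontier P.Ω := (h q).2 ⟨0, 0, le_rfl, zero_le_one, le_rfl, zero_le_one, by simp, by simp⟩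
  rw [P.frontier_eq, mem_iUnion] at hq
  obtain ⟨i, hqi⟩ := hq
  rw [segment_eq_image] at hqi
  obtain ⟨s, ⟨h0, h1⟩, hs⟩ := hqi
  simp only at hs
  obtain ⟨α, β, a0, a1, b0, b1, hx, -⟩ := (h _).1 (P.vtx_mem_frontier i)
  obtain ⟨α', β', a0', a1', b0', b1', hx', -⟩ := (h _).1 (P.vtx_mem_frontier (i + 1))
  rcases h0.eq_or_lt with rfl | h0
  · exact ⟨i, by simpa using hs⟩
  rcases h1.eq_or_lt with rfl | h1
  · exact ⟨i + 1, by simpa using hs⟩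
  have : q + (((1 - s) * α + s * α') • v + ((1 - s) * β + s * β') • w) = q + ((0:ℝ) • v + (0:ℝ) • w) := by
    rw [hx, hx'] at hs
    rw [zero_smul, zero_smul, add_zero, add_zero]
    conv_rhs => rw [← hs]
    module
  obtain ⟨e1, e2⟩ := coord_unique hind this
  have z1 : α = 0 := by nlinarith [mul_nonneg h0.le a0', mul_nonneg (by linarith : 0 ≤ 1 - s) a0]
  have z2 : β = 0 := by nlinarith [mul_nonneg h0.le b0', mul_nonneg (by linarith : 0 ≤ 1 - s) b0]
  exact ⟨i, by rw [hx, z1, z2]; simp⟩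

theorem special_chord (hs : P.IsSpecial) : ∃ j : ZMod (2 * n),
    ‖P.vtx (j + 2) - P.vtx (j - 1)‖ = 1 ∧
    P.vtx (j - 1) + (1 / 2 : ℝ) • (P.vtx (j + 2) - P.vtx (j - 1)) ∈ P.Ω := by
  obtain ⟨hn, q, v, w, hv, hw, hF⟩ := hs
  have hn' : (3 : ℝ) ≤ n := by exact_mod_cast hn
  set L : ℝ := (n : ℝ) - 1 with hLdef
  have hL : 1 < L := by linarith
  have hL2 : 2 ≤ L := by linarith
  have hPF := P.PF_of hF
  have hind := P.PF_indep hPF hv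
  obtain ⟨i, hi⟩ := P.corner_vtx hPF hv
  have hvn : ‖-v‖ = 1 := by rw [norm_neg, hv]
  have hPF' := P.PF_flip hPF
  have hLi0 : 0 < L⁻¹ := by positivity
  have hLi1 : L⁻¹ < 1 := inv_lt_one_of_one_lt₀ hL
  have hv0 : v ≠ 0 := by rintro rfl; simp at hv
  -- the midpoint of the chord lies in the interior
  have hfin : ∀ a b : ZMod (2 * n), (P.vtx a = q + L⁻¹ • w ∧ P.vtx b = q + v + L⁻¹ • w) ∨
      (P.vtx b = q + L⁻¹ • w ∧ P.vtx a = q + v + L⁻¹ • w) →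
      ‖P.vtx b - P.vtx a‖ = 1 ∧ P.vtx a + (1 / 2 : ℝ) • (P.vtx b - P.vtx a) ∈ P.Ω := by
    intro a b hab
    have hm : P.vtx a + (1 / 2 : ℝ) • (P.vtx b - P.vtx a) = q + ((1 / 2 : ℝ) • v + L⁻¹ • w) := by
      rcases hab with ⟨h1, h2⟩ | ⟨h1, h2⟩ <;> rw [h1, h2] <;> module
    constructor
    · rcases hab with ⟨h1, h2⟩ | ⟨h1, h2⟩
      · rw [h1, h2, show q + v + L⁻¹ • w - (q + L⁻¹ • w) = v by abel, hv]
      · rw [h1, h2, show q + L⁻¹ • w - (q + v + L⁻¹ • w) = -v by abel, hvn]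
    · have hcl : P.vtx a + (1 / 2 : ℝ) • (P.vtx b - P.vtx a) ∈ closure P.Ω := by
        have := P.convex.closure.segment_subset (P.vtx_mem_closure a) (P.vtx_mem_closure b)
        apply this
        rw [segment_eq_image']
        exact ⟨1 / 2, ⟨by norm_num, by norm_num⟩, rfl⟩
      by_contra hno
      have hfr : P.vtx a + (1 / 2 : ℝ) • (P.vtx b - P.vtx a) ∈ frontier P.Ω := by
        rw [P.isOpen.frontier_eq]; exact ⟨hcl, hno⟩
      rw [hm] at hfr
      obtain ⟨α, β, -, -, -, -, hx, hor⟩ := (hPF _).1 hfr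
      obtain ⟨h1, h2⟩ := coord_unique hind hx
      rcases hor with h | h | h | h <;> linarith
  rcases P.corner_nbrs hPF hv hw hL hi with ⟨h1, h2⟩ | ⟨h1, h2⟩
  · refine ⟨i, hfin _ _ (Or.inl ⟨h2, ?_⟩)⟩
    have := P.corner_nbrs hPF' hvn hw hL h1
    rw [add_sub_cancel_right, hi, show i + 1 + 1 = i + 2 by ring] at this
    rcases this with ⟨h3, h4⟩ | ⟨h3, h4⟩
    · exfalso
      have h5 : q + (((-1 : ℝ)) • v + (0 : ℝ) • w) = q + ((0 : ℝ) • v + L⁻¹ • w) := by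
        have : q = q + v + L⁻¹ • w := h4
        have h6 : v + L⁻¹ • w = 0 := by
          rw [add_assoc] at this; exact (left_eq_add.1 this)
        rw [(eq_neg_of_add_eq_zero_right h6)]; module
      have := (coord_unique hind h5).1
      norm_num at this
    · exact h3
  · refine ⟨i - 1, ?_⟩
    rw [show i - 1 + 2 = i + 1 by ring]
    refine hfin _ _ (Or.inr ⟨h1, ?_⟩)
    have := P.corner_nbrs hPF' hvn hw hL h2
    rw [sub_add_cancel, hi] at this
    rcases this with ⟨h3, h4⟩ | ⟨h3, h4⟩
    · exact h4
    · exfalso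
      have h5 : q + (((-1 : ℝ)) • v + (0 : ℝ) • w) = q + ((0 : ℝ) • v + L⁻¹ • w) := by
        have : q = q + v + L⁻¹ • w := h3
        have h6 : v + L⁻¹ • w = 0 := by
          rw [add_assoc] at this; exact (left_eq_add.1 this)
        rw [(eq_neg_of_add_eq_zero_right h6)]; module
      have := (coord_unique hind h5).1
      norm_num at this

theorem no_graph (hs : P.IsSpecial) {u : Pt → ℝ} (hu : JSGraph P u) : False := by
  obtain ⟨hmin, hbd⟩ := hu
  obtain ⟨ψ, hψ, hd⟩ := exists_conj P.convex hmin
  have hlip : ∀ p q : Pt, |ψ p - ψ q| ≤ ‖p - q‖ := by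
    intro p q
    have := hψ.dist_le_mul p q
    rw [NNReal.coe_one, one_mul, Real.dist_eq, dist_eq_norm] at this
    exact this
  have hE : ∀ k : ZMod (2 * n), Even k.val → ψ (P.vtx (k + 1)) - ψ (P.vtx k) = 1 := by
    intro k hk
    have h1 := P.edge_ge k hmin hψ hd (fun t ht => (hbd k t ht).1 hk)
    have h2 := (abs_le.1 (hlip (P.vtx (k + 1)) (P.vtx k))).2
    rw [show ‖P.vtx (k + 1) - P.vtx k‖ = 1 from P.norm_e k] at h2
    linarith
  have hO : ∀ k : ZMod (2 * n), ¬ Even k.val → ψ (P.vtx (k + 1)) - ψ (P.vtx k) = -1 := by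
    intro k hk
    have h1 := P.edge_le k hmin hψ hd (fun t ht => (hbd k t ht).2 hk)
    have h2 := (abs_le.1 (hlip (P.vtx (k + 1)) (P.vtx k))).1
    rw [show ‖P.vtx (k + 1) - P.vtx k‖ = 1 from P.norm_e k] at h2
    linarith
  obtain ⟨j, hj1, hj2⟩ := P.special_chord hs
  set y := P.vtx (j - 1) with hy
  set d := P.vtx (j + 2) - y with hdd
  have hnz := P.neZero
  obtain ⟨σ, hσ, hval⟩ : ∃ σ : ℝ, (σ = 1 ∨ σ = -1) ∧ ψ (y + d) - ψ y = σ := by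
    have hyd : y + d = P.vtx (j + 2) := by rw [hdd]; abel
    rw [hyd]
    have p1 : Even j.val ↔ ¬ Even (j - 1).val := by
      have := P.even_succ (j - 1); rwa [sub_add_cancel] at this
    have p2 := P.even_succ j
    by_cases hp : Even j.val
    · have a1 := hO (j - 1) (p1.1 hp)
      have a2 := hE j hp
      have a3 := hO (j + 1) (fun h => p2.1 h hp)
      rw [sub_add_cancel] at a1
      rw [show j + 1 + 1 = j + 2 by ring] at a3
      exact ⟨-1, Or.inr rfl, by linarith⟩
    · have a1 := hE (j - 1) (by by_contra h; exact hp (p1.2 h))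
      have a2 := hO j hp
      have a3 := hE (j + 1) (p2.2 hp)
      rw [sub_add_cancel] at a1
      rw [show j + 1 + 1 = j + 2 by ring] at a3
      exact ⟨1, Or.inl rfl, by linarith⟩
  have hlin : ∀ t ∈ Ioo (0 : ℝ) 1, ψ (y + t • d) = ψ y + σ * t := by
    rintro t ⟨t0, t1⟩
    have b1 := abs_le.1 (hlip (y + t • d) y)
    have b2 := abs_le.1 (hlip (y + d) (y + t • d))
    rw [add_sub_cancel_left, norm_smul, hj1, mul_one, Real.norm_eq_abs, abs_of_pos t0] at b1
    rw [show y + d - (y + t • d) = (1 - t) • d by module, norm_smul, hj1, mul_one, Real.norm_eq_abs,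
      abs_of_pos (sub_pos.2 t1)] at b2
    rcases hσ with rfl | rfl <;> linarith [b1.1, b1.2, b2.1, b2.2]
  have hline : HasDerivAt (fun t : ℝ => y + t • d) d (1 / 2) := by
    have := ((hasDerivAt_id (1 / 2 : ℝ)).smul_const d).const_add y
    simpa using this
  have hder := (hd _ hj2).comp_hasDerivAt (1 / 2 : ℝ) hline
  have hder2 : HasDerivAt (ψ ∘ fun t : ℝ => y + t • d) σ (1 / 2) := by
    have h0 : HasDerivAt (fun t : ℝ => ψ y + σ * t) σ (1 / 2) := by
      have := ((hasDerivAt_id (1 / 2 : ℝ)).const_mul σ).const_add (ψ y)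
      simpa using this
    apply h0.congr_of_eventuallyEq
    filter_upwards [Ioo_mem_nhds (show (0 : ℝ) < 1 / 2 by norm_num) (show (1 / 2 : ℝ) < 1 by norm_num)] with t ht
    exact hlin t ht
  have huniq := hder.unique hder2
  have hc : |inner ℝ (J (Xf u (y + (1 / 2 : ℝ) • d))) d| ≤ _ := abs_real_inner_le_norm _ _
  rw [norm_J, hj1, mul_one] at hc
  have hlt := norm_Xf_lt u (y + (1 / 2 : ℝ) • d)
  have huniq' : inner ℝ (J (Xf u (y + (1 / 2 : ℝ) • d))) d = σ := huniq
  rw [huniq'] at hc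
  rcases hσ with rfl | rfl <;> norm_num at hc <;> linarith

end UnitPolygon


/-- Jenkins–Serrin existence theorem for unit polygons: a bounded convex polygonal domain
with `2n` unit edges carries a Jenkins–Serrin graph (boundary values `+∞` on the edges
`(p_{2i}, p_{2i+1})` and `−∞` on the edges `(p_{2i−1}, p_{2i})`) if and only if it is not
special. -/
theorem jenkins_serrin_existence_iff_not_special
    (n : ℕ) (P : UnitPolygon n) :
    (∃ u : Pt → ℝ, JSGraph P u) ↔ ¬ P.IsSpecial := by
  constructor
  · rintro ⟨u, hu⟩ hs
    exact P.no_graph hs hu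
  · exact fun h => P.exists_graph h
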